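/- Let F be an infinite field with char(F) ≠ 2 and let u ∈ M_F be a linear combination of words containing no occurrence of x_1 or x_1^T. Let U ∈ M_3(R) be the 3×3 matrix obtained from u by substituting the generic matrix X_k for x_k and X_kᵀ for x_k^T for each k. Then the invariant tr(U X_1) ∈ R^{O(3)} is decomposable (lies in the square of the ideal of R^{O(3)} generated by all homogeneous invariants of positive degree) if and only if u = 0 in A_{3,d}. -/

import Mathlib

open FreeAlgebra MulOpposite

/-- The alphabet: `(k, false)` is the letter `x_{k+1}`, `(k, true)` is `x_{k+1}ᵀ`. -/
abbrev Ltr (d : ℕ) := Fin d × Bool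

/-- The free (unital) associative algebra on the `2d` letters.  The free non-unital
algebra `M_F` sits inside it as the span of the nonempty words. -/
abbrev FA (F : Type) [Field F] (d : ℕ) := FreeAlgebra F (Ltr d)

variable (F : Type) [Field F] (d : ℕ)

/-- The word in the free algebra corresponding to a list of letters
(the empty list gives `1`, the unit). -/
def wordOf (l : List (Ltr d)) : FA F d := (l.map (FreeAlgebra.ι F)).prod

/-- The transpose: the linear anti-automorphism with `x ↦ xᵀ`, `xᵀ ↦ x`. -/
def tp (a : FA F d) : FA F d :=
  ((FreeAlgebra.lift F fun p : Ltr d => op (FreeAlgebra.ι F (p.1, !p.2))) a).unop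

/-- `ā = a - aᵀ`. -/
def bar (a : FA F d) : FA F d := a - tp F d a

/-- `T(a,b,c) = a b̄ c̄ + b̄ aᵀ c̄ + b̄ c̄ a`. -/
def Trel (a b c : FA F d) : FA F d :=
  a * bar F d b * bar F d c + bar F d b * tp F d a * bar F d c + bar F d b * bar F d c * a

/-- The copy of the free non-unital algebra `M_F`, i.e. the span of the nonempty words. -/
def MFsub : Submodule F (FA F d) :=
  Submodule.span F {w | ∃ l : List (Ltr d), l ≠ [] ∧ w = wordOf F d l}

/-- The two-sided ideal such that `A_{3,d} = M_F / (idealA ∩ M_F)`: it is generated by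
`a³` for `a ∈ M_F` together with `T(a,b,c)` for `a, b, c ∈ M_F`.  (Since all generators lie in
`M_F`, its intersection with `M_F` is exactly the two-sided ideal of the non-unital algebra
`M_F` generated by these elements; in fact it is contained in `M_F`.)
An element `u ∈ M_F` is zero in `A_{3,d}` iff `u ∈ idealA F d`. -/
def idealA : TwoSidedIdeal (FA F d) :=
  TwoSidedIdeal.span
    ({x | ∃ a ∈ MFsub F d, x = a ^ 3} ∪
     {x | ∃ a ∈ MFsub F d, ∃ b ∈ MFsub F d, ∃ c ∈ MFsub F d, x = Trel F d a b c})

open Matrix MvPolynomial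

/-- The polynomial ring `R = F[x_{ij}(k)]`, `1 ≤ i,j ≤ 3`, `1 ≤ k ≤ d`. -/
abbrev Rpoly (F : Type) [Field F] (d : ℕ) := MvPolynomial (Fin 3 × Fin 3 × Fin d) F

variable (F : Type) [Field F] (d : ℕ)

/-- The `k`-th generic 3×3 matrix `X_k`. -/
noncomputable def genMat (k : Fin d) : Matrix (Fin 3) (Fin 3) (Rpoly F d) :=
  Matrix.of fun i j => MvPolynomial.X (i, j, k)

/-- The action of `g` on `R` by simultaneous conjugation: entries of `X_k` are replaced
by the entries of `gᵀ X_k g`. -/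
noncomputable def actHom (g : Matrix (Fin 3) (Fin 3) F) : Rpoly F d →ₐ[F] Rpoly F d :=
  MvPolynomial.aeval fun p : Fin 3 × Fin 3 × Fin d =>
    ((g.map (algebraMap F (Rpoly F d)))ᵀ * genMat F d p.2.2 *
      g.map (algebraMap F (Rpoly F d))) p.1 p.2.1

/-- The algebra `R^{O(3)}` of invariants of the orthogonal group. -/
noncomputable def invAlg : Subalgebra F (Rpoly F d) where
  carrier := {f | ∀ g : Matrix (Fin 3) (Fin 3) F, gᵀ * g = 1 → actHom F d g f = f}
  mul_mem' := by
    intro a b ha hb g hg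
    rw [_root_.map_mul, ha g hg, hb g hg]
  add_mem' := by
    intro a b ha hb g hg
    rw [_root_.map_add, ha g hg, hb g hg]
  one_mem' := by
    intro g hg
    exact map_one _
  algebraMap_mem' := by
    intro r g hg
    exact (actHom F d g).commutes r

/-- The ideal of `R^{O(3)}` generated by all homogeneous invariants of positive degree. -/
noncomputable def plusIdeal : Ideal (invAlg F d) :=
  Ideal.span {f | ∃ n : ℕ, 0 < n ∧ MvPolynomial.IsHomogeneous (f : Rpoly F d) n}

/-- The set of decomposable invariants: elements of `R^{O(3)}` lying in the square of the
ideal generated by all homogeneous invariants of positive degree. -/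
noncomputable def decompSet : Set (Rpoly F d) :=
  Subtype.val '' ((plusIdeal F d ^ 2 : Ideal (invAlg F d)) : Set (invAlg F d))

/-- Substitution of the generic matrices: `x_k ↦ X_k`, `x_kᵀ ↦ X_kᵀ`. -/
noncomputable def evMat : FA F d →ₐ[F] Matrix (Fin 3) (Fin 3) (Rpoly F d) :=
  FreeAlgebra.lift F fun p : Ltr d => if p.2 then (genMat F d p.1)ᵀ else genMat F d p.1


open FreeAlgebra MulOpposite
open Matrix MvPolynomial
set_option linter.all false

namespace Stmt17
noncomputable section
open Function (Injective comp_def)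
open Finset (sum_congr mem_univ sum_add_distrib univ mul_sum prod_congr)
open Fintype (equivFin sum_equiv)
open Submodule (smul_mem span_induction)
open SetLike (mem_coe)
open LinearMap (mem_ker)
open List (map_cons nodup_cons map_append map_congr_left range'_succ append_assoc prod_cons map_nil mem_map finRange ofFn map_ofFn)
open Or (inl inr)
open Option (some_inj)
open Bool (false_eq_true)
open Fin (sum_univ_two sum_univ_three)
open MultilinearMap (cons_smul curryLeft_apply compLinearMap_apply mkPiAlgebraFin_apply)
open Multiset (insert_eq_cons singleton_add cons_coe toFinsupp)
open Algebra (algebraMap_eq_smul_one)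
open TwoSidedIdeal (mem_mk' mul_mem_left mul_mem_right)
open AlgHom (commutes)
alias map_mul := _root_.map_mul
alias map_sub := _root_.map_sub
alias map_sum := _root_.map_sum
alias map_add := _root_.map_add
alias map_smul := _root_.map_smul
local notation "M3" => Matrix (Fin 3) (Fin 3)
local notation "N2" F => (2 : F) ≠ 0

section SFT
open Equiv
variable {α : Type} [Fintype α] [DecidableEq α]
def Fpf (σ : Perm α) : Prop := (∀ x, σ (σ x) = x) ∧ ∀ x, σ x ≠ x
def cj (q : Fin 4 ↪ α) (τ : Perm (Fin 4)) (σ : Perm α) : Perm α :=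
  τ.viaFintypeEmbedding q * σ * (τ.viaFintypeEmbedding q)⁻¹
def Ev (K : Type) [Field K] (σ : Perm α) (w : α → Fin 3) : K :=
  if ∀ x, w (σ x) = w x then 1 else 0
lemma via_not (q : Fin 4 ↪ α) (τ : Perm (Fin 4)) {x : α} (h : ∀ i, q i ≠ x) :
    τ.viaFintypeEmbedding q x = x :=
  Equiv.Perm.viaFintypeEmbedding_apply_notMem_range _ _ (by rintro ⟨i, hi⟩; exact h i hi)
lemma via_inv (q : Fin 4 ↪ α) (τ : Perm (Fin 4)) :
    (τ.viaFintypeEmbedding q)⁻¹ = (τ⁻¹).viaFintypeEmbedding q := by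
  rw [inv_eq_iff_mul_eq_one]
  ext x
  by_cases h : ∃ i, q i = x
  · obtain ⟨i, rfl⟩ := h
    simp
  · push Not at h
    simp [via_not q _ h]
lemma via_mul (q : Fin 4 ↪ α) (τ ρ : Perm (Fin 4)) :
    (τ * ρ).viaFintypeEmbedding q = τ.viaFintypeEmbedding q * ρ.viaFintypeEmbedding q := by
  ext x
  by_cases h : ∃ i, q i = x
  · obtain ⟨i, rfl⟩ := h
    simp
  · push Not at h
    simp [via_not q _ h]
lemma cj_q (q : Fin 4 ↪ α) (τ : Perm (Fin 4)) (σ : Perm α) (hd : ∀ i j, σ (q i) ≠ q j)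
    (i : Fin 4) : cj q τ σ (q (τ i)) = σ (q i) := by
  have h1 : (τ.viaFintypeEmbedding q)⁻¹ (q (τ i)) = q i := by
    rw [via_inv]; simp
  simp only [cj, Perm.mul_apply, h1]
  exact via_not q τ (fun j => (hd i j).symm)
lemma cj_p (q : Fin 4 ↪ α) (τ : Perm (Fin 4)) (σ : Perm α) (hσ : Fpf σ)
    (hd : ∀ i j, σ (q i) ≠ q j)
    (i : Fin 4) : cj q τ σ (σ (q i)) = q (τ i) := by
  have h1 : (τ.viaFintypeEmbedding q)⁻¹ (σ (q i)) = σ (q i) := by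
    rw [via_inv]; exact via_not q _ (fun j => (hd i j).symm)
  simp only [cj, Perm.mul_apply, h1, hσ.1]
  simp
lemma cj_other (q : Fin 4 ↪ α) (τ : Perm (Fin 4)) (σ : Perm α) (x : α)
    (h1 : ∀ i, q i ≠ x) (h2 : ∀ i, q i ≠ σ x) : cj q τ σ x = σ x := by
  have h3 : (τ.viaFintypeEmbedding q)⁻¹ x = x := by
    rw [via_inv]; exact via_not q _ h1
  simp only [cj, Perm.mul_apply, h3]
  exact via_not q _ h2
lemma cj_fpf (q : Fin 4 ↪ α) (τ : Perm (Fin 4)) (σ : Perm α) (hσ : Fpf σ) : Fpf (cj q τ σ) := by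
  constructor
  · intro x
    simp [cj, hσ.1]
  · intro x h
    simp only [cj, Perm.mul_apply] at h
    apply hσ.2 ((τ.viaFintypeEmbedding q)⁻¹ x)
    apply (τ.viaFintypeEmbedding q).injective
    rw [h]; simp
lemma cj_cj (q : Fin 4 ↪ α) (τ ρ : Perm (Fin 4)) (σ : Perm α) :
    cj q τ (cj q ρ σ) = cj q (τ * ρ) σ := by
  simp only [cj, via_mul, _root_.mul_inv_rev, mul_assoc]
variable {K : Type} [Field K]
lemma Ev_alt (h2 : (2 : K) ≠ 0) (q : Fin 4 ↪ α) (σ : Perm α) (w : α → Fin 3) :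
    ∑ τ : Perm (Fin 4), ((Perm.sign τ : ℤ) : K) * Ev K (cj q τ σ) w = 0 := by
  obtain ⟨i, j, hij, hw⟩ : ∃ i j : Fin 4, i ≠ j ∧ w (q i) = w (q j) := by
    by_contra hcon
    push Not at hcon
    have : Injective (fun i => w (q i)) := by
      intro i j h; by_contra hne; exact hcon i j hne h
    have := Fintype.card_le_of_injective _ this
    simp at this
  have hsw : ∀ x, w ((swap i j).viaFintypeEmbedding q x) = w x := by
    intro x
    by_cases h : ∃ k, q k = x
    · obtain ⟨k, rfl⟩ := h
      rw [Perm.viaFintypeEmbedding_apply_image]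
      rcases eq_or_ne k i with rfl | hi
      · simp [hw]
      rcases eq_or_ne k j with rfl | hj
      · simp [hw]
      rw [swap_apply_of_ne_of_ne hi hj]
    · push Not at h
      rw [via_not q _ h]
  have key : ∀ τ, Ev K (cj q (swap i j * τ) σ) w = Ev K (cj q τ σ) w := by
    intro τ
    rw [← cj_cj]
    unfold Ev
    congr 1
    apply propext
    constructor
    · intro h x
      have := h ((swap i j).viaFintypeEmbedding q x)
      rw [hsw] at this
      rw [← this]
      conv_rhs => rw [cj]
      simp [hsw]
    · intro h x
      have := h (((swap i j).viaFintypeEmbedding q)⁻¹ x)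
      rw [← hsw (((swap i j).viaFintypeEmbedding q)⁻¹ x)] at this
      rw [cj]
      simp only [Perm.mul_apply, hsw]
      rw [this]; simp
  have h1 : ∑ τ : Perm (Fin 4), ((Perm.sign τ : ℤ) : K) * Ev K (cj q τ σ) w
      = - ∑ τ : Perm (Fin 4), ((Perm.sign τ : ℤ) : K) * Ev K (cj q τ σ) w := by
    conv_lhs => rw [← Equiv.sum_comp (Equiv.mulLeft (swap i j))]
    rw [← Finset.sum_neg_distrib]
    apply sum_congr rfl
    intro τ _
    simp only [Equiv.coe_mulLeft, key, Perm.sign_mul, Perm.sign_swap hij]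
    push_cast; ring
  have h3 : (2 : K) * ∑ τ : Perm (Fin 4), ((Perm.sign τ : ℤ) : K) * Ev K (cj q τ σ) w = 0 := by
    linear_combination h1
  exact (mul_eq_zero.mp h3).resolve_left h2
section order
variable [LinearOrder α]
def GoodInv (σ : Perm α) : Prop :=
  ¬ ∃ a b c d : α, a < b ∧ b < c ∧ c < d ∧ σ a < σ b ∧ σ b < σ c ∧ σ c < σ d
def LexLt (σ τ : Perm α) : Prop := ∃ x, (∀ y < x, σ y = τ y) ∧ σ x < τ x
lemma lexlt_irrefl (σ : Perm α) : ¬ LexLt σ σ := by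
  rintro ⟨x, _, h⟩; exact lt_irrefl _ h
lemma lexlt_trans {σ τ ρ : Perm α} (h1 : LexLt σ τ) (h2 : LexLt τ ρ) : LexLt σ ρ := by
  obtain ⟨x, hx, hx'⟩ := h1
  obtain ⟨y, hy, hy'⟩ := h2
  rcases lt_trichotomy x y with h | rfl | h
  · exact ⟨x, fun z hz => (hx z hz).trans (hy z (hz.trans h)), by rw [← hy x h]; exact hx'⟩
  · exact ⟨x, fun z hz => (hx z hz).trans (hy z hz), hx'.trans hy'⟩
  · exact ⟨y, fun z hz => (hx z (hz.trans h)).trans (hy z hz), by rw [hx y h]; exact hy'⟩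
lemma lexlt_wf : WellFounded (fun σ τ : Perm α => LexLt σ τ) := by
  have : IsTrans (Perm α) (fun σ τ => LexLt σ τ) := ⟨fun _ _ _ h1 h2 => lexlt_trans h1 h2⟩
  have : Std.Irrefl (fun σ τ : Perm α => LexLt σ τ) := ⟨fun a => lexlt_irrefl a⟩
  exact Finite.wellFounded_of_trans_of_irrefl _
lemma lexgt_wf : WellFounded (fun σ τ : Perm α => LexLt τ σ) := by
  have : IsTrans (Perm α) (fun σ τ => LexLt τ σ) := ⟨fun _ _ _ h1 h2 => lexlt_trans h2 h1⟩
  have : Std.Irrefl (fun σ τ : Perm α => LexLt τ σ) := ⟨fun a => lexlt_irrefl a⟩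
  exact Finite.wellFounded_of_trans_of_irrefl _
lemma exists_first_diff {σ τ : Perm α} (h : σ ≠ τ) :
    ∃ x, (∀ y < x, σ y = τ y) ∧ σ x ≠ τ x := by
  have : ∃ x, σ x ≠ τ x := by
    by_contra hc; push Not at hc; exact h (Equiv.ext hc)
  have hne : (univ.filter (fun x => σ x ≠ τ x)).Nonempty := by
    obtain ⟨x, hx⟩ := this; exact ⟨x, by simpa using hx⟩
  refine ⟨Finset.min' _ hne, ?_, ?_⟩
  · intro y hy
    by_contra hc
    exact absurd (Finset.min'_le _ y (by simpa using hc)) (not_le.mpr hy)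
  · simpa using Finset.min'_mem _ hne
lemma straight {σ : Perm α} (hσ : Fpf σ) (hg : ¬ GoodInv σ) :
    ∃ q : Fin 4 ↪ α, (∀ i j, σ (q i) ≠ q j) ∧ ∀ τ, τ ≠ 1 → LexLt σ (cj q τ σ) := by
  unfold GoodInv at hg
  push Not at hg
  obtain ⟨a, b, c, d, hab, hbc, hcd, h1, h2, h3⟩ := hg
  let p : Fin 4 → α := ![a, b, c, d]
  have hp : StrictMono p := by
    rw [Fin.strictMono_iff_lt_succ]
    intro i; fin_cases i <;> simp [p, hab, hbc, hcd]
  have hq : StrictMono (fun i => σ (p i)) := by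
    rw [Fin.strictMono_iff_lt_succ]
    intro i; fin_cases i <;> simp [p, h1, h2, h3]
  let q : Fin 4 ↪ α := ⟨fun i => σ (p i), hq.injective⟩
  have hqp : ∀ i, σ (q i) = p i := fun i => hσ.1 _
  have hd : ∀ i j, σ (q i) ≠ q j := by
    intro i j h
    rw [hqp] at h
    change p i = σ (p j) at h
    have h' : σ (p i) = p j := by rw [h, hσ.1]
    rcases lt_trichotomy i j with hij | rfl | hij
    · have := hq hij
      simp only [← h, h'] at this
      exact absurd this (not_lt.mpr (hp hij).le)
    · exact hσ.2 _ h'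
    · have := hq hij
      simp only [← h, h'] at this
      exact absurd this (not_lt.mpr (hp hij).le)
  refine ⟨q, hd, ?_⟩
  intro τ hτ
  have hτne : cj q τ σ ≠ σ := by
    intro h
    apply hτ
    ext i
    have h4 := cj_p q τ σ hσ hd i
    rw [h, hσ.1] at h4
    rw [← q.injective h4]
    rfl
  obtain ⟨x, hx, hx'⟩ := exists_first_diff hτne.symm
  refine ⟨x, hx, ?_⟩
  have pv : ∀ i, cj q τ σ (p i) = q (τ i) := fun i => by
    have := cj_p q τ σ hσ hd i; rwa [hqp] at this
  have qv : ∀ i, cj q τ σ (q i) = p (τ⁻¹ i) := fun i => by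
    have := cj_q q τ σ hd (τ⁻¹ i); rw [hqp] at this; simpa using this
  have perm_aux : ∀ (ρ : Perm (Fin 4)) (a : Fin 4), (∀ b < a, ρ b = b) → ρ a ≠ a → a < ρ a := by
    intro ρ a h hne
    by_contra hlt
    have h5 : ρ a < a := lt_of_le_of_ne (not_lt.mp hlt) hne
    exact hne (ρ.injective (h _ h5))
  by_cases c1 : ∃ i, p i = x
  · obtain ⟨i, rfl⟩ := c1
    rw [pv]
    change q i < q (τ i)
    apply hq
    apply perm_aux
    · intro b hb
      have := hx _ (hp hb)
      rw [pv] at this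
      exact (q.injective this).symm
    · intro h
      apply hx'
      rw [pv, h]; rfl
  by_cases c2 : ∃ i, q i = x
  · obtain ⟨i, rfl⟩ := c2
    rw [qv, hqp]
    apply hp
    apply perm_aux
    · intro b hb
      have := hx _ (show q b < q i from hq hb)
      rw [qv, hqp] at this
      exact (hp.injective this).symm
    · intro h
      apply hx'
      rw [qv, h, hqp]
  exfalso
  apply hx'
  rw [cj_other]
  · intro i h; exact c2 ⟨i, h⟩
  · intro i h
    apply c1
    exact ⟨i, σ.injective h⟩
def A1 (σ : Perm α) (i : α) : Prop := ∃ j < i, σ j < σ i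
def A2 (σ : Perm α) (i : α) : Prop := ∃ j < i, σ j < σ i ∧ A1 σ j
open Classical in
def colr (σ : Perm α) (i : α) : Fin 3 := if A2 σ i then 2 else if A1 σ i then 1 else 0
lemma A1_inv {σ : Perm α} (hσ : Fpf σ) (i : α) : A1 σ (σ i) ↔ A1 σ i := by
  have : ∀ i, A1 σ i → A1 σ (σ i) := by
    rintro i ⟨j, h1, h2⟩
    exact ⟨σ j, h2, by rwa [hσ.1, hσ.1]⟩
  exact ⟨fun h => by simpa [hσ.1] using this _ h, this i⟩
lemma A2_inv {σ : Perm α} (hσ : Fpf σ) (i : α) : A2 σ (σ i) ↔ A2 σ i := by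
  have : ∀ i, A2 σ i → A2 σ (σ i) := by
    rintro i ⟨j, h1, h2, h3⟩
    exact ⟨σ j, h2, by rwa [hσ.1, hσ.1], (A1_inv hσ j).2 h3⟩
  exact ⟨fun h => by simpa [hσ.1] using this _ h, this i⟩
lemma colr_inv {σ : Perm α} (hσ : Fpf σ) (i : α) : colr σ (σ i) = colr σ i := by
  have e1 := A1_inv hσ i
  have e2 := A2_inv hσ i
  by_cases a : A1 σ i <;> by_cases b : A2 σ i <;> simp [colr, a, b, e1.trans (iff_of_eq rfl), e2, e1]
lemma A2_A1 {σ : Perm α} {i : α} (h : A2 σ i) : A1 σ i := by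
  obtain ⟨j, h1, h2, _⟩ := h; exact ⟨j, h1, h2⟩
lemma colr_dec {σ : Perm α} (hg : GoodInv σ) {i j : α} (hij : i < j)
    (hc : colr σ i = colr σ j) : σ j < σ i := by
  by_contra hcon
  have h1 : σ i < σ j := lt_of_le_of_ne (not_lt.mp hcon) (fun h => hij.ne (σ.injective h))
  have a1 : A1 σ j := ⟨i, hij, h1⟩
  have b1 : A1 σ i := by
    by_contra hn
    have : ¬ A2 σ i := fun h => hn (A2_A1 h)
    by_cases h5 : A2 σ j <;> simp [colr, hn, this, a1, h5] at hc
  have a2 : A2 σ j := ⟨i, hij, h1, b1⟩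
  have b2 : A2 σ i := by
    by_contra hn
    simp [colr, hn, a2, b1] at hc
  obtain ⟨k, hk, hk', m, hm, hm'⟩ := b2
  exact hg ⟨m, k, i, j, hm, hk, hij, hm', hk', h1⟩
lemma colr_le {σ τ : Perm α} (hσ : Fpf σ) (hg : GoodInv σ)
    (h : ∀ x, colr σ (τ x) = colr σ x) (hne : τ ≠ σ) : LexLt τ σ := by
  obtain ⟨x, hx, hx'⟩ := exists_first_diff hne
  refine ⟨x, hx, ?_⟩
  have hz : σ (σ (τ x)) = τ x := hσ.1 _
  rcases lt_trichotomy (σ (τ x)) x with h1 | h1 | h1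
  · have := hx _ h1
    rw [hz] at this
    have := τ.injective this
    exact absurd this h1.ne
  · exfalso; apply hx'
    rw [← h1, hz, h1]
  · have := colr_dec hg h1 (by rw [colr_inv hσ, h])
    rwa [hz] at this
end order
theorem sft {M : Type} [AddCommGroup M] [Module K M] (h2 : (2 : K) ≠ 0) (Ψ : Perm α → M)
    (hΨ : ∀ σ, Fpf σ → ∀ q : Fin 4 ↪ α, (∀ i j, σ (q i) ≠ q j) →
      ∑ τ : Perm (Fin 4), ((Perm.sign τ : ℤ) : K) • Ψ (cj q τ σ) = 0)
    (k : Perm α → K) (hk : ∀ σ, ¬ Fpf σ → k σ = 0)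
    (h : ∀ w : α → Fin 3, ∑ σ, k σ * Ev K σ w = 0) : ∑ σ, k σ • Ψ σ = 0 := by
  classical
  let _ : LinearOrder α := LinearOrder.lift' (equivFin α) (equivFin α).injective
  let N : Submodule K (Perm α → K) := Submodule.span K
    {f | ∃ σ, Fpf σ ∧ ∃ q : Fin 4 ↪ α, (∀ i j, σ (q i) ≠ q j) ∧
      f = ∑ τ : Perm (Fin 4), ((Perm.sign τ : ℤ) : K) • Pi.single (cj q τ σ) (1 : K)}
  let G : Submodule K (Perm α → K) := Submodule.span K
    {f | ∃ σ, Fpf σ ∧ GoodInv σ ∧ f = Pi.single σ (1 : K)}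
  have hstr : ∀ σ : Perm α, Fpf σ → (Pi.single σ (1 : K) : Perm α → K) ∈ N ⊔ G := by
    intro σ
    refine lexgt_wf.induction (C := fun σ : Perm α =>
      Fpf σ → (Pi.single σ (1 : K) : Perm α → K) ∈ N ⊔ G) σ ?_
    intro σ ih
    intro hσ
    by_cases hg : GoodInv σ
    · exact Submodule.mem_sup_right (Submodule.subset_span ⟨σ, hσ, hg, rfl⟩)
    obtain ⟨q, hd, hq⟩ := straight hσ hg
    have hA : (∑ τ : Perm (Fin 4), ((Perm.sign τ : ℤ) : K) • (Pi.single (cj q τ σ) (1 : K) : Perm α → K))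
        ∈ N ⊔ G := Submodule.mem_sup_left (Submodule.subset_span ⟨σ, hσ, q, hd, rfl⟩)
    rw [← Finset.add_sum_erase _ _ (mem_univ (1 : Perm (Fin 4)))] at hA
    have h1 : cj q 1 σ = σ := by
      have : (1 : Perm (Fin 4)).viaFintypeEmbedding q = 1 := by
        ext x
        by_cases h : ∃ i, q i = x
        · obtain ⟨i, rfl⟩ := h; simp
        · push Not at h; simp [via_not q _ h]
      simp [cj, this]
    rw [h1] at hA
    have hB : (∑ τ ∈ univ.erase (1 : Perm (Fin 4)),
        ((Perm.sign τ : ℤ) : K) • (Pi.single (cj q τ σ) (1 : K) : Perm α → K)) ∈ N ⊔ G := by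
      apply Submodule.sum_mem
      intro τ hτ
      apply smul_mem
      exact ih _ (hq τ (Finset.ne_of_mem_erase hτ)) (cj_fpf q τ σ hσ)
    have := Submodule.sub_mem _ hA hB
    simpa using this
  have hkmem : k ∈ N ⊔ G := by
    have : k = ∑ σ, k σ • (Pi.single σ (1 : K) : Perm α → K) := by
      ext ρ
      simp [Finset.sum_apply, Pi.single_apply]
    rw [this]
    apply Submodule.sum_mem
    intro σ _
    by_cases hσ : Fpf σ
    · exact smul_mem _ _ (hstr σ hσ)
    · rw [hk σ hσ, zero_smul]; exact Submodule.zero_mem _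
  obtain ⟨n, hn, g, hg, hng⟩ := Submodule.mem_sup.mp hkmem
  have hN : (∀ w, ∑ σ, n σ * Ev K σ w = 0) ∧ ∑ σ, n σ • Ψ σ = 0 := by
    let L : (Perm α → K) →ₗ[K] ((α → Fin 3) → K) × M :=
      LinearMap.prod
        (LinearMap.pi fun w => ∑ σ, (LinearMap.proj σ).smulRight (Ev K σ w))
        (∑ σ, (LinearMap.proj σ).smulRight (Ψ σ))
    have : N ≤ LinearMap.ker L := by
      apply Submodule.span_le.mpr
      rintro f ⟨σ, hσ, q, hd, rfl⟩
      rw [mem_coe, mem_ker, map_sum]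
      have e1 : ∀ τ : Perm (Fin 4), L (((Perm.sign τ : ℤ) : K) • Pi.single (cj q τ σ) (1 : K))
          = (fun w => ((Perm.sign τ : ℤ) : K) * Ev K (cj q τ σ) w,
             ((Perm.sign τ : ℤ) : K) • Ψ (cj q τ σ)) := by
        intro τ
        rw [map_smul]
        ext1
        · ext w
          simp [L, LinearMap.sum_apply, Pi.single_apply]
        · simp [L, LinearMap.sum_apply, Pi.single_apply]
      simp only [e1]
      ext1
      · ext w
        simp only [Prod.fst_sum, Finset.sum_apply]
        simpa using Ev_alt h2 q σ w
      · simp only [Prod.snd_sum]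
        simpa using hΨ σ hσ q hd
    have h0 := this hn
    rw [mem_ker] at h0
    constructor
    · intro w
      have := congrFun (congrArg Prod.fst h0) w
      simpa [L, LinearMap.sum_apply] using this
    · have := congrArg Prod.snd h0
      simpa [L, LinearMap.sum_apply] using this
  have hGs : ∀ σ, g σ ≠ 0 → Fpf σ ∧ GoodInv σ := by
    have : G ≤ ({ carrier := {f | ∀ σ, f σ ≠ 0 → Fpf σ ∧ GoodInv σ}
                  add_mem' := by
                    intro a b ha hb σ hσ
                    by_cases h : a σ = 0
                    · exact hb σ (by intro h'; apply hσ; simp [h, h'])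
                    · exact ha σ h
                  zero_mem' := by intro σ h; exact absurd rfl h
                  smul_mem' := by
                    intro c a ha σ hσ
                    exact ha σ (by intro h'; apply hσ; simp [h']) } : Submodule K (Perm α → K)) := by
      apply Submodule.span_le.mpr
      rintro f ⟨σ, hσ, hg, rfl⟩ ρ hρ
      by_cases e : ρ = σ
      · subst e; exact ⟨hσ, hg⟩
      · simp [Pi.single_apply, e] at hρ
    exact this hg
  have hgev : ∀ w, ∑ σ, g σ * Ev K σ w = 0 := by
    intro w
    have e1 := h w
    rw [← hng] at e1
    simp only [Pi.add_apply, add_mul, sum_add_distrib, hN.1 w, zero_add] at e1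
    exact e1
  have hg0 : ∀ σ, g σ = 0 := by
    intro σ
    refine lexlt_wf.induction (C := fun σ : Perm α => g σ = 0) σ ?_
    intro σ ih
    by_contra hne
    obtain ⟨hσ, hgd⟩ := hGs σ hne
    have e1 := hgev (colr σ)
    rw [Finset.sum_eq_single σ] at e1
    · rw [Ev, if_pos (colr_inv hσ), mul_one] at e1
      exact hne e1
    · intro τ _ hτ
      by_cases hc : ∀ x, colr σ (τ x) = colr σ x
      · rw [ih τ (colr_le hσ hgd hc hτ), zero_mul]
      · rw [Ev, if_neg hc, mul_zero]
    · intro h; exact absurd (mem_univ _) h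
  have : k = n := by
    rw [← hng]; ext σ; simp [hg0 σ]
  rw [this]; exact hN.2
end SFT
structure AS (F A : Type) [Field F] [Ring A] [Algebra F A] (t : A →ₗ[F] A)
    (M : Submodule F A) : Prop where
  two : N2 F
  t_mul : ∀ a b, t (a * b) = t b * t a
  t_one : t 1 = 1
  t_t : ∀ a, t (t a) = a
  t_mem : ∀ a ∈ M, t a ∈ M
  mul_l : ∀ a ∈ M, ∀ b, b * a ∈ M
  mul_r : ∀ a ∈ M, ∀ b, a * b ∈ M
  cube : ∀ a ∈ M, a * a * a = 0
  T : ∀ a ∈ M, ∀ b ∈ M, ∀ c ∈ M,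
    a * (b - t b) * (c - t c) + (b - t b) * t a * (c - t c) + (b - t b) * (c - t c) * a = 0
lemma AS.cub3 {F A : Type} [Field F] [Ring A] [Algebra F A] {t : A →ₗ[F] A}
    {M : Submodule F A} (h : AS F A t M) {a b c : A} (ha : a ∈ M) (hb : b ∈ M) (hc : c ∈ M) :
    a * b * c + a * c * b + b * a * c + b * c * a + c * a * b + c * b * a = 0 := by
  have e1 := h.cube _ (M.add_mem (M.add_mem ha hb) hc)
  have e2 := h.cube _ (M.add_mem ha hb)
  have e3 := h.cube _ (M.add_mem ha hc)
  have e4 := h.cube _ (M.add_mem hb hc)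
  have e5 := h.cube _ ha
  have e6 := h.cube _ hb
  have e7 := h.cube _ hc
  have : a * b * c + a * c * b + b * a * c + b * c * a + c * a * b + c * b * a =
    (a + b + c) * (a + b + c) * (a + b + c) - (a + b) * (a + b) * (a + b)
     - (a + c) * (a + c) * (a + c) - (b + c) * (b + c) * (b + c) + a * a * a + b * b * b
     + c * c * c := by noncomm_ring
  rw [this, e1, e2, e3, e4, e5, e6, e7]; simp
section formal
abbrev FW := List (Fin 3 × Bool)
def fflip (x : Fin 3 × Bool) : Fin 3 × Bool := (x.1, !x.2)
def fC (x y z : Fin 3 × Bool) : List (ℤ × FW) :=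
  [(1, [x, y, z]), (1, [x, z, y]), (1, [y, x, z]), (1, [y, z, x]), (1, [z, x, y]), (1, [z, y, x])]
def fT (a b c : Fin 3 × Bool) : List (ℤ × FW) :=
  [(1, [a, b, c]), (-1, [a, b, fflip c]), (-1, [a, fflip b, c]), (1, [a, fflip b, fflip c]),
   (1, [b, fflip a, c]), (-1, [b, fflip a, fflip c]), (-1, [fflip b, fflip a, c]),
   (1, [fflip b, fflip a, fflip c]),
   (1, [b, c, a]), (-1, [b, fflip c, a]), (-1, [fflip b, c, a]), (1, [fflip b, fflip c, a])]
def fneg (P : List (ℤ × FW)) : List (ℤ × FW) := P.map fun x => (-x.1, x.2)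
def fcert : Bool → Bool → Bool → List (ℤ × FW)
  | false, false, false => fC (0, false) (1, false) (2, false)
  | false, false, true => fneg (fT (0, false) (2, false) (1, false)) ++
      (fneg (fT (1, false) (2, false) (0, false)) ++ (fC (0, false) (1, false) (2, false) ++
       fneg (fC (0, false) (1, false) (2, true))))
  | false, true, false => fT (0, false) (1, false) (2, false)
  | false, true, true => fneg (fT (0, false) (1, false) (2, false)) ++
      (fT (0, true) (1, false) (2, false) ++ (fneg (fT (0, true) (2, false) (1, false)) ++
      (fneg (fT (1, false) (0, false) (2, false)) ++ (fT (1, true) (0, false) (2, false) ++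
      (fneg (fT (2, false) (1, false) (0, false)) ++ (fC (0, false) (1, false) (2, false) ++
       fneg (fC (0, false) (1, true) (2, false))))))))
  | true, false, false => fT (2, false) (0, false) (1, false)
  | true, false, true => fT (0, false) (2, false) (1, false) ++
      (fneg (fT (0, true) (2, false) (1, false)) ++ (fT (2, false) (0, false) (1, false) ++
       fneg (fT (2, true) (0, false) (1, false))))
  | true, true, false => fT (1, true) (0, false) (2, false)
  | true, true, true => fneg (fT (1, false) (2, false) (0, false)) ++
      (fneg (fT (2, false) (1, false) (0, false)) ++ (fC (0, false) (1, false) (2, false) ++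
       fneg (fC (0, true) (1, false) (2, false))))
def fmu (ty t s : Fin 4 → Bool × Fin 4) (x : Fin 4 × Bool) : Fin 4 × Bool :=
  if x.2 = (ty x.1).1 then ((s x.1).2, !(ty (s x.1).2).1) else ((t x.1).2, (ty (t x.1).2).1)
def fmu' (ty : Fin 4 → Bool) (t s : Fin 4 → Fin 4) (x : Fin 4 × Bool) : Fin 4 × Bool :=
  if x.2 = ty x.1 then (s x.1, !ty (s x.1)) else (t x.1, ty (t x.1))
def ocons (a : Fin 3 × Bool) : Option FW → Option FW
  | none => none
  | some l => some (a :: l)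
def trav (μ : Fin 4 × Bool → Fin 4 × Bool) : ℕ → Fin 4 × Bool → Option FW
  | 0, _ => none
  | n + 1, x => match μ x with
    | (0, true) => ocons (0, false) (trav μ n (1, false))
    | (1, true) => ocons (1, false) (trav μ n (2, false))
    | (2, true) => ocons (2, false) (trav μ n (3, false))
    | (3, true) => some []
    | (0, false) => none
    | (1, false) => ocons (0, true) (trav μ n (0, true))
    | (2, false) => ocons (1, true) (trav μ n (1, true))
    | (3, false) => ocons (2, true) (trav μ n (2, true))
inductive Path (μ : Fin 4 × Bool → Fin 4 × Bool) : Fin 4 × Bool → FW → Prop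
  | nil (x) : μ x = (3, true) → Path μ x []
  | fwd (x) (k : Fin 3) (L) : μ x = (k.castSucc, true) → Path μ (k.succ, false) L →
      Path μ x ((k, false) :: L)
  | bwd (x) (k : Fin 3) (L) : μ x = (k.succ, false) → Path μ (k.castSucc, true) L →
      Path μ x ((k, true) :: L)
lemma ocons_some {a : Fin 3 × Bool} {o : Option FW} {L : FW} (h : ocons a o = some L) :
    ∃ L', o = some L' ∧ L = a :: L' := by
  cases o with
  | none => simp [ocons] at h
  | some l => exact ⟨l, rfl, by simpa [ocons] using h.symm⟩
lemma trav_path (μ : Fin 4 × Bool → Fin 4 × Bool) : ∀ n x L, trav μ n x = some L → Path μ x L := by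
  intro n
  induction n with
  | zero => intro x L h; simp [trav] at h
  | succ n ih =>
    intro x L h
    rw [trav] at h
    split at h
    · obtain ⟨L', h1, rfl⟩ := ocons_some h
      exact Path.fwd x 0 L' (by assumption) (ih _ _ h1)
    · obtain ⟨L', h1, rfl⟩ := ocons_some h
      exact Path.fwd x 1 L' (by assumption) (ih _ _ h1)
    · obtain ⟨L', h1, rfl⟩ := ocons_some h
      exact Path.fwd x 2 L' (by assumption) (ih _ _ h1)
    · cases h; exact Path.nil x (by assumption)
    · cases h
    · obtain ⟨L', h1, rfl⟩ := ocons_some h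
      exact Path.bwd x 0 L' (by assumption) (ih _ _ h1)
    · obtain ⟨L', h1, rfl⟩ := ocons_some h
      exact Path.bwd x 1 L' (by assumption) (ih _ _ h1)
    · obtain ⟨L', h1, rfl⟩ := ocons_some h
      exact Path.bwd x 2 L' (by assumption) (ih _ _ h1)
def tup (f : Fin 4 → Fin 4) : Fin 4 × Fin 4 × Fin 4 × Fin 4 := (f 0, f 1, f 2, f 3)
def fn4 (a : Fin 4 × Fin 4 × Fin 4 × Fin 4) : Fin 4 → Fin 4 := ![a.1, a.2.1, a.2.2.1, a.2.2.2]
lemma fn4_tup (f : Fin 4 → Fin 4) : fn4 (tup f) = f := by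
  ext i; fin_cases i <;> rfl
def invf (t : Fin 4 → Fin 4) (j : Fin 4) : Fin 4 :=
  if t 0 = j then 0 else if t 1 = j then 1 else if t 2 = j then 2 else 3
lemma invf_eq (τ : Equiv.Perm (Fin 4)) : invf τ = τ.symm := by
  ext j
  obtain ⟨i, rfl⟩ := τ.surjective j
  simp only [invf, τ.injective.eq_iff, Equiv.symm_apply_apply]
  fin_cases i <;> simp
def perms4 : List (ℤ × (Fin 4 × Fin 4 × Fin 4 × Fin 4)) :=
  [(1, 0, 1, 2, 3), (-1, 0, 1, 3, 2), (-1, 0, 2, 1, 3), (1, 0, 2, 3, 1), (1, 0, 3, 1, 2),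
   (-1, 0, 3, 2, 1), (-1, 1, 0, 2, 3), (1, 1, 0, 3, 2), (1, 1, 2, 0, 3), (-1, 1, 2, 3, 0),
   (-1, 1, 3, 0, 2), (1, 1, 3, 2, 0), (1, 2, 0, 1, 3), (-1, 2, 0, 3, 1), (-1, 2, 1, 0, 3),
   (1, 2, 1, 3, 0), (1, 2, 3, 0, 1), (-1, 2, 3, 1, 0), (-1, 3, 0, 1, 2), (1, 3, 0, 2, 1),
   (1, 3, 1, 0, 2), (-1, 3, 1, 2, 0), (-1, 3, 2, 0, 1), (1, 3, 2, 1, 0)]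
set_option maxRecDepth 100000 in
lemma perms4_eq : (univ : Finset (Equiv.Perm (Fin 4))).val.map
    (fun τ => (((Equiv.Perm.sign τ : ℤˣ) : ℤ), tup τ)) = (perms4 : Multiset _) := by
  decide +kernel
def tr4 (ty : Fin 4 → Bool) (t : Fin 4 → Fin 4) : Option FW :=
  trav (fmu' ty t (invf t)) 4 (0, false)
def bb (a b c d : Bool) : Fin 4 → Bool := ![a, b, c, d]
def w48 : List FW :=
  ([[0, 1, 2], [0, 2, 1], [1, 0, 2], [1, 2, 0], [2, 0, 1], [2, 1, 0]] : List (List (Fin 3))).flatMap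
    fun p => ([[false, false, false], [false, false, true], [false, true, false],
      [false, true, true], [true, false, false], [true, false, true], [true, true, false],
      [true, true, true]] : List (List Bool)).map fun b => p.zip b
def cfl (P : List (ℤ × FW)) (w : FW) : ℤ := (P.map fun x => if x.2 = w then x.1 else 0).sum
def cft (ty : Fin 4 → Bool) (w : FW) : ℤ :=
  (perms4.map fun x => if tr4 ty (fn4 x.2) = some w then x.1 else 0).sum
def okL (L : FW) : Bool := decide (L.map Prod.fst).Nodup
set_option maxRecDepth 100000 in
lemma tr4_ok : ∀ a b c d : Bool, ∀ x ∈ perms4, ∃ L ∈ tr4 (bb a b c d) (fn4 x.2),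
    (L.map Prod.fst).Nodup ∧ (L.length = 3 → L ∈ w48) := by
  decide +kernel
set_option maxRecDepth 100000 in
lemma cert_ok : ∀ a b c d : Bool, ∀ w ∈ w48,
    cft (bb a b c d) w = cfl (fcert (xor a b) (xor a c) (xor a d)) w := by
  decide +kernel
set_option maxRecDepth 100000 in
lemma cert_mem : ∀ a b c : Bool, ∀ x ∈ fcert a b c, x.2 ∈ w48 := by
  decide +kernel
set_option maxRecDepth 100000 in
lemma w48_nodup : w48.Nodup := by decide +kernel
end formal
section formal2
variable {A : Type} [Ring A]
lemma sum_cfl (V : Fin 3 × Bool → A) (P : List (ℤ × FW)) :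
    (w48.map fun w => cfl P w • (w.map V).prod).sum =
    (P.map fun x => if x.2 ∈ w48 then x.1 • (x.2.map V).prod else 0).sum := by
  induction P with
  | nil => simp [cfl]
  | cons x P ih =>
    have : ∀ w, cfl (x :: P) w = (if x.2 = w then x.1 else 0) + cfl P w := fun w => by
      simp [cfl]
    simp only [this, add_smul, List.sum_map_add, ih, map_cons, List.sum_cons]
    congr 1
    have h1 : ∀ l : List FW, l.Nodup →
        (l.map fun w => (if x.2 = w then x.1 else 0) • (w.map V).prod).sum =
          if x.2 ∈ l then x.1 • (x.2.map V).prod else 0 := by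
      intro l
      induction l with
      | nil => simp
      | cons w l ih2 =>
        intro hl
        rw [nodup_cons] at hl
        simp only [map_cons, List.sum_cons, ih2 hl.2, List.mem_cons]
        by_cases e : x.2 = w
        · rw [if_pos e, if_neg (by rw [e]; exact hl.1), if_pos (inl e), e, add_zero]
        · rw [if_neg e, zero_smul, zero_add]
          simp [e]
    exact h1 _ w48_nodup
def vL (V : Fin 3 × Bool → A) (L : FW) : A := if L.length = 3 then (L.map V).prod else 0
lemma evP_cert {F : Type} [Field F] [Algebra F A] {t : A →ₗ[F] A}
    {M : Submodule F A} (h : AS F A t M) (V : Fin 3 × Bool → A) (hV : ∀ k, V k ∈ M)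
    (hVt : ∀ k, t (V k) = V (fflip k)) (a b c : Bool) :
    ((fcert a b c).map fun x => x.1 • (x.2.map V).prod).sum = 0 := by
  have hC : ∀ x y z, ((fC x y z).map fun x => x.1 • (x.2.map V).prod).sum = 0 := by
    intro x y z
    have := h.cub3 (hV x) (hV y) (hV z)
    rw [← this]
    simp [fC]
    noncomm_ring
  have hT : ∀ x y z, ((fT x y z).map fun x => x.1 • (x.2.map V).prod).sum = 0 := by
    intro x y z
    have := h.T _ (hV x) _ (hV y) _ (hV z)
    rw [← this]
    simp only [hVt]
    simp [fT]
    noncomm_ring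
  have hN : ∀ P : List (ℤ × FW), ((fneg P).map fun x => x.1 • (x.2.map V).prod).sum =
      - (P.map fun x => x.1 • (x.2.map V).prod).sum := by
    intro P
    induction P with
    | nil => simp [fneg]
    | cons x P ih =>
      simp only [fneg, map_cons, List.sum_cons] at ih ⊢
      rw [ih]; simp; abel
  cases a <;> cases b <;> cases c <;>
    simp only [fcert, map_append, List.sum_append, hN, hC, hT, neg_zero, add_zero]
theorem alt_formal {F : Type} [Field F] [Algebra F A] {t : A →ₗ[F] A}
    {M : Submodule F A} (h : AS F A t M) (V : Fin 3 × Bool → A) (hV : ∀ k, V k ∈ M)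
    (hVt : ∀ k, t (V k) = V (fflip k)) (ty : Fin 4 → Bool) :
    ∑ τ : Equiv.Perm (Fin 4), ((Equiv.Perm.sign τ : ℤˣ) : ℤ) •
      vL V ((tr4 ty τ).getD []) = 0 := by
  have e0 : ty = bb (ty 0) (ty 1) (ty 2) (ty 3) := by
    ext i; fin_cases i <;> rfl
  have e1 : ∑ τ : Equiv.Perm (Fin 4), ((Equiv.Perm.sign τ : ℤˣ) : ℤ) • vL V ((tr4 ty τ).getD [])
      = (perms4.map fun x => x.1 • vL V ((tr4 ty (fn4 x.2)).getD [])).sum := by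
    have := congrArg (fun m : Multiset (ℤ × (Fin 4 × Fin 4 × Fin 4 × Fin 4)) =>
      (m.map fun x => x.1 • vL V ((tr4 ty (fn4 x.2)).getD [])).sum) perms4_eq
    simp only [Multiset.map_map, comp_def, fn4_tup, Multiset.map_coe,
      Multiset.sum_coe] at this
    exact this
  rw [e1]
  let P : List (ℤ × FW) := perms4.map fun x => (x.1, (tr4 ty (fn4 x.2)).getD [])
  have hok : ∀ x ∈ perms4, ∃ L ∈ tr4 ty (fn4 x.2), (L.map Prod.fst).Nodup ∧
      (L.length = 3 → L ∈ w48) := by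
    rw [e0]; exact tr4_ok _ _ _ _
  have e2 : (perms4.map fun x => x.1 • vL V ((tr4 ty (fn4 x.2)).getD [])).sum =
      (P.map fun x => if x.2 ∈ w48 then x.1 • (x.2.map V).prod else 0).sum := by
    simp only [P, List.map_map]
    congr 1
    apply map_congr_left
    intro x hx
    obtain ⟨L, hL, _, h3⟩ := hok x hx
    rw [Option.mem_def] at hL
    simp only [Function.comp, hL, Option.getD_some, vL]
    have hl : ∀ w ∈ w48, w.length = 3 := by decide +kernel
    by_cases h4 : L.length = 3
    · rw [if_pos h4, if_pos (h3 h4)]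
    · rw [if_neg h4, if_neg (fun h5 => h4 (hl _ h5)), smul_zero]
  rw [e2, ← sum_cfl]
  have e3 : ∀ w ∈ w48, cfl P w = cfl (fcert (xor (ty 0) (ty 1)) (xor (ty 0) (ty 2)) (xor (ty 0) (ty 3))) w := by
    intro w hw
    rw [← cert_ok _ _ _ _ w hw, ← e0]
    simp only [cfl, cft, P, List.map_map]
    congr 1
    apply map_congr_left
    intro x hx
    obtain ⟨L, hL, _, h3⟩ := hok x hx
    rw [Option.mem_def] at hL
    simp [hL]
  rw [map_congr_left (fun w hw => by rw [e3 w hw]), sum_cfl,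
    map_congr_left (fun x hx => by rw [if_pos (cert_mem _ _ _ x hx)])]
  exact evP_cert h V hV hVt _ _ _
end formal2
section psi
open Equiv
variable {J : Type} [Fintype J] [DecidableEq J]
def th (x : J × Bool) : J × Bool := (x.1, !x.2)
@[simp] lemma th_th (x : J × Bool) : th (th x) = x := by simp [th]
@[simp] lemma th_fst (x : J × Bool) : (th x).1 = x.1 := rfl
lemma th_ne (x : J × Bool) : th x ≠ x := by
  intro h; have := congrArg Prod.snd h; simp [th] at this
def Lk (o : J) (σ : Perm (J × Bool)) (l : List (J × Bool)) : Prop :=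
  List.IsChain (fun x y => σ (th x) = y) ((o, false) :: (l ++ [(o, false)]))
def Ml (o : J) (l : List (J × Bool)) : Prop :=
  (o :: l.map Prod.fst).Nodup ∧ ∀ j, j ∈ o :: l.map Prod.fst
lemma lk_unique {o : J} {σ : Perm (J × Bool)} : ∀ (l l' : List (J × Bool)) (x : J × Bool),
    List.IsChain (fun x y => σ (th x) = y) (x :: (l ++ [(o, false)])) →
    List.IsChain (fun x y => σ (th x) = y) (x :: (l' ++ [(o, false)])) →
    o ∉ l.map Prod.fst → o ∉ l'.map Prod.fst → l = l' := by
  intro l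
  induction l with
  | nil =>
    intro l' x h1 h2 h3 h4
    cases l' with
    | nil => rfl
    | cons y l' =>
      exfalso
      simp at h1 h2
      apply h4
      rw [← h2.1, h1]; simp
  | cons y l ih =>
    intro l' x h1 h2 h3 h4
    cases l' with
    | nil =>
      exfalso
      simp at h1 h2
      apply h3
      rw [← h1.1, h2]; simp
    | cons y' l' =>
      simp only [List.cons_append, List.isChain_cons_cons] at h1 h2
      have : y = y' := h1.1.symm.trans h2.1
      subst this
      congr 1
      apply ih l' y h1.2 h2.2
      · intro h; apply h3; simp only [map_cons, List.mem_cons]; exact inr h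
      · intro h; apply h4; simp only [map_cons, List.mem_cons]; exact inr h
variable {A : Type} [Ring A]
open Classical in
def Psi (o : J) (W : J × Bool → A) (σ : Perm (J × Bool)) : A :=
  if h : ∃ l, Lk o σ l ∧ Ml o l then (h.choose.map W).prod else 0
lemma psi_val {o : J} (W : J × Bool → A) {σ : Perm (J × Bool)} {l : List (J × Bool)}
    (h1 : Lk o σ l) (h2 : Ml o l) : Psi o W σ = (l.map W).prod := by
  have h : ∃ l, Lk o σ l ∧ Ml o l := ⟨l, h1, h2⟩
  rw [Psi, dif_pos h]
  have := h.choose_spec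
  rw [lk_unique _ _ _ this.1 h1 (nodup_cons.mp this.2.1).1 (nodup_cons.mp h2.1).1]
lemma psi_zero {o : J} (W : J × Bool → A) {σ : Perm (J × Bool)} {l : List (J × Bool)}
    (h1 : Lk o σ l) (h2 : o ∉ l.map Prod.fst) (h3 : ¬ Ml o l) : Psi o W σ = 0 := by
  rw [Psi, dif_neg]
  rintro ⟨l', h4, h5⟩
  rw [lk_unique _ _ _ h4 h1 (nodup_cons.mp h5.1).1 h2] at h5
  exact h3 h5
lemma psi_closed {o : J} (W : J × Bool → A) {σ : Perm (J × Bool)} (S : Set J) (ho : o ∈ S)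
    (hS : ∀ x, x.1 ∈ S → (σ x).1 ∈ S) {j : J} (hj : j ∉ S) : Psi o W σ = 0 := by
  rw [Psi, dif_neg]
  rintro ⟨l, h1, h2⟩
  have key : ∀ (l : List (J × Bool)) x, x.1 ∈ S →
      List.IsChain (fun x y => σ (th x) = y) (x :: l) → ∀ y ∈ l, y.1 ∈ S := by
    intro l
    induction l with
    | nil => simp
    | cons z l ih =>
      intro x hx hc y hy
      rw [List.isChain_cons_cons] at hc
      have hz : z.1 ∈ S := by rw [← hc.1]; exact hS _ hx
      rcases List.mem_cons.mp hy with rfl | hy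
      · exact hz
      · exact ih z hz hc.2 y hy
  have h3 := h2.2 j
  rw [List.mem_cons] at h3
  rcases h3 with rfl | h3
  · exact hj ho
  · obtain ⟨x, hx, rfl⟩ := mem_map.mp h3
    exact hj (key _ _ ho h1 x (by simp [hx]))
end psi
section psialt
open Equiv
variable {J : Type} [Fintype J] [DecidableEq J]
lemma chain_range {β : Type} (R : β → β → Prop) (c : ℕ → β) : ∀ len s,
    (∀ m, s ≤ m → m + 1 < s + len → R (c m) (c (m + 1))) →
    List.IsChain R ((List.range' s len).map c) := by
  intro len
  induction len with
  | zero => intro s _; simp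
  | succ len ih =>
    intro s h
    rw [range'_succ, map_cons, List.isChain_cons]
    refine ⟨?_, ih _ (fun m h1 h2 => h m (by omega) (by omega))⟩
    intro y hy
    cases len with
    | zero => simp at hy
    | succ k =>
      rw [range'_succ, map_cons, List.head?_cons, Option.mem_def, some_inj] at hy
      subst hy
      exact h s le_rfl (by omega)
lemma path_chain {β : Type} (f : β → β) (g : β → β)
    (μ : Fin 4 × Bool → Fin 4 × Bool) (P : Fin 4 × Bool → β)
    (hP : ∀ x, f (P x) = P (μ x)) (s : Fin 3 × Bool → List β) (z : List β)
    (hs0 : ∀ k, s k ≠ [])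
    (hs : ∀ k, List.IsChain (fun x y => f (g x) = y) (s k))
    (hz : List.IsChain (fun x y => f (g x) = y) z)
    (hz' : ∀ y ∈ z.head?, y = P (3, true))
    (h1 : ∀ k, ∀ y ∈ (s (k, false)).head?, y = P (k.castSucc, true))
    (h2 : ∀ k, ∀ y ∈ (s (k, false)).getLast?, g y = P (k.succ, false))
    (h3 : ∀ k, ∀ y ∈ (s (k, true)).head?, y = P (k.succ, false))
    (h4 : ∀ k, ∀ y ∈ (s (k, true)).getLast?, g y = P (k.castSucc, true))
    {x : Fin 4 × Bool} {L : FW} (h : Path μ x L) :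
    List.IsChain (fun x y => f (g x) = y) (L.flatMap s ++ z) ∧
      ∀ y ∈ (L.flatMap s ++ z).head?, f (P x) = y := by
  induction h with
  | nil x h =>
    simp only [List.flatMap_nil, List.nil_append]
    exact ⟨hz, fun y hy => by rw [hP, h, hz' y hy]⟩
  | fwd x k L hx hp ih =>
    simp only [List.flatMap_cons, append_assoc]
    refine ⟨List.isChain_append.mpr ⟨hs _, ih.1, ?_⟩, ?_⟩
    · intro a ha b hb
      rw [h2 k a ha]; exact ih.2 b hb
    · intro y hy
      rw [List.head?_append_of_ne_nil _ (hs0 _)] at hy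
      rw [hP, hx, h1 k y hy]
  | bwd x k L hx hp ih =>
    simp only [List.flatMap_cons, append_assoc]
    refine ⟨List.isChain_append.mpr ⟨hs _, ih.1, ?_⟩, ?_⟩
    · intro a ha b hb
      rw [h4 k a ha]; exact ih.2 b hb
    · intro y hy
      rw [List.head?_append_of_ne_nil _ (hs0 _)] at hy
      rw [hP, hx, h3 k y hy]
lemma t_prod {F A : Type} [Field F] [Ring A] [Algebra F A] {t : A →ₗ[F] A}
    {M : Submodule F A} (h : AS F A t M) (o : J) (W : J × Bool → A)
    (hWt : ∀ x, x.1 ≠ o → t (W x) = W (th x)) :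
    ∀ l : List (J × Bool), (∀ x ∈ l, x.1 ≠ o) →
    t ((l.map W).prod) = (((l.map th).reverse).map W).prod := by
  intro l
  induction l with
  | nil => intro _; simp [h.t_one]
  | cons x l ih =>
    intro hl
    simp only [map_cons, prod_cons, h.t_mul, List.reverse_cons, map_append,
      List.prod_append, map_nil, List.prod_nil, mul_one]
    rw [ih (fun y hy => hl y (by simp [hy])), hWt x (hl x (by simp))]
lemma boolne : ∀ b c : Bool, ¬ b = c → b = !c := by decide
set_option maxHeartbeats 4000000 in
theorem psi_core {F A : Type} [Field F] [Ring A] [Algebra F A] {t : A →ₗ[F] A}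
    {M : Submodule F A} (h : AS F A t M) (o : J) (W : J × Bool → A)
    (hW : ∀ x, x.1 ≠ o → W x ∈ M) (hWt : ∀ x, x.1 ≠ o → t (W x) = W (th x))
    (σ : Perm (J × Bool)) (hσ : Fpf σ) (q : Fin 4 ↪ J × Bool) (hd : ∀ i j, σ (q i) ≠ q j)
    (c : ℕ → J × Bool) (n : ℕ) (c0 : c 0 = (o, false)) (cn : c (n + 1) = (o, false))
    (cs : ∀ m, c (m + 1) = σ (th (c m)))
    (cinj : ∀ m m', m ≤ n → m' ≤ n → (c m).1 = (c m').1 → m = m')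
    (csur : ∀ j, ∃ m ≤ n, (c m).1 = j)
    (pos : Fin 4 → ℕ) (hpos : StrictMono pos) (hpn : ∀ i, pos i ≤ n)
    (hq : ∀ i, q i = th (c (pos i)) ∨ q i = c (pos i + 1))
    (hun : ∀ m ≤ n, ∀ i, (q i = th (c m) ∨ q i = c (m + 1)) → pos i = m) :
    ∑ τ : Perm (Fin 4), ((Perm.sign τ : ℤˣ) : ℤ) • Psi o W (cj q τ σ) = 0 := by
  classical
  let P : Fin 4 × Bool → J × Bool := fun x => if x.2 then c (pos x.1 + 1) else th (c (pos x.1))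
  let ty : Fin 4 → Bool := fun i => decide (q i = c (pos i + 1))
  have hPq : ∀ i, P (i, ty i) = q i := by
    intro i
    by_cases e : q i = c (pos i + 1)
    · simp [P, ty, e]
    · have := (hq i).resolve_right e
      simp [P, ty, e, this]
      intro h'; rw [this] at e; exact absurd h' e
  have hPp : ∀ i, P (i, !ty i) = σ (q i) := by
    intro i
    by_cases e : q i = c (pos i + 1)
    · simp [P, ty, e]
      rw [cs, hσ.1]
    · have := (hq i).resolve_right e
      have e' : ty i = false := by simp [ty, e]
      rw [e', this, ← cs]; simp [P]
  let sg : ℕ → ℕ → List (J × Bool) := fun s len => (List.range' s len).map c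
  let a : Fin 3 → List (J × Bool) := fun k =>
    sg (pos k.castSucc + 1) (pos k.succ - pos k.castSucc)
  let z0 := sg 1 (pos 0)
  let z4 := sg (pos 3 + 1) (n - pos 3)
  let s : Fin 3 × Bool → List (J × Bool) := fun x =>
    if x.2 then ((a x.1).map th).reverse else a x.1
  have hlt : ∀ k : Fin 3, pos k.castSucc < pos k.succ := fun k => hpos (Fin.castSucc_lt_succ)
  have ha : ∀ k x, x ∈ a k ↔ ∃ m, pos k.castSucc < m ∧ m ≤ pos k.succ ∧ c m = x := by
    intro k x
    have := hlt k
    simp only [a, sg, mem_map, List.mem_range'_1]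
    constructor
    · rintro ⟨m, hm, rfl⟩; exact ⟨m, by omega, by omega, rfl⟩
    · rintro ⟨m, h1, h2, rfl⟩; exact ⟨m, by omega, rfl⟩
  have hz0 : ∀ x, x ∈ z0 ↔ ∃ m, 1 ≤ m ∧ m ≤ pos 0 ∧ c m = x := by
    intro x
    simp only [z0, sg, mem_map, List.mem_range'_1]
    constructor
    · rintro ⟨m, hm, rfl⟩; exact ⟨m, by omega, by omega, rfl⟩
    · rintro ⟨m, h1, h2, rfl⟩; exact ⟨m, by omega, rfl⟩
  have hz4 : ∀ x, x ∈ z4 ↔ ∃ m, pos 3 < m ∧ m ≤ n ∧ c m = x := by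
    intro x
    have := hpn 3
    simp only [z4, sg, mem_map, List.mem_range'_1]
    constructor
    · rintro ⟨m, hm, rfl⟩; exact ⟨m, by omega, by omega, rfl⟩
    · rintro ⟨m, h1, h2, rfl⟩; exact ⟨m, by omega, rfl⟩
  have hane : ∀ k, a k ≠ [] := by
    intro k h0
    have := (ha k (c (pos k.succ))).2 ⟨_, hlt k, le_rfl, rfl⟩
    rw [h0] at this; simp at this
  have hcne : ∀ m, 1 ≤ m → m ≤ n → (c m).1 ≠ o := by
    intro m h1 h2 h3
    have := cinj m 0 h2 (Nat.zero_le _) (by rw [h3, c0])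
    omega
  have hao : ∀ k, ∀ x ∈ a k, x.1 ≠ o := by
    intro k x hx
    obtain ⟨m, h1, h2, rfl⟩ := (ha k x).1 hx
    exact hcne m (by omega) (h2.trans (hpn _))
  let V : Fin 3 × Bool → A := fun k => ((s k).map W).prod
  have hVt : ∀ k, t (V k) = V (fflip k) := by
    rintro ⟨k, b⟩
    cases b
    · simp only [V, s, fflip, Bool.not_false, if_true, false_eq_true, if_false]
      exact t_prod h o W hWt _ (hao k)
    · simp only [V, s, fflip, Bool.not_true, if_true, false_eq_true, if_false]
      rw [← t_prod h o W hWt _ (hao k), h.t_t]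
  have hV0 : ∀ k, V (k, false) ∈ M := by
    intro k
    have : ∀ l : List (J × Bool), l ≠ [] → (∀ x ∈ l, x.1 ≠ o) → (l.map W).prod ∈ M := by
      intro l hl hx
      cases l with
      | nil => exact absurd rfl hl
      | cons x l =>
        rw [map_cons, prod_cons]
        exact h.mul_r _ (hW x (hx x (by simp))) _
    exact this _ (hane k) (hao k)
  have hV : ∀ k, V k ∈ M := by
    rintro ⟨k, b⟩
    cases b
    · exact hV0 k
    · have := hVt (k, false)
      rw [show fflip (k, false) = (k, true) from rfl] at this
      rw [← this]; exact h.t_mem _ (hV0 k)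
  have hsm : ∀ k x, x ∈ s k → ∃ m, pos k.1.castSucc < m ∧ m ≤ pos k.1.succ ∧ (c m).1 = x.1 := by
    rintro ⟨k, b⟩ x hx
    cases b
    · obtain ⟨m, h1, h2, rfl⟩ := (ha k x).1 hx
      exact ⟨m, h1, h2, rfl⟩
    · simp only [s, if_true, List.mem_reverse, mem_map] at hx
      obtain ⟨y, hy, rfl⟩ := hx
      obtain ⟨m, h1, h2, rfl⟩ := (ha k y).1 hy
      exact ⟨m, h1, h2, rfl⟩
  have hsp : ∀ k, ((s k).map Prod.fst).Perm ((a k.1).map Prod.fst) := by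
    rintro ⟨k, b⟩
    cases b
    · exact List.Perm.refl _
    · simp only [s, if_true, List.map_reverse, List.map_map]
      exact List.reverse_perm _
  have hp01 : pos 0 < pos 1 := hpos (by decide)
  have hp12 : pos 1 < pos 2 := hpos (by decide)
  have hp23 : pos 2 < pos 3 := hpos (by decide)
  have hp3n := hpn 3
  have hl : z0 ++ (a 0 ++ (a 1 ++ (a 2 ++ z4))) = sg 1 n := by
    have e : ∀ u v w x, v = u + x → sg u x ++ sg v w = sg u (x + w) := by
      intro u v w x hv
      subst hv
      simp only [sg, ← map_append, List.range'_append_1]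
    change sg _ _ ++ (sg (pos 0 + 1) (pos 1 - pos 0) ++ (sg (pos 1 + 1) (pos 2 - pos 1) ++
      (sg (pos 2 + 1) (pos 3 - pos 2) ++ sg _ _))) = _
    rw [e, e, e, e]
    · congr 1; omega
    all_goals omega
  have hMl : Ml o (sg 1 n) := by
    constructor
    · have : o :: (sg 1 n).map Prod.fst = (List.range (n + 1)).map (fun m => (c m).1) := by
        rw [List.range_eq_range', range'_succ]
        simp [sg, c0]
      rw [this]
      apply List.Nodup.map_on _ List.nodup_range
      intro x hx y hy hxy
      rw [List.mem_range] at hx hy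
      exact cinj x y (by omega) (by omega) hxy
    · intro j
      obtain ⟨m, hm, rfl⟩ := csur j
      rcases Nat.eq_zero_or_pos m with rfl | h0
      · rw [c0]; simp
      · apply List.mem_cons_of_mem
        simp only [sg, List.map_map, mem_map, List.mem_range'_1]
        exact ⟨m, by omega, rfl⟩
  have key : ∀ τ : Perm (Fin 4), Psi o W (cj q τ σ) =
      (z0.map W).prod * vL V ((tr4 ty τ).getD []) * (z4.map W).prod := by
    intro τ
    obtain ⟨L, hL, hLn, hL3⟩ : ∃ L ∈ tr4 ty τ, (L.map Prod.fst).Nodup ∧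
        (L.length = 3 → L ∈ w48) := by
      have e0 : ty = bb (ty 0) (ty 1) (ty 2) (ty 3) := by
        ext i; fin_cases i <;> rfl
      have hm : (((Perm.sign τ : ℤˣ) : ℤ), tup τ) ∈ perms4 := by
        rw [← Multiset.mem_coe, ← perms4_eq]
        exact Multiset.mem_map.mpr ⟨τ, Finset.mem_val.mpr (mem_univ τ), rfl⟩
      have := tr4_ok (ty 0) (ty 1) (ty 2) (ty 3) _ hm
      rw [← e0, fn4_tup] at this
      exact this
    rw [Option.mem_def] at hL
    have hpath := trav_path _ _ _ _ hL
    have hP : ∀ x, cj q τ σ (P x) = P (fmu' ty τ (invf τ) x) := by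
      rintro ⟨j, b⟩
      rw [invf_eq]
      by_cases e : b = ty j
      · subst e
        rw [hPq]
        have := cj_q q τ σ hd (τ.symm j)
        rw [Equiv.apply_symm_apply] at this
        rw [this]
        simp [fmu', hPp]
      · have e' : b = !ty j := boolne _ _ e
        subst e'
        rw [hPp, cj_p q τ σ hσ hd, ← hPq]
        simp [fmu']
    have hcj : ∀ m ≤ n, (∀ i, pos i ≠ m) → cj q τ σ (th (c m)) = c (m + 1) := by
      intro m hm hi
      rw [cj_other, cs]
      · intro i h'; exact hi i (hun m hm i (inl h'))
      · intro i h'; exact hi i (hun m hm i (inr (by rw [h', cs])))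
    have hposcases : ∀ i : Fin 4, i = 0 ∨ i = 1 ∨ i = 2 ∨ i = 3 := by decide
    have hachain : ∀ k, List.IsChain (fun x y => cj q τ σ (th x) = y) (a k) := by
      intro k
      apply chain_range
      intro m h1 h2
      have := hlt k
      have h3 := hpn k.succ
      apply hcj m (by omega)
      intro i hi
      have i1 : k.castSucc < i := hpos.lt_iff_lt.mp (by omega)
      have i2 : i < k.succ := hpos.lt_iff_lt.mp (by omega)
      have i3 : k.castSucc.val = k.val := rfl
      have i4 : k.succ.val = k.val + 1 := rfl
      have := Fin.lt_def.mp i1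
      have := Fin.lt_def.mp i2
      omega
    have hz4chain : List.IsChain (fun x y => cj q τ σ (th x) = y) (z4 ++ [(o, false)]) := by
      have : z4 ++ [(o, false)] = sg (pos 3 + 1) (n - pos 3 + 1) := by
        simp only [z4, sg, List.range'_concat, map_append, map_cons, map_nil]
        rw [← cn]; congr 3; omega
      rw [this]
      apply chain_range
      intro m h1 h2
      apply hcj m (by omega)
      intro i hi
      have := hpos.monotone (Fin.le_last i)
      change pos i ≤ pos 3 at this
      omega
    have hz0chain : List.IsChain (fun x y => cj q τ σ (th x) = y) ((o, false) :: z0) := by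
      have : (o, false) :: z0 = sg 0 (pos 0 + 1) := by
        simp only [z0, sg, range'_succ, map_cons, c0]
      rw [this]
      apply chain_range
      intro m h1 h2
      apply hcj m (by omega)
      intro i hi
      have := hpos.monotone (Fin.zero_le i)
      omega
    have ah : ∀ k, (a k).head? = some (c (pos k.castSucc + 1)) := by
      intro k
      have := hlt k
      obtain ⟨r, hr⟩ : ∃ r, pos k.succ - pos k.castSucc = r + 1 := ⟨pos k.succ - pos k.castSucc - 1, by omega⟩
      simp only [a, sg, hr, range'_succ, map_cons, List.head?_cons]
    have al : ∀ k, (a k).getLast? = some (c (pos k.succ)) := by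
      intro k
      have := hlt k
      obtain ⟨r, hr⟩ : ∃ r, pos k.succ - pos k.castSucc = r + 1 := ⟨pos k.succ - pos k.castSucc - 1, by omega⟩
      simp only [a, sg, hr, List.range'_concat, map_append, map_cons, map_nil,
        List.getLast?_concat]
      congr 2; omega
    have pc := path_chain (cj q τ σ) th (fmu' ty τ (invf τ)) P hP s (z4 ++ [(o, false)])
      (by rintro ⟨k, b⟩
          cases b
          · simpa [s] using hane k
          · simpa [s] using hane k)
      (by rintro ⟨k, b⟩
          cases b
          · simpa [s] using hachain k
          · simp only [s, if_true, List.isChain_reverse, List.isChain_map]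
            refine (hachain k).imp ?_
            intro x y hxy
            change cj q τ σ (th (th y)) = th x
            rw [th_th, ← hxy]
            exact (cj_fpf q τ σ hσ).1 _)
      hz4chain
      (by intro y hy
          have : z4 ++ [(o, false)] = sg (pos 3 + 1) (n - pos 3 + 1) := by
            simp only [z4, sg, List.range'_concat, map_append, map_cons, map_nil]
            rw [← cn]; congr 3; omega
          rw [this] at hy
          simp only [sg, range'_succ, map_cons, List.head?_cons, Option.mem_def,
            some_inj] at hy
          rw [← hy]; simp [P])
      (by intro k y hy
          simp only [s, false_eq_true, if_false, ah, Option.mem_def, some_inj] at hy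
          rw [← hy]; simp [P])
      (by intro k y hy
          simp only [s, false_eq_true, if_false, al, Option.mem_def, some_inj] at hy
          rw [← hy]; simp [P])
      (by intro k y hy
          simp only [s, if_true, List.head?_reverse, List.getLast?_map, al, Option.map_some, Option.mem_def,
            some_inj] at hy
          rw [← hy]; simp [P])
      (by intro k y hy
          simp only [s, if_true, List.getLast?_reverse, List.head?_map, ah, Option.map_some, Option.mem_def,
            some_inj] at hy
          rw [← hy]; simp [P])
      hpath
    have hLk : Lk o (cj q τ σ) (z0 ++ (L.flatMap s ++ z4)) := by
      unfold Lk
      rw [show (o, false) :: (z0 ++ (L.flatMap s ++ z4) ++ [(o, false)]) =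
        ((o, false) :: z0) ++ (L.flatMap s ++ (z4 ++ [(o, false)])) by simp]
      refine List.isChain_append.mpr ⟨hz0chain, pc.1, ?_⟩
      intro x hx y hy
      have : (o, false) :: z0 = sg 0 (pos 0 + 1) := by
        simp only [z0, sg, range'_succ, map_cons, c0]
      rw [this] at hx
      simp only [sg, List.range'_concat, map_append, map_cons, map_nil,
        List.getLast?_concat, Option.mem_def, some_inj] at hx
      rw [← pc.2 y hy, ← hx]
      simp [P]
    have hmem : ∀ x ∈ z0 ++ (L.flatMap s ++ z4), ∃ m, 1 ≤ m ∧ m ≤ n ∧ (c m).1 = x.1 ∧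
        ((m ≤ pos 0 ∨ pos 3 < m) ∨ ∃ k ∈ L.map Prod.fst, pos k.castSucc < m ∧ m ≤ pos k.succ) := by
      intro x hx
      rw [List.mem_append, List.mem_append] at hx
      rcases hx with hx | hx | hx
      · obtain ⟨m, h1, h2, rfl⟩ := (hz0 x).1 hx
        exact ⟨m, h1, h2.trans (hpn _), rfl, inl (inl h2)⟩
      · obtain ⟨k, hk, hx⟩ := List.mem_flatMap.mp hx
        obtain ⟨m, h1, h2, h3⟩ := hsm k x hx
        exact ⟨m, by omega, h2.trans (hpn _), h3, inr ⟨k.1, List.mem_map_of_mem hk, h1, h2⟩⟩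
      · obtain ⟨m, h1, h2, rfl⟩ := (hz4 x).1 hx
        exact ⟨m, by omega, h2, rfl, inl (inr h1)⟩
    rw [hL, Option.getD_some]
    by_cases h3 : L.length = 3
    · have hper : ((z0 ++ (L.flatMap s ++ z4)).map Prod.fst).Perm ((sg 1 n).map Prod.fst) := by
        rw [← hl]
        simp only [map_append]
        apply List.Perm.append_left
        have e1 : ((L.flatMap s).map Prod.fst).Perm
            ((L.map Prod.fst).flatMap fun k => (a k).map Prod.fst) := by
          clear hL hLn hL3 hpath pc hLk hmem h3
          induction L with
          | nil => simp
          | cons x L ih =>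
            simp only [List.flatMap_cons, map_cons, map_append]
            exact (hsp x).append ih
        have e2 : (L.map Prod.fst).Perm [0, 1, 2] := by
          have : (L.map Prod.fst).Perm (finRange 3) := by
            apply (List.subperm_of_subset hLn (fun x _ => List.mem_finRange x)).perm_of_length_le
            simp [h3]
          exact this.trans (by decide)
        have e3 := e1.trans (e2.flatMap_right (fun k => (a k).map Prod.fst))
        have e4 := e3.append_right (z4.map Prod.fst)
        simpa using e4
      have hMl' : Ml o (z0 ++ (L.flatMap s ++ z4)) := by
        have hp := hper.cons o
        exact ⟨hp.nodup_iff.mpr hMl.1, fun j => hp.mem_iff.mpr (hMl.2 j)⟩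
      rw [psi_val W hLk hMl', vL, if_pos h3]
      simp only [map_append, List.prod_append]
      have : ∀ L : FW, ((L.flatMap s).map W).prod = (L.map V).prod := by
        intro L
        induction L with
        | nil => simp
        | cons x L ih => simp only [List.flatMap_cons, map_append, List.prod_append, ih,
            map_cons, prod_cons, V]
      rw [this]; noncomm_ring
    · rw [vL, if_neg h3, mul_zero, zero_mul]
      apply psi_zero W hLk
      · intro ho
        obtain ⟨x, hx, rfl⟩ := mem_map.mp ho
        obtain ⟨m, h1, h2, h4, _⟩ := hmem x hx
        exact hcne m h1 h2 h4
      · intro hM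
        obtain ⟨k, hk⟩ : ∃ k, k ∉ L.map Prod.fst := by
          by_contra hcon
          push Not at hcon
          apply h3
          have : (L.map Prod.fst).Perm (finRange 3) :=
            (List.perm_ext_iff_of_nodup hLn (List.nodup_finRange 3)).mpr
              (fun x => ⟨fun _ => List.mem_finRange x, fun _ => hcon x⟩)
          simpa using this.length_eq
        have hk1 := hlt k
        have hk2 := hpn k.succ
        have := hM.2 (c (pos k.succ)).1
        rw [List.mem_cons] at this
        rcases this with h5 | h5
        · exact hcne _ (by omega) hk2 h5
        · obtain ⟨x, hx, hxe⟩ := mem_map.mp h5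
          obtain ⟨m, h1, h2, h4, h6⟩ := hmem x hx
          have : m = pos k.succ := cinj _ _ h2 hk2 (by rw [h4, hxe])
          subst this
          rcases h6 with (h6 | h6) | ⟨k', hk', h6, h7⟩
          · have := hpos.monotone (Fin.zero_le k.castSucc); omega
          · have := hpos.monotone (Fin.le_last k.succ)
            change pos k.succ ≤ pos 3 at this; omega
          · have i1 : k'.castSucc < k.succ := hpos.lt_iff_lt.mp h6
            have i2 : k.succ ≤ k'.succ := hpos.le_iff_le.mp h7
            apply hk
            have : k = k' := by
              have := Fin.lt_def.mp i1
              have := Fin.le_def.mp i2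
              simp at *
              omega
            rwa [this]
  simp only [key]
  have := alt_formal h V hV hVt ty
  have e : ∀ τ : Perm (Fin 4), ((Perm.sign τ : ℤˣ) : ℤ) • ((z0.map W).prod *
      vL V ((tr4 ty τ).getD []) * (z4.map W).prod) =
      (z0.map W).prod * (((Perm.sign τ : ℤˣ) : ℤ) • vL V ((tr4 ty τ).getD [])) * (z4.map W).prod := by
    intro τ; rw [mul_smul_comm, smul_mul_assoc]
  simp only [e]
  rw [← Finset.sum_mul, ← mul_sum, this]; simp
end psialt
section psialt2
open Equiv
variable {J : Type} [Fintype J] [DecidableEq J]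
lemma chain_iter {β : Type} (f : β → β) : ∀ (l : List β) (x : β),
    List.IsChain (fun x y => f x = y) (x :: l) →
    ∀ m (h : m < (x :: l).length), (x :: l)[m] = f^[m] x := by
  intro l
  induction l with
  | nil => intro x _ m h; simp at h; subst h; rfl
  | cons y l ih =>
    intro x hc m h
    rw [List.isChain_cons_cons] at hc
    cases m with
    | zero => rfl
    | succ m =>
      rw [List.getElem_cons_succ, ih y hc.2 m (by simpa using h), ← hc.1, Function.iterate_succ_apply]
lemma cj_sort {α : Type} [Fintype α] [DecidableEq α] (q : Fin 4 ↪ α) (ρ τ : Perm (Fin 4))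
    (σ : Perm α) : cj (ρ.toEmbedding.trans q) τ σ = cj q (ρ * τ * ρ⁻¹) σ := by
  have : τ.viaFintypeEmbedding (ρ.toEmbedding.trans q) = (ρ * τ * ρ⁻¹).viaFintypeEmbedding q := by
    ext x
    by_cases hx : ∃ i, q i = x
    · obtain ⟨i, rfl⟩ := hx
      rw [Perm.viaFintypeEmbedding_apply_image]
      have := Perm.viaFintypeEmbedding_apply_image τ (ρ.toEmbedding.trans q) (ρ.symm i)
      simp at this
      rw [this]; rfl
    · push Not at hx
      rw [via_not q _ hx, via_not _ _ (fun i => hx (ρ i))]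
  rw [cj, cj, this]
theorem psi_alt1 {F A : Type} [Field F] [Ring A] [Algebra F A] {t : A →ₗ[F] A}
    {M : Submodule F A} (h : AS F A t M) (o : J) (W : J × Bool → A)
    (hW : ∀ x, x.1 ≠ o → W x ∈ M) (hWt : ∀ x, x.1 ≠ o → t (W x) = W (th x))
    (σ : Perm (J × Bool)) (hσ : Fpf σ) (q : Fin 4 ↪ J × Bool) (hd : ∀ i j, σ (q i) ≠ q j)
    (l : List (J × Bool)) (hl : Lk o σ l) (hm : Ml o l) :
    ∑ τ : Perm (Fin 4), ((Perm.sign τ : ℤˣ) : ℤ) • Psi o W (cj q τ σ) = 0 := by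
  classical
  let f : J × Bool → J × Bool := fun x => σ (th x)
  let c : ℕ → J × Bool := fun m => f^[m] (o, false)
  have hc := chain_iter f _ _ hl
  have c0 : c 0 = (o, false) := rfl
  have cs : ∀ m, c (m + 1) = σ (th (c m)) := fun m => Function.iterate_succ_apply' _ _ _
  have cn : c (l.length + 1) = (o, false) := by
    have := hc (l.length + 1) (by simp)
    rw [List.getElem_cons_succ, List.getElem_append_right (le_refl _)] at this
    simp at this
    exact this.symm
  have cg : ∀ m (hm : m ≤ l.length), (c m).1 = (o :: l.map Prod.fst)[m]'(by simp; omega) := by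
    intro m hm'
    have := hc m (by simp; omega)
    change (f^[m] (o, false)).1 = _
    rw [← this]
    cases m with
    | zero => rfl
    | succ m =>
      simp only [List.getElem_cons_succ]
      rw [List.getElem_append_left (by omega), List.getElem_map]
  have cinj : ∀ m m', m ≤ l.length → m' ≤ l.length → (c m).1 = (c m').1 → m = m' := by
    intro m m' h1 h2 h3
    rw [cg m h1, cg m' h2] at h3
    exact (List.Nodup.getElem_inj_iff hm.1).mp h3
  have csur : ∀ j, ∃ m ≤ l.length, (c m).1 = j := by
    intro j
    obtain ⟨m, h1, h2⟩ := List.getElem_of_mem (hm.2 j)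
    have h3 : m ≤ l.length := by simp at h1; omega
    exact ⟨m, h3, by rw [cg m h3, h2]⟩
  clear_value c
  have hex : ∀ x : J × Bool, ∃ m ≤ l.length, x = th (c m) ∨ x = c (m + 1) := by
    intro x
    obtain ⟨m, h1, h2⟩ := csur x.1
    by_cases e : (c m).2 = x.2
    · have e' : c m = x := Prod.ext h2 e
      cases m with
      | zero => exact ⟨l.length, le_rfl, inr (by rw [cn, ← c0, e'])⟩
      | succ m => exact ⟨m, by omega, inr e'.symm⟩
    · refine ⟨m, h1, inl (Prod.ext h2.symm ?_)⟩
      exact boolne _ _ (fun h => e h.symm)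
  have thinj : ∀ x y : J × Bool, th x = th y → x = y := fun x y h => by
    rw [← th_th x, h, th_th]
  have aux : ∀ m m', m ≤ l.length → m' ≤ l.length → th (c m) ≠ c (m' + 1) := by
    intro m m' h1 h2 h3
    rcases Nat.lt_or_ge m' l.length with h4 | h4
    · have := cinj m (m' + 1) h1 h4 (by rw [← h3]; rfl)
      subst this
      exact th_ne _ h3
    · have : m' = l.length := by omega
      subst this
      rw [cn, ← c0] at h3
      have := cinj m 0 h1 (Nat.zero_le _) (by rw [← h3]; rfl)
      subst this
      exact th_ne _ h3
  have huni : ∀ x m m', m ≤ l.length → m' ≤ l.length → (x = th (c m) ∨ x = c (m + 1)) →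
      (x = th (c m') ∨ x = c (m' + 1)) → m = m' := by
    intro x m m' h1 h2 h3 h4
    rcases h3 with rfl | rfl <;> rcases h4 with h4 | h4
    · exact cinj _ _ h1 h2 (by rw [thinj _ _ h4])
    · exact absurd h4 (aux _ _ h1 h2)
    · exact absurd h4.symm (aux _ _ h2 h1)
    · rw [cs, cs] at h4
      exact cinj _ _ h1 h2 (by rw [thinj _ _ (σ.injective h4)])
  choose pos hp1 hp2 using fun i => hex (q i)
  have pinj : Injective pos := by
    intro i j hij
    have hi := hp2 i
    have hj := hp2 j
    rw [← hij] at hj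
    rcases hi with hi | hi <;> rcases hj with hj | hj
    · exact q.injective (hi.trans hj.symm)
    · exact absurd (by rw [hi, hj, cs]) (hd i j)
    · exact absurd (by rw [hi, hj, cs]) (hd j i)
    · exact q.injective (hi.trans hj.symm)
  let ρ : Perm (Fin 4) := Tuple.sort pos
  have hmono : StrictMono (pos ∘ ρ) :=
    (Tuple.monotone_sort pos).strictMono_of_injective (pinj.comp ρ.injective)
  have key := psi_core h o W hW hWt σ hσ (ρ.toEmbedding.trans q) (fun i j => hd _ _) c l.length
    c0 cn cs cinj csur (pos ∘ ρ) hmono (fun i => hp1 _) (fun i => hp2 _)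
    (fun m hm i hi => huni _ _ _ (hp1 _) hm (hp2 _) hi)
  rw [← key]
  refine (sum_equiv (MulAut.conj ρ).toEquiv _ _ ?_).symm
  intro τ
  rw [cj_sort]
  congr 2
  simp [MulAut.conj_apply, Perm.sign_mul]
  rw [mul_comm (Perm.sign ρ), mul_assoc, Int.units_mul_self, mul_one]
theorem psi_alt {F A : Type} [Field F] [Ring A] [Algebra F A] {t : A →ₗ[F] A}
    {M : Submodule F A} (h : AS F A t M) (o : J) (W : J × Bool → A)
    (hW : ∀ x, x.1 ≠ o → W x ∈ M) (hWt : ∀ x, x.1 ≠ o → t (W x) = W (th x))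
    (σ : Perm (J × Bool)) (hσ : Fpf σ) (q : Fin 4 ↪ J × Bool) (hd : ∀ i j, σ (q i) ≠ q j) :
    ∑ τ : Perm (Fin 4), (((Perm.sign τ : ℤˣ) : ℤ) : F) • Psi o W (cj q τ σ) = 0 := by
  simp only [Int.cast_smul_eq_zsmul]
  by_cases hx : ∃ τ0 l, Lk o (cj q τ0 σ) l ∧ Ml o l
  · obtain ⟨τ0, l, h1, h2⟩ := hx
    have hf := cj_fpf q τ0 σ hσ
    have hd' : ∀ i j, (cj q τ0 σ) (q i) ≠ q j := by
      intro i j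
      have := cj_q q τ0 σ hd (τ0.symm i)
      rw [Equiv.apply_symm_apply] at this
      rw [this]; exact hd _ _
    have := psi_alt1 h o W hW hWt (cj q τ0 σ) hf q hd' l h1 h2
    simp only [cj_cj] at this
    rw [← sum_equiv (Equiv.mulRight τ0)
      (fun τ => ((Perm.sign (τ * τ0) : ℤˣ) : ℤ) • Psi o W (cj q (τ * τ0) σ)) _ (fun τ => rfl)]
    have e : ∀ τ : Perm (Fin 4), ((Perm.sign (τ * τ0) : ℤˣ) : ℤ) • Psi o W (cj q (τ * τ0) σ) =
        ((Perm.sign τ0 : ℤˣ) : ℤ) • (((Perm.sign τ : ℤˣ) : ℤ) • Psi o W (cj q (τ * τ0) σ)) := by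
      intro τ
      rw [smul_smul, Perm.sign_mul, mul_comm]; simp
    simp only [e]
    rw [← Finset.smul_sum, this, smul_zero]
  · apply Finset.sum_eq_zero
    intro τ _
    rw [Psi, dif_neg, smul_zero]
    rintro ⟨l, h1, h2⟩
    exact hx ⟨τ, l, h1, h2⟩
end psialt2
section cl
variable {K : Type} [Field K] {β : Type} [Fintype β] [DecidableEq β]
lemma CL (t : Finset β → K) (b : ℕ) (hs : ∀ B, B.card ≠ b → t B = 0)
    (hu : ∀ X, ∑ S ∈ X.powerset, t S = t X) (hb : 2 * b < Fintype.card β) (B : Finset β) :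
    t B = 0 := by
  by_cases hB : B.card = b
  swap
  · exact hs B hB
  have h0 : ∀ Z ∈ B.powerset, ∑ S ∈ (Zᶜ).powerset, t S = 0 := by
    intro Z hZ
    rw [hu]
    apply hs
    have h1 := Finset.card_le_card (Finset.mem_powerset.mp hZ)
    have h2 := Finset.card_add_card_compl Z
    omega
  have h1 : ∑ Z ∈ B.powerset, (-1 : K) ^ Z.card * ∑ S ∈ (Zᶜ).powerset, t S = 0 :=
    Finset.sum_eq_zero (fun Z hZ => by rw [h0 Z hZ, mul_zero])
  have h2 : ∑ Z ∈ B.powerset, (-1 : K) ^ Z.card * ∑ S ∈ (Zᶜ).powerset, t S =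
      ∑ S : Finset β, t S * (∑ Z ∈ (B \ S).powerset, (-1 : ℤ) ^ Z.card : ℤ) := by
    simp only [Int.cast_sum, mul_sum]
    rw [Finset.sum_sigma', Finset.sum_sigma']
    refine Finset.sum_bij' (fun x _ => ⟨x.2, x.1⟩) (fun x _ => ⟨x.2, x.1⟩) ?_ ?_ ?_ ?_ ?_
    · rintro ⟨Z, S⟩ h
      simp only [Finset.mem_sigma, Finset.mem_powerset, mem_univ, true_and] at h ⊢
      intro x hx
      rw [Finset.mem_sdiff]
      exact ⟨h.1 hx, fun h' => Finset.mem_compl.mp (h.2 h') hx⟩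
    · rintro ⟨S, Z⟩ h
      simp only [Finset.mem_sigma, Finset.mem_powerset, mem_univ, true_and] at h ⊢
      refine ⟨fun x hx => (Finset.mem_sdiff.mp (h hx)).1, fun x hx => ?_⟩
      rw [Finset.mem_compl]
      exact fun h' => (Finset.mem_sdiff.mp (h h')).2 hx
    · intros; rfl
    · intros; rfl
    · rintro ⟨Z, S⟩ h
      simp [mul_comm]
  rw [h2] at h1
  rw [← h1, Finset.sum_eq_single B]
  · simp
  · intro S _ hne
    rw [Finset.sum_powerset_neg_one_pow_card]
    split_ifs with h
    · have h3 : B ⊆ S := Finset.sdiff_eq_empty_iff_subset.mp h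
      rw [hs S, zero_mul]
      intro h4
      exact hne (Finset.eq_of_subset_of_card_le h3 (by omega)).symm
    · simp
  · intro h; exact absurd (mem_univ _) h
end cl
section core
variable {K : Type} [Field K]
abbrev V3 (K : Type) := Fin 3 → K
def Th (v : V3 K) : Matrix (Fin 2) (Fin 2) K := !![v 1, 2 * v 2; -2 * v 0, -v 1]
def Uu (v : V3 K) : V3 K := ![v 0 + v 1 + v 2, v 1 + 2 * v 2, v 2]
def Hh (c : K) (v : V3 K) : V3 K := ![c ^ 2 * v 0, v 1, (c⁻¹) ^ 2 * v 2]
def Wd {n : ℕ} (v : Fin n → V3 K) (l : List (Fin n)) : Matrix (Fin 2) (Fin 2) K :=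
  (l.map fun i => Th (v i)).prod
def mon {n : ℕ} (L1 L2 : List (List (Fin n))) (v : Fin n → V3 K) : K :=
  (L1.map fun l => (Wd v l).trace).prod * (L2.map fun l => Wd v l 0 1).prod
def Adm (n s : ℕ) (L1 L2 : List (List (Fin n))) : Prop :=
  (L1.flatten ++ L2.flatten).Perm (finRange n) ∧ L2.length = s
def Cls (K : Type) [Field K] (n s : ℕ) : Submodule K ((Fin n → V3 K) → K) :=
  Submodule.span K {f | ∃ L1 L2, Adm n s L1 L2 ∧ f = mon L1 L2}
lemma wd_conj {n : ℕ} (m m' : Matrix (Fin 2) (Fin 2) K) (h : m * m' = 1) (f : V3 K → V3 K)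
    (hf : ∀ x, Th (f x) = m' * Th x * m) (v : Fin n → V3 K) (l : List (Fin n)) :
    Wd (fun i => f (v i)) l = m' * Wd v l * m := by
  have h' : m' * m = 1 := mul_eq_one_comm.mp h
  induction l with
  | nil => simp [Wd, h']
  | cons i l ih =>
    simp only [Wd, map_cons, prod_cons] at ih ⊢
    rw [ih, hf]
    generalize (List.map (fun i => Th (v i)) l).prod = Q
    calc m' * Th (v i) * m * (m' * Q * m) = m' * Th (v i) * (m * m') * Q * m := by
          simp only [mul_assoc]
      _ = _ := by rw [h]; simp only [mul_assoc, one_mul]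
lemma mon_U {n : ℕ} (L1 L2 : List (List (Fin n))) (v : Fin n → V3 K) :
    mon L1 L2 (fun i => Uu (v i)) = mon L1 L2 v := by
  have e : ∀ l, Wd (fun i => Uu (v i)) l = !![1, 0; -1, 1] * Wd v l * !![1, 0; 1, 1] := by
    apply wd_conj
    · ext i j; fin_cases i <;> fin_cases j <;> simp [Matrix.mul_apply, sum_univ_two]
    · intro x
      ext i j; fin_cases i <;> fin_cases j <;>
        simp [Matrix.mul_apply, sum_univ_two, Th, Uu] <;> ring
  simp only [mon, e]
  have e1 : ∀ W : Matrix (Fin 2) (Fin 2) K, (!![1, 0; -1, 1] * W * !![1, 0; 1, 1]).trace = W.trace := by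
    intro W
    simp only [trace_fin_two, Matrix.mul_apply, sum_univ_two]
    simp
  have e2 : ∀ W : Matrix (Fin 2) (Fin 2) K, ((!![1, 0; -1, 1] * W * !![1, 0; 1, 1] : Matrix (Fin 2) (Fin 2) K)) 0 1 = W 0 1 := by
    intro W
    simp only [Matrix.mul_apply, sum_univ_two]
    simp
  simp only [e1, e2]
lemma mon_H {n : ℕ} (L1 L2 : List (List (Fin n))) (v : Fin n → V3 K) (c : K) (hc : c ≠ 0) :
    c ^ (2 * L2.length) * mon L1 L2 (fun i => Hh c (v i)) = mon L1 L2 v := by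
  have e : ∀ l, Wd (fun i => Hh c (v i)) l = !![c⁻¹, 0; 0, c] * Wd v l * !![c, 0; 0, c⁻¹] := by
    apply wd_conj
    · ext i j; fin_cases i <;> fin_cases j <;> simp [Matrix.mul_apply, sum_univ_two, hc]
    · intro x
      ext i j; fin_cases i <;> fin_cases j <;>
        simp [Matrix.mul_apply, sum_univ_two, Th, Hh] <;> field_simp
  simp only [mon, e]
  have e1 : ∀ W : Matrix (Fin 2) (Fin 2) K, (!![c⁻¹, 0; 0, c] * W * !![c, 0; 0, c⁻¹]).trace = W.trace := by
    intro W
    simp only [trace_fin_two, Matrix.mul_apply, sum_univ_two]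
    simp
    field_simp
  have e2 : ∀ W : Matrix (Fin 2) (Fin 2) K, (!![c⁻¹, 0; 0, c] * W * !![c, 0; 0, c⁻¹]) 0 1 =
      (c⁻¹) ^ 2 * W 0 1 := by
    intro W
    simp only [Matrix.mul_apply, sum_univ_two]
    simp
    ring
  simp only [e1, e2]
  rw [List.prod_map_mul]
  simp only [List.map_const', List.prod_replicate]
  rw [← pow_mul, inv_pow]
  field_simp
lemma cls_U {n s : ℕ} {f : (Fin n → V3 K) → K} (hf : f ∈ Cls K n s) (v : Fin n → V3 K) :
    f (fun i => Uu (v i)) = f v := by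
  induction hf using span_induction with
  | mem x h => obtain ⟨L1, L2, h, rfl⟩ := h; exact mon_U L1 L2 v
  | zero => rfl
  | add x y _ _ h1 h2 => simp [h1, h2]
  | smul a x _ h => simp [h]
lemma cls_H {n s : ℕ} {f : (Fin n → V3 K) → K} (hf : f ∈ Cls K n s) (v : Fin n → V3 K)
    (c : K) (hc : c ≠ 0) : c ^ (2 * s) * f (fun i => Hh c (v i)) = f v := by
  induction hf using span_induction with
  | mem x h => obtain ⟨L1, L2, h, rfl⟩ := h; rw [← h.2]; exact mon_H L1 L2 v c hc
  | zero => simp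
  | add x y _ _ h1 h2 => simp [← h1, ← h2, mul_add]
  | smul a x _ h => simp [← h]; ring
def SLin {n : ℕ} {E : Type} [AddCommGroup E] [Module K E] (i : Fin n) (f : (Fin n → V3 K) → E) : Prop :=
  ∀ v, (∀ x y, f (Function.update v i (x + y)) = f (Function.update v i x) + f (Function.update v i y)) ∧
    ∀ (c : K) x, f (Function.update v i (c • x)) = c • f (Function.update v i x)
def SCon {n : ℕ} {E : Type} (i : Fin n) (f : (Fin n → V3 K) → E) : Prop :=
  ∀ v x y, f (Function.update v i x) = f (Function.update v i y)
lemma Th_add (x y : V3 K) : Th (x + y) = Th x + Th y := by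
  ext i j; fin_cases i <;> fin_cases j <;> simp [Th] <;> ring
lemma Th_smul (c : K) (x : V3 K) : Th (c • x) = c • Th x := by
  ext i j; fin_cases i <;> fin_cases j <;> simp [Th] <;> ring
lemma wd_con {n : ℕ} (i : Fin n) (l : List (Fin n)) (h : i ∉ l) :
    SCon (K := K) i (fun v => Wd v l) := by
  intro v x y
  simp only [Wd]
  congr 1
  apply map_congr_left
  intro j hj
  have : j ≠ i := fun e => h (e ▸ hj)
  simp [this]
lemma slin_mul_con {n : ℕ} {E : Type} [Ring E] [Algebra K E] (i : Fin n) {f g : (Fin n → V3 K) → E}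
    (hf : SLin i f) (hg : SCon i g) : SLin i (fun v => f v * g v) := by
  intro v
  refine ⟨fun x y => ?_, fun c x => ?_⟩
  · simp only [(hf v).1, add_mul]
    rw [hg v (x + y) x]; congr 2; exact hg v x y
  · simp only [(hf v).2, smul_mul_assoc]
    rw [hg v (c • x) x]
lemma con_mul_slin {n : ℕ} {E : Type} [Ring E] [Algebra K E] (i : Fin n) {f g : (Fin n → V3 K) → E}
    (hf : SCon i f) (hg : SLin i g) : SLin i (fun v => f v * g v) := by
  intro v
  refine ⟨fun x y => ?_, fun c x => ?_⟩
  · simp only [(hg v).1, mul_add]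
    rw [hf v (x + y) x]; congr 2; exact hf v x y
  · simp only [(hg v).2, mul_smul_comm]
    rw [hf v (c • x) x]
lemma con_mul_con {n : ℕ} {E : Type} [Ring E] (i : Fin n) {f g : (Fin n → V3 K) → E}
    (hf : SCon i f) (hg : SCon i g) : SCon i (fun v => f v * g v) := by
  intro v x y; simp only; rw [hf v x y, hg v x y]
lemma wd_lin {n : ℕ} (i : Fin n) (l : List (Fin n)) (h : i ∈ l) (hl : l.Nodup) :
    SLin (K := K) i (fun v => Wd v l) := by
  induction l with
  | nil => simp at h
  | cons j l ih =>
    rw [nodup_cons] at hl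
    have e : (fun v : Fin n → V3 K => Wd v (j :: l)) = fun v => Th (v j) * Wd v l := by
      ext v; simp [Wd]
    rw [e]
    by_cases hj : i = j
    · subst hj
      apply slin_mul_con i _ (wd_con i l hl.1)
      intro v
      exact ⟨fun x y => by simp [Th_add], fun c x => by simp [Th_smul]⟩
    · apply con_mul_slin i _ (ih ((List.mem_cons.mp h).resolve_left hj) hl.2)
      intro v x y
      have hj' : j ≠ i := fun h => hj h.symm
      simp only [Function.update_of_ne hj']
lemma list_con {n : ℕ} (i : Fin n) (φ : Matrix (Fin 2) (Fin 2) K →ₗ[K] K) (L : List (List (Fin n)))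
    (h : i ∉ L.flatten) : SCon (K := K) i (fun v => (L.map fun l => φ (Wd v l)).prod) := by
  intro v x y
  simp only
  congr 1
  apply map_congr_left
  intro l hl
  exact congrArg φ (wd_con i l (fun hi => h (List.mem_flatten.mpr ⟨l, hl, hi⟩)) v x y)
lemma list_lin {n : ℕ} (i : Fin n) (φ : Matrix (Fin 2) (Fin 2) K →ₗ[K] K) (L : List (List (Fin n)))
    (h : i ∈ L.flatten) (hL : L.flatten.Nodup) :
    SLin (K := K) i (fun v => (L.map fun l => φ (Wd v l)).prod) := by
  induction L with
  | nil => simp at h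
  | cons l L ih =>
    rw [List.flatten_cons] at h hL
    have hd := List.nodup_append.mp hL
    simp only [map_cons, prod_cons]
    by_cases hi : i ∈ l
    · apply slin_mul_con i _ (list_con i φ L (fun h' => hd.2.2 i hi i h' rfl))
      have := wd_lin (K := K) i l hi hd.1
      intro v
      exact ⟨fun x y => by simp only [(this v).1, map_add], fun c x => by simp only [(this v).2, map_smul]⟩
    · apply con_mul_slin i _ (ih ((List.mem_append.mp h).resolve_left hi) hd.2.1)
      intro v x y
      exact congrArg φ (wd_con i l hi v x y)
lemma mon_lin {n s : ℕ} (i : Fin n) {L1 L2 : List (List (Fin n))} (h : Adm n s L1 L2) :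
    SLin (K := K) i (mon L1 L2) := by
  have hn : (L1.flatten ++ L2.flatten).Nodup := h.1.nodup_iff.mpr (List.nodup_finRange n)
  have hi : i ∈ L1.flatten ++ L2.flatten := h.1.mem_iff.mpr (List.mem_finRange i)
  have hd := List.nodup_append.mp hn
  let φ1 : Matrix (Fin 2) (Fin 2) K →ₗ[K] K := Matrix.traceLinearMap (Fin 2) K K
  let φ2 : Matrix (Fin 2) (Fin 2) K →ₗ[K] K := Matrix.entryLinearMap K K 0 1
  have e : (mon L1 L2 : (Fin n → V3 K) → K) = fun v => (L1.map fun l => φ1 (Wd v l)).prod *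
    (L2.map fun l => φ2 (Wd v l)).prod := rfl
  rw [e]
  by_cases h1 : i ∈ L1.flatten
  · exact slin_mul_con i (list_lin i φ1 L1 h1 hd.1) (list_con i φ2 L2 (fun h' => hd.2.2 i h1 i h' rfl))
  · exact con_mul_slin i (list_con i φ1 L1 h1)
      (list_lin i φ2 L2 ((List.mem_append.mp hi).resolve_left h1) hd.2.1)
lemma cls_mul {n s : ℕ} {f : (Fin n → V3 K) → K} (hf : f ∈ Cls K n s) :
    ∃ M : MultilinearMap K (fun _ : Fin n => V3 K) K, ⇑M = f := by
  have hl : ∀ i, SLin i f := by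
    intro i
    induction hf using span_induction with
    | mem x h => obtain ⟨L1, L2, h, rfl⟩ := h; exact mon_lin i h
    | zero => intro v; simp
    | add x y _ _ h1 h2 =>
      intro v
      refine ⟨fun a b => ?_, fun c a => ?_⟩
      · simp only [Pi.add_apply, (h1 v).1, (h2 v).1]; ring
      · simp only [Pi.add_apply, (h1 v).2, (h2 v).2, smul_add]
    | smul a x _ h =>
      intro v
      refine ⟨fun p b => ?_, fun c p => ?_⟩
      · simp only [Pi.smul_apply, (h v).1, smul_add]
      · simp only [Pi.smul_apply, (h v).2]; rw [smul_comm]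
  refine ⟨⟨f, ?_, ?_⟩, rfl⟩
  · intro inst v i x y
    have := (hl i v).1 x y
    convert this
  · intro inst v i c x
    have := (hl i v).2 c x
    convert this
end core
section zerolem
variable {K : Type} [Field K]
lemma pow_sep [Infinite K] {a b : ℕ} (hab : a ≠ b) (t : K) (h : ∀ c : K, c ≠ 0 → c ^ a * t = c ^ b * t) :
    t = 0 := by
  by_contra ht
  have h1 : (Polynomial.X ^ (a + 1) - Polynomial.X ^ (b + 1) : Polynomial K) = 0 := by
    apply Polynomial.funext
    intro c
    simp only [Polynomial.eval_sub, Polynomial.eval_pow, Polynomial.eval_X, Polynomial.eval_zero]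
    by_cases hc : c = 0
    · simp [hc]
    · have := mul_right_cancel₀ ht (h c hc)
      rw [pow_succ, pow_succ, this, sub_self]
  have h2 := sub_eq_zero.mp h1
  have h3 := congrArg Polynomial.natDegree h2
  simp at h3
  exact hab h3
def fe (b : Bool) : Fin 2 → K := if b then ![0, 1] else ![1, 0]
def uu (a : Fin 2 → K) : Fin 2 → K := ![a 0 + a 1, a 1]
def hh (c : K) (a : Fin 2 → K) : Fin 2 → K := ![c * a 0, c⁻¹ * a 1]
variable {β : Type} [Fintype β] [DecidableEq β]
def yB (B : Finset β) : β → Fin 2 → K := fun x => fe (decide (x ∈ B))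
lemma G_expand (G : MultilinearMap K (fun _ : β => Fin 2 → K) K) (X : Finset β) :
    G (fun x => uu (yB X x)) = ∑ S ∈ X.powerset, G (yB S) := by
  have e : (fun x => uu (yB X x) : β → Fin 2 → K) =
      (fun x => if x ∈ X then fe true else 0) + (fun x => fe false) := by
    ext x j
    by_cases h : x ∈ X <;> fin_cases j <;> simp [uu, yB, fe, h]
  rw [e, MultilinearMap.map_add_univ]
  rw [← Finset.sum_subset (Finset.subset_univ X.powerset)]
  · apply sum_congr rfl
    intro S hS
    rw [Finset.mem_powerset] at hS
    congr 1
    ext x j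
    by_cases h : x ∈ S
    · simp [h, hS h, yB]
    · simp [h, yB]
  · intro S _ hS
    rw [Finset.mem_powerset, Finset.not_subset] at hS
    obtain ⟨x, h1, h2⟩ := hS
    apply G.map_coord_zero x
    simp [h1, h2]
lemma G_zero [Infinite K] (G : MultilinearMap K (fun _ : β => Fin 2 → K) K) (n : ℕ)
    (hn : Fintype.card β = 2 * n + 1)
    (hu : ∀ y, G (fun x => uu (y x)) = G y)
    (hw : ∀ c : K, c ≠ 0 → ∀ y, G (fun x => hh c (y x)) = c * G y) (B : Finset β) :
    G (yB B) = 0 := by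
  refine CL (fun B => G (yB B)) n ?_ ?_ (by omega) B
  · intro B hB
    apply pow_sep (a := Fintype.card β - B.card) (b := B.card + 1)
    · have := Finset.card_le_univ B
      omega
    · intro c hc
      have e : (fun x => hh c (yB B x) : β → Fin 2 → K) =
          fun x => (if x ∈ B then c⁻¹ else c) • yB B x := by
        ext x j
        by_cases h : x ∈ B <;> fin_cases j <;> simp [hh, yB, fe, h]
      have h1 := hw c hc (yB B)
      rw [e, MultilinearMap.map_smul_univ, Finset.prod_ite] at h1
      simp only [Finset.prod_const] at h1
      have e1 : (univ.filter fun x => x ∈ B) = B := by ext; simp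
      have e2 : (univ.filter fun x => x ∉ B) = Bᶜ := by ext; simp
      rw [e1, e2, Finset.card_compl, smul_eq_mul] at h1
      rw [pow_succ, mul_assoc, ← h1, inv_pow]
      field_simp
  · intro X
    rw [← G_expand, hu]
def ph (a b : Fin 2 → K) : V3 K := ![a 0 * b 0, a 0 * b 1 + a 1 * b 0, a 1 * b 1]
def Lz (a : Fin 2 → K) : V3 K := ![0, 2 * a 0, a 1]
def mm {n : ℕ} (y : Option (Fin n × Fin 2) → Fin 2 → K) : Fin (n + 1) → V3 K :=
  Fin.cons (Lz (y none)) (fun i => ph (y (some (i, 0))) (y (some (i, 1))))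
lemma mm_update {n : ℕ} (y : Option (Fin n × Fin 2) → Fin 2 → K) (k : Option (Fin n × Fin 2)) :
    ∃ (i : Fin (n + 1)) (f : (Fin 2 → K) →ₗ[K] V3 K), ∀ a,
      mm (Function.update y k a) = Function.update (mm y) i (f a) := by
  rcases k with _ | ⟨i, j⟩
  · refine ⟨0, ⟨⟨Lz, ?_⟩, ?_⟩, ?_⟩
    · intro a b; ext j; fin_cases j <;> simp [Lz] <;> ring
    · intro c a; ext j; fin_cases j <;> simp [Lz] <;> ring
    · intro a
      ext m : 1
      refine Fin.cases ?_ (fun m => ?_) m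
      · simp [mm]
      · simp [mm, Fin.succ_ne_zero]
  · have hj : j = 0 ∨ j = 1 := by fin_cases j <;> simp
    rcases hj with rfl | rfl
    · refine ⟨i.succ, ⟨⟨fun a => ph a (y (some (i, 1))), ?_⟩, ?_⟩, ?_⟩
      · intro a b; ext j; fin_cases j <;> simp [ph] <;> ring
      · intro c a; ext j; fin_cases j <;> simp [ph] <;> ring
      · intro a
        ext m : 1
        refine Fin.cases ?_ (fun m => ?_) m
        · simp [mm, (Fin.succ_ne_zero i).symm]
        · by_cases h : m = i
          · subst h; simp [mm]
          · have : m.succ ≠ i.succ := fun e => h (Fin.succ_injective _ e)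
            simp [mm, this, h]
    · refine ⟨i.succ, ⟨⟨fun a => ph (y (some (i, 0))) a, ?_⟩, ?_⟩, ?_⟩
      · intro a b; ext j; fin_cases j <;> simp [ph] <;> ring
      · intro c a; ext j; fin_cases j <;> simp [ph] <;> ring
      · intro a
        ext m : 1
        refine Fin.cases ?_ (fun m => ?_) m
        · simp [mm, (Fin.succ_ne_zero i).symm]
        · by_cases h : m = i
          · subst h; simp [mm]
          · have : m.succ ≠ i.succ := fun e => h (Fin.succ_injective _ e)
            simp [mm, this, h]
def GT {n : ℕ} (T : MultilinearMap K (fun _ : Fin (n + 1) => V3 K) K) :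
    MultilinearMap K (fun _ : Option (Fin n × Fin 2) => Fin 2 → K) K :=
  MultilinearMap.mk' (fun y => T (mm y))
    (by
      intro y k a b
      obtain ⟨i, f, hf⟩ := mm_update y k
      simp only [hf, map_add, MultilinearMap.map_update_add])
    (by
      intro y k c a
      obtain ⟨i, f, hf⟩ := mm_update y k
      simp only [hf, map_smul, MultilinearMap.map_update_smul])
lemma cons_add_smul {n : ℕ} (T : MultilinearMap K (fun _ : Fin (n + 1) => V3 K) K) (x y : V3 K) (c : K)
    (v : Fin n → V3 K) : T (Fin.cons (x + c • y) v) = T (Fin.cons x v) + c * T (Fin.cons y v) := by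
  rw [MultilinearMap.cons_add, cons_smul, smul_eq_mul]
lemma cons_map {n : ℕ} (f : V3 K → V3 K) (x : V3 K) (v : Fin n → V3 K) :
    (fun i => f ((Fin.cons x v : Fin (n + 1) → V3 K) i)) = (Fin.cons (f x) (fun i => f (v i)) : Fin (n + 1) → V3 K) := by
  ext i : 1
  refine Fin.cases ?_ (fun m => ?_) i <;> simp
theorem zero_lem [Infinite K] (h2 : (2 : K) ≠ 0) {n : ℕ} (T : MultilinearMap K (fun _ : Fin (n + 1) => V3 K) K)
    (hU : ∀ v, T (fun i => Uu (v i)) = T v)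
    (hH : ∀ c : K, c ≠ 0 → ∀ v, T (fun i => Hh c (v i)) = T v)
    (he : ∀ v : Fin n → V3 K, T (Fin.cons ![1, 0, 0] v) = 0) : T = 0 := by
  have key : ∀ B, T (mm (yB B)) = 0 := by
    apply G_zero (GT T) n (by simp; ring)
    · intro y
      change T (mm fun x => uu (y x)) = T (mm y)
      rw [← hU (mm y)]
      simp only [mm, cons_map]
      have e1 : Uu (Lz (y none)) = Lz (uu (y none)) + (2 * y none 0 + y none 1) • ![1, 0, 0] := by
        ext j; fin_cases j <;> simp [Uu, Lz, uu] <;> ring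
      have e2 : ∀ a b : Fin 2 → K, Uu (ph a b) = ph (uu a) (uu b) := by
        intro a b; ext j; fin_cases j <;> simp [Uu, ph, uu] <;> ring
      rw [e1, cons_add_smul, he]
      simp only [e2, mul_zero, add_zero]
    · intro c hc y
      change T (mm fun x => hh c (y x)) = c * T (mm y)
      rw [← hH c hc (mm y)]
      simp only [mm, cons_map]
      have e1 : Lz (hh c (y none)) = c • Hh c (Lz (y none)) := by
        ext j; fin_cases j <;> simp [Hh, Lz, hh] <;> field_simp
      have e2 : ∀ a b : Fin 2 → K, Hh c (ph a b) = ph (hh c a) (hh c b) := by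
        intro a b; ext j; fin_cases j <;> simp [Hh, ph, hh] <;> field_simp
      rw [e1, cons_smul]
      simp only [e2, smul_eq_mul]
  apply Module.Basis.ext_multilinear (fun _ => Pi.basisFun K (Fin 3))
  intro w
  simp only [Pi.basisFun_apply, MultilinearMap.zero_apply]
  have e : (fun i => Pi.single (w i) (1 : K) : Fin (n + 1) → V3 K) =
      Fin.cons (Pi.single (w 0) 1) (fun i => Pi.single (w i.succ) 1) := by
    ext i : 1
    refine Fin.cases ?_ (fun m => ?_) i <;> simp
  rw [e]
  by_cases h0 : w 0 = 0
  · rw [h0]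
    have : (Pi.single 0 1 : V3 K) = ![1, 0, 0] := by ext j; fin_cases j <;> simp
    rw [this]; exact he _
  · classical
    let B : Finset (Option (Fin n × Fin 2)) := univ.filter fun x =>
      (match x with
      | none => w 0 = 2
      | some (i, j) => w i.succ = 2 ∨ (w i.succ = 1 ∧ j = 1) : Prop)
    have a3 : ∀ k : Fin 3, k = 0 ∨ k = 1 ∨ k = 2 := by decide
    have hk := key B
    have e5 : (mm (yB B) : Fin (n + 1) → V3 K) = Fin.cons ((if w 0 = 2 then (1 : K) else 2) • Pi.single (w 0) 1)
        (fun i => Pi.single (w i.succ) 1) := by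
      simp only [mm, yB, B, Finset.mem_filter, mem_univ, true_and]
      congr 1
      · rcases (a3 (w 0)).resolve_left h0 with h | h <;> rw [h] <;> ext j <;> fin_cases j <;>
          simp [Lz, fe]
      · ext i j
        rcases a3 (w i.succ) with h | h | h <;> rw [h] <;> fin_cases j <;> simp [ph, fe]
    rw [e5, cons_smul, smul_eq_mul] at hk
    refine (mul_eq_zero.mp hk).resolve_left ?_
    split_ifs <;> simp [h2]
end zerolem
section corefft
variable {K : Type} [Field K]
def sL {n : ℕ} (L : List (List (Fin n))) : List (List (Fin (n + 1))) := L.map (List.map Fin.succ)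
lemma wd_succ {n : ℕ} (x : V3 K) (v : Fin n → V3 K) (l : List (Fin n)) :
    Wd (Fin.cons x v : Fin (n + 1) → V3 K) (l.map Fin.succ) = Wd v l := by
  simp [Wd, comp_def]
lemma sL_flat {n : ℕ} (L : List (List (Fin n))) : (sL L).flatten = L.flatten.map Fin.succ := by
  simp [sL, List.map_flatten]
lemma adm_sL {n s s' : ℕ} {L1 L2 : List (List (Fin n))} (h : Adm n s L1 L2)
    {M1 M2 : List (List (Fin (n + 1)))}
    (hp : (M1.flatten ++ M2.flatten).Perm (0 :: ((sL L1).flatten ++ (sL L2).flatten)))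
    (hs : M2.length = s') : Adm (n + 1) s' M1 M2 := by
  refine ⟨hp.trans ?_, hs⟩
  rw [List.finRange_succ, sL_flat, sL_flat, ← map_append]
  exact (h.1.map Fin.succ).cons 0
lemma mon_sL {n : ℕ} (x : V3 K) (v : Fin n → V3 K) (L1 L2 : List (List (Fin n))) :
    ((sL L1).map fun l => (Wd (Fin.cons x v : Fin (n + 1) → V3 K) l).trace).prod *
     ((sL L2).map fun l => Wd (Fin.cons x v : Fin (n + 1) → V3 K) l 0 1).prod = mon L1 L2 v := by
  simp only [mon, sL, List.map_map, comp_def, wd_succ]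
lemma lift1 (h2 : (2 : K) ≠ 0) {n s : ℕ} {f : (Fin n → V3 K) → K} (hf : f ∈ Cls K n (s + 1)) :
    ∃ M ∈ Cls K (n + 1) s, ∀ v : Fin n → V3 K, M (Fin.cons ![1, 0, 0] v) = f v := by
  induction hf using span_induction with
  | mem x h =>
    obtain ⟨L1, L2, h, rfl⟩ := h
    rcases L2 with _ | ⟨l, L2⟩
    · have := h.2; simp at this
    refine ⟨(-2⁻¹ : K) • mon ((0 :: l.map Fin.succ) :: sL L1) (sL L2),
      smul_mem _ _ (Submodule.subset_span ⟨_, _, adm_sL h ?_ ?_, rfl⟩), ?_⟩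
    · simp [sL]
      rw [← append_assoc, ← append_assoc]
      exact List.Perm.append_right _ List.perm_append_comm
    · have := h.2; simp at this; simp [sL, this]
    · intro v
      have e : (Wd (Fin.cons ![1, 0, 0] v : Fin (n + 1) → V3 K) (0 :: l.map Fin.succ)).trace =
          -2 * Wd v l 0 1 := by
        rw [← wd_succ ![1,0,0] v l]
        simp only [Wd, map_cons, prod_cons, Fin.cons_zero]
        simp only [trace_fin_two, Matrix.mul_apply, sum_univ_two, Th]
        simp
      simp only [Pi.smul_apply, smul_eq_mul, mon, map_cons, prod_cons]
      rw [e, mul_assoc, mon_sL]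
      simp only [mon]
      field_simp
  | zero => exact ⟨0, Submodule.zero_mem _, fun v => rfl⟩
  | add x y _ _ hx hy =>
    obtain ⟨M, hM, h1⟩ := hx
    obtain ⟨N, hN, h3⟩ := hy
    exact ⟨M + N, Submodule.add_mem _ hM hN, fun v => by simp [h1, h3]⟩
  | smul c x _ hx =>
    obtain ⟨M, hM, h1⟩ := hx
    exact ⟨c • M, smul_mem _ _ hM, fun v => by simp [h1]⟩
lemma lift2 {n s : ℕ} {f : (Fin n → V3 K) → K} (hf : f ∈ Cls K n (s + 1)) :
    ∃ M ∈ Cls K (n + 1) (s + 1), (∀ v : Fin n → V3 K, M (Fin.cons ![1, 0, 0] v) = 0) ∧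
      ∀ v : Fin n → V3 K, M (Fin.cons ![0, 1, 0] v) = f v := by
  induction hf using span_induction with
  | mem x h =>
    obtain ⟨L1, L2, h, rfl⟩ := h
    rcases L2 with _ | ⟨l, L2⟩
    · have := h.2; simp at this
    have e : ∀ x v, (Wd (Fin.cons x v : Fin (n + 1) → V3 K) (l.map Fin.succ ++ [0])) 0 1 =
          Wd v l 0 0 * (2 * x 2) - Wd v l 0 1 * x 1 := by
        intro x v
        rw [← wd_succ x v l]
        simp only [Wd, map_append, List.prod_append, map_cons, map_nil, prod_cons, Fin.cons_zero, List.prod_nil, mul_one]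
        simp only [Matrix.mul_apply, sum_univ_two, Th]
        simp [sub_eq_add_neg]
    refine ⟨(-1 : K) • mon (sL L1) ((l.map Fin.succ ++ [0]) :: sL L2),
      smul_mem _ _ (Submodule.subset_span ⟨_, _, adm_sL h ?_ ?_, rfl⟩), ?_, ?_⟩
    · simp [sL]
      rw [← append_assoc, ← append_assoc]
      exact List.perm_middle
    · have := h.2; simp at this; simp [sL, this]
    · intro v
      simp only [Pi.smul_apply, smul_eq_mul, mon, map_cons, prod_cons]
      rw [e]
      simp
    · intro v
      simp only [Pi.smul_apply, smul_eq_mul, mon, map_cons, prod_cons]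
      rw [e, mul_left_comm (List.prod _), mon_sL]
      simp [mon]
      ring
  | zero => exact ⟨0, Submodule.zero_mem _, fun v => rfl, fun v => rfl⟩
  | add x y _ _ hx hy =>
    obtain ⟨M, hM, h1, h1'⟩ := hx
    obtain ⟨N, hN, h3, h3'⟩ := hy
    exact ⟨M + N, Submodule.add_mem _ hM hN, fun v => by simp [h1, h3], fun v => by simp [h1', h3']⟩
  | smul c x _ hx =>
    obtain ⟨M, hM, h1, h1'⟩ := hx
    exact ⟨c • M, smul_mem _ _ hM, fun v => by simp [h1], fun v => by simp [h1']⟩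
lemma lift3 (h2 : (2 : K) ≠ 0) {n s : ℕ} {f : (Fin n → V3 K) → K} (hf : f ∈ Cls K n s) :
    ∃ M ∈ Cls K (n + 1) (s + 1), ∀ x, ∀ v : Fin n → V3 K, M (Fin.cons x v) = x 2 * f v := by
  induction hf using span_induction with
  | mem x h =>
    obtain ⟨L1, L2, h, rfl⟩ := h
    refine ⟨(2⁻¹ : K) • mon (sL L1) ([0] :: sL L2),
      smul_mem _ _ (Submodule.subset_span ⟨_, _, adm_sL h ?_ ?_, rfl⟩), ?_⟩
    · simp
    · have := h.2; simp [sL, this]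
    · intro x v
      have e : (Wd (Fin.cons x v : Fin (n + 1) → V3 K) [0]) 0 1 = 2 * x 2 := by
        simp [Wd, Th]
      simp only [Pi.smul_apply, smul_eq_mul, mon, map_cons, prod_cons]
      rw [e, mul_left_comm (List.prod _), mon_sL]
      simp only [mon]
      field_simp
  | zero => exact ⟨0, Submodule.zero_mem _, fun x v => by simp⟩
  | add x y _ _ hx hy =>
    obtain ⟨M, hM, h1⟩ := hx
    obtain ⟨N, hN, h3⟩ := hy
    exact ⟨M + N, Submodule.add_mem _ hM hN, fun x v => by simp [h1, h3, mul_add]⟩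
  | smul c x _ hx =>
    obtain ⟨M, hM, h1⟩ := hx
    exact ⟨c • M, smul_mem _ _ hM, fun x v => by simp [h1, mul_left_comm]⟩
def UInv {n : ℕ} (T : MultilinearMap K (fun _ : Fin n => V3 K) K) : Prop :=
  ∀ v, T (fun i => Uu (v i)) = T v
def HInv {n : ℕ} (s : ℕ) (T : MultilinearMap K (fun _ : Fin n => V3 K) K) : Prop :=
  ∀ c : K, c ≠ 0 → ∀ v, c ^ (2 * s) * T (fun i => Hh c (v i)) = T v
lemma cls_inv {n s : ℕ} {T : MultilinearMap K (fun _ : Fin n => V3 K) K} (h : ⇑T ∈ Cls K n s) :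
    UInv T ∧ HInv s T := ⟨fun v => cls_U h v, fun c hc v => cls_H h v c hc⟩
lemma sub_inv {n s : ℕ} {T M : MultilinearMap K (fun _ : Fin n => V3 K) K} (hT : UInv T ∧ HInv s T)
    (h : UInv M ∧ HInv s M) : UInv (T - M) ∧ HInv s (T - M) := by
  refine ⟨fun v => ?_, fun c hc v => ?_⟩
  · simp [hT.1 v, h.1 v]
  · simp [mul_sub, hT.2 c hc v, h.2 c hc v]
theorem core [Infinite K] (h2 : (2 : K) ≠ 0) : ∀ (n s : ℕ)
    (T : MultilinearMap K (fun _ : Fin n => V3 K) K), UInv T ∧ HInv s T → ⇑T ∈ Cls K n s := by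
  intro n
  induction n with
  | zero =>
    intro s T hT
    rcases Nat.eq_zero_or_pos s with rfl | hs
    · have : ⇑T = T 0 • mon [] [] := by
        ext v
        rw [Subsingleton.elim v 0]
        simp [mon]
      rw [this]
      exact smul_mem _ _ (Submodule.subset_span ⟨[], [], by simp [Adm], rfl⟩)
    · have : ⇑T = 0 := by
        ext v
        apply pow_sep (a := 2 * s) (b := 0) (by omega)
        intro c hc
        have := hT.2 c hc v
        rw [Subsingleton.elim (fun i => Hh c (v i)) v] at this
        rw [this]; simp
      rw [this]; exact Submodule.zero_mem _
  | succ n ih =>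
    intro s T hT
    have Ue : Uu (![1, 0, 0] : V3 K) = ![1, 0, 0] := by ext j; fin_cases j <;> simp [Uu]
    have Ue0 : Uu (![0, 1, 0] : V3 K) = ![0, 1, 0] + (1:K) • ![1, 0, 0] := by
      ext j; fin_cases j <;> simp [Uu]
    have Uem : Uu (![0, 0, 1] : V3 K) = (![0, 0, 1] + (2:K) • ![0, 1, 0]) + (1 : K) • ![1,0,0] := by
      ext j; fin_cases j <;> simp [Uu]
    have He : ∀ c : K, Hh c (![1, 0, 0] : V3 K) = (c ^ 2) • ![1, 0, 0] := by
      intro c; ext j; fin_cases j <;> simp [Hh]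
    have He0 : ∀ c : K, Hh c (![0, 1, 0] : V3 K) = ![0, 1, 0] := by
      intro c; ext j; fin_cases j <;> simp [Hh]
    have Hem : ∀ c : K, Hh c (![0, 0, 1] : V3 K) = ((c⁻¹) ^ 2) • ![0, 0, 1] := by
      intro c; ext j; fin_cases j <;> simp [Hh]
    have s1 : ⇑(T.curryLeft ![1, 0, 0]) ∈ Cls K n (s + 1) := by
      apply ih
      refine ⟨fun v => ?_, fun c hc v => ?_⟩
      · have := hT.1 (Fin.cons ![1, 0, 0] v)
        rw [cons_map, Ue] at this
        exact this
      · have := hT.2 c hc (Fin.cons ![1, 0, 0] v)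
        rw [cons_map, He, cons_smul, smul_eq_mul] at this
        rw [curryLeft_apply, curryLeft_apply, ← this]
        ring
    obtain ⟨f1, hf1, e1⟩ := lift1 h2 s1
    obtain ⟨M1, rfl⟩ := cls_mul hf1
    suffices h : ⇑(T - M1) ∈ Cls K (n + 1) s by
      have := Submodule.add_mem _ h hf1
      convert this using 1
      ext v; simp
    have hT1 := sub_inv hT (cls_inv hf1)
    have v1 : ∀ v : Fin n → V3 K, (T - M1) (Fin.cons ![1, 0, 0] v) = 0 := by
      intro v; rw [MultilinearMap.sub_apply, e1, curryLeft_apply, sub_self]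
    generalize T - M1 = T1 at hT1 v1
    rcases s with _ | s
    · have : T1 = 0 := by
        apply zero_lem h2 T1 hT1.1 _ v1
        intro c hc v
        simpa using hT1.2 c hc v
      rw [this]; exact Submodule.zero_mem _
    have s2 : ⇑(T1.curryLeft ![0, 1, 0]) ∈ Cls K n (s + 1) := by
      apply ih
      refine ⟨fun v => ?_, fun c hc v => ?_⟩
      · have := hT1.1 (Fin.cons ![0, 1, 0] v)
        rw [cons_map, Ue0, cons_add_smul, v1, mul_zero, add_zero] at this
        exact this
      · have := hT1.2 c hc (Fin.cons ![0, 1, 0] v)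
        rw [cons_map, He0] at this
        exact this
    obtain ⟨f2, hf2, e2, e2'⟩ := lift2 s2
    obtain ⟨M2, rfl⟩ := cls_mul hf2
    suffices h : ⇑(T1 - M2) ∈ Cls K (n + 1) (s + 1) by
      have := Submodule.add_mem _ h hf2
      convert this using 1
      ext v; simp
    have hT2 := sub_inv hT1 (cls_inv hf2)
    have v2 : ∀ v : Fin n → V3 K, (T1 - M2) (Fin.cons ![1, 0, 0] v) = 0 := by
      intro v; rw [MultilinearMap.sub_apply, e2, v1, sub_self]
    have v2' : ∀ v : Fin n → V3 K, (T1 - M2) (Fin.cons ![0, 1, 0] v) = 0 := by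
      intro v; rw [MultilinearMap.sub_apply, e2', curryLeft_apply, sub_self]
    generalize T1 - M2 = T2 at hT2 v2 v2'
    have s3 : ⇑(T2.curryLeft ![0, 0, 1]) ∈ Cls K n s := by
      apply ih
      refine ⟨fun v => ?_, fun c hc v => ?_⟩
      · have := hT2.1 (Fin.cons ![0, 0, 1] v)
        rw [cons_map, Uem, cons_add_smul, cons_add_smul, v2, v2', mul_zero, mul_zero, add_zero, add_zero] at this
        exact this
      · have := hT2.2 c hc (Fin.cons ![0, 0, 1] v)
        rw [cons_map, Hem, cons_smul, smul_eq_mul] at this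
        rw [curryLeft_apply, curryLeft_apply, ← this, inv_pow]
        field_simp
        ring
    obtain ⟨f3, hf3, e3⟩ := lift3 h2 s3
    convert hf3 using 1
    ext v
    rw [← Fin.cons_self_tail v, e3]
    have hv : v 0 = ((0 : V3 K) + v 0 0 • ![1, 0, 0] + v 0 1 • ![0, 1, 0]) + v 0 2 • ![0, 0, 1] := by
      ext j; fin_cases j <;> simp
    rw [hv, cons_add_smul, cons_add_smul, cons_add_smul, v2, v2']
    have : T2 (Fin.cons 0 (Fin.tail v)) = 0 := T2.map_coord_zero 0 (by simp)
    rw [this]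
    simp
end corefft
section dots
variable {K : Type} [Field K] {α : Type}
def dt (x y : V3 K) : K := x 0 * y 0 + x 1 * y 1 + x 2 * y 2
def de (x y z : V3 K) : K := x 0 * (y 1 * z 2 - y 2 * z 1) - x 1 * (y 0 * z 2 - y 2 * z 0) + x 2 * (y 0 * z 1 - y 1 * z 0)
def Qm (I : K) (x : V3 K) : V3 K := ![2⁻¹ * (x 0 - I * x 1), x 2, 2⁻¹ * (-x 0 - I * x 1)]
def dmon (D : List (α × α)) (v : α → V3 K) : K := (D.map fun p => dt (v p.1) (v p.2)).prod
def emon (E : List (α × α × α)) (v : α → V3 K) : K := (E.map fun p => de (v p.1) (v p.2.1) (v p.2.2)).prod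
def dlet (D : List (α × α)) : Multiset α := (D.map fun p => ({p.1, p.2} : Multiset α)).sum
def elet (E : List (α × α × α)) : Multiset α := (E.map fun p => ({p.1, p.2.1, p.2.2} : Multiset α)).sum
def BB (K : Type) [Field K] (s : Multiset α) : Submodule K ((α → V3 K) → K) :=
  Submodule.span K {f | ∃ D E, E.length ≤ 1 ∧ dlet D + elet E = s ∧ f = fun v => dmon D v * emon E v}
lemma bb_mul_mem (s t : Multiset α) (f g : (α → V3 K) → K) (hf : f ∈ BB K s) (hg : g ∈ BB K t) :
    f * g ∈ BB K (s + t) := by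
  induction hf using span_induction with
  | zero => rw [zero_mul]; exact Submodule.zero_mem _
  | add x y _ _ hx hy => rw [add_mul]; exact Submodule.add_mem _ hx hy
  | smul c x _ hx => rw [smul_mul_assoc]; exact smul_mem _ _ hx
  | mem x h =>
  obtain ⟨D, E, hE, hs, rfl⟩ := h
  induction hg using span_induction with
  | zero => rw [mul_zero]; exact Submodule.zero_mem _
  | add x y _ _ hx hy => rw [mul_add]; exact Submodule.add_mem _ hx hy
  | smul c x _ hx => rw [mul_smul_comm]; exact smul_mem _ _ hx
  | mem x h =>
  obtain ⟨D', E', hE', hs', rfl⟩ := h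
  subst hs hs'
  rcases E with _ | ⟨⟨a, b, c⟩, _ | ⟨_, _⟩⟩
  · apply Submodule.subset_span
    refine ⟨D ++ D', E', hE', by simp [dlet, elet]; abel, ?_⟩
    ext v; simp [dmon, emon]; ring
  · rcases E' with _ | ⟨⟨a', b', c'⟩, _ | ⟨_, _⟩⟩
    · apply Submodule.subset_span
      refine ⟨D ++ D', [(a, b, c)], by simp, by simp [dlet, elet]; abel, ?_⟩
      ext v; simp [dmon, emon]; ring
    · have key : ∀ x y z : α, ({x, y, z} : Multiset α) = {a', b', c'} →
          (fun v => dmon ((a, x) :: (b, y) :: (c, z) :: (D ++ D')) v : (α → V3 K) → K) ∈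
            BB K (dlet D + elet [(a, b, c)] + (dlet D' + elet [(a', b', c')])) := by
        intro x y z h
        apply Submodule.subset_span
        refine ⟨(a, x) :: (b, y) :: (c, z) :: (D ++ D'), [], by simp, ?_, ?_⟩
        · have e1 : elet [(a', b', c')] = ({x, y, z} : Multiset α) := by rw [h]; simp [elet]
          rw [e1]
          simp [dlet, elet, insert_eq_cons, ← singleton_add]
          abel
        · ext v; simp [emon]
      have p1 := key a' b' c' rfl
      have p2 := key b' c' a' (by simp only [insert_eq_cons, ← singleton_add]; abel)
      have p3 := key c' a' b' (by simp only [insert_eq_cons, ← singleton_add]; abel)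
      have p4 := key a' c' b' (by simp only [insert_eq_cons, ← singleton_add]; abel)
      have p5 := key b' a' c' (by simp only [insert_eq_cons, ← singleton_add]; abel)
      have p6 := key c' b' a' (by simp only [insert_eq_cons, ← singleton_add]; abel)
      have := Submodule.sub_mem _ (Submodule.add_mem _ (Submodule.add_mem _ p1 p2) p3)
        (Submodule.add_mem _ (Submodule.add_mem _ p4 p5) p6)
      convert this using 1
      ext v
      simp [dmon, emon, dt, de]
      ring
    · simp at hE'
  · simp at hE
lemma bb_one : (1 : (α → V3 K) → K) ∈ BB K (0 : Multiset α) :=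
  Submodule.subset_span ⟨[], [], by simp, by simp [dlet, elet], by ext; simp [dmon, emon]⟩
lemma bb_dt (x y : α) : (fun v => dt (v x) (v y) : (α → V3 K) → K) ∈ BB K ({x, y} : Multiset α) :=
  Submodule.subset_span ⟨[(x, y)], [], by simp, by simp [dlet, elet], by ext; simp [dmon, emon]⟩
lemma bb_de (x y z : α) : (fun v => de (v x) (v y) (v z) : (α → V3 K) → K) ∈ BB K ({x, y, z} : Multiset α) :=
  Submodule.subset_span ⟨[], [(x, y, z)], by simp, by simp [dlet, elet], by ext; simp [dmon, emon]⟩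
lemma th3 (h2 : (2 : K) ≠ 0) (I : K) (hI : I * I = -1) (x y z : V3 K) :
    Th (Qm I x) * Th (Qm I y) * Th (Qm I z) = dt x y • Th (Qm I z) - dt x z • Th (Qm I y) +
      dt y z • Th (Qm I x) - (I * de x y z) • 1 := by
  have e : ∀ x : V3 K, Th (Qm I x) = !![x 2, -x 0 - I * x 1; -x 0 + I * x 1, - x 2] := by
    intro x
    ext i j; fin_cases i <;> fin_cases j <;> simp [Th, Qm] <;> field_simp <;> ring
  simp only [e]
  ext i j
  fin_cases i <;> fin_cases j <;>
    simp only [Matrix.mul_apply, sum_univ_two] <;> simp [dt, de] <;> grind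
lemma th2 (h2 : (2 : K) ≠ 0) (I : K) (hI : I * I = -1) (x y : V3 K) :
    (Th (Qm I x) * Th (Qm I y)).trace = 2 * dt x y := by
  have e : ∀ x : V3 K, Th (Qm I x) = !![x 2, -x 0 - I * x 1; -x 0 + I * x 1, - x 2] := by
    intro x
    ext i j; fin_cases i <;> fin_cases j <;> simp [Th, Qm] <;> field_simp <;> ring
  simp only [e]
  simp only [Matrix.mul_apply, sum_univ_two, trace_fin_two]
  simp [dt]
  grind
def QW (I : K) (v : α → V3 K) (l : List α) : Matrix (Fin 2) (Fin 2) K :=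
  (l.map fun i => Th (Qm I (v i))).prod
lemma tr_bb (h2 : (2 : K) ≠ 0) (I : K) (hI : I * I = -1) : ∀ (n : ℕ) (l : List α), l.length ≤ n →
    (fun v => (QW I v l).trace : (α → V3 K) → K) ∈ BB K (l : Multiset α) := by
  intro n
  induction n with
  | zero =>
    intro l hl
    have : l = [] := by simpa using hl
    subst this
    have := smul_mem _ (2 : K) (bb_one (α := α) (K := K))
    have e : (fun v => (QW I v ([] : List α)).trace : (α → V3 K) → K) = (2 : K) • 1 := by
      ext v; simp [QW]
    rw [e]; exact this
  | succ n ih =>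
    intro l hl
    rcases l with _ | ⟨x, _ | ⟨y, _ | ⟨z, l⟩⟩⟩
    · exact ih [] (by simp)
    · convert Submodule.zero_mem _ using 1
      ext v; simp [QW, Th, trace_fin_two]
    · have e : (fun v => (QW I v [x, y]).trace : (α → V3 K) → K) = (2 : K) • fun v => dt (v x) (v y) := by
        ext v
        simp [QW, th2 h2 I hI]
      rw [e]; exact smul_mem _ (2 : K) (bb_dt x y)
    · simp at hl
      have a1 := bb_mul_mem _ _ _ _ (bb_dt x y) (ih (z :: l) (by simp; omega))
      have a2 := bb_mul_mem _ _ _ _ (bb_dt x z) (ih (y :: l) (by simp; omega))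
      have a3 := bb_mul_mem _ _ _ _ (bb_dt y z) (ih (x :: l) (by simp; omega))
      have a4 := bb_mul_mem _ _ _ _ (bb_de x y z) (ih l (by omega))
      have e0 : ((x :: y :: z :: l : List α) : Multiset α) = {x} + {y} + {z} + (l : Multiset α) := by
        simp [← cons_coe, ← singleton_add]; abel
      have e1 : ({x, y} : Multiset α) + (z :: l : List α) = {x} + {y} + {z} + (l : Multiset α) := by
        simp [← cons_coe, ← singleton_add, insert_eq_cons]; abel
      have e2 : ({x, z} : Multiset α) + (y :: l : List α) = {x} + {y} + {z} + (l : Multiset α) := by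
        simp [← cons_coe, ← singleton_add, insert_eq_cons]; abel
      have e3 : ({y, z} : Multiset α) + (x :: l : List α) = {x} + {y} + {z} + (l : Multiset α) := by
        simp [← cons_coe, ← singleton_add, insert_eq_cons]; abel
      have e4 : ({x, y, z} : Multiset α) + l = {x} + {y} + {z} + (l : Multiset α) := by
        simp [← cons_coe, ← singleton_add, insert_eq_cons]; abel
      rw [e1] at a1; rw [e2] at a2; rw [e3] at a3; rw [e4] at a4; rw [e0]
      convert Submodule.sub_mem _ (Submodule.add_mem _ (Submodule.sub_mem _ a1 a2) a3)
        (smul_mem _ I a4) using 1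
      ext v
      simp only [QW, map_cons, prod_cons, ← mul_assoc, th3 h2 I hI]
      simp [add_mul, sub_mul, Matrix.trace_add, trace_sub, QW, Matrix.trace_smul]
      ring
lemma trs_bb (h2 : (2 : K) ≠ 0) (I : K) (hI : I * I = -1) (L : List (List α)) :
    (fun v => (L.map fun l => (QW I v l).trace).prod : (α → V3 K) → K) ∈ BB K (L.flatten : Multiset α) := by
  induction L with
  | nil => simp; exact bb_one
  | cons l L ih =>
    have := bb_mul_mem _ _ _ _ (tr_bb h2 I hI _ l le_rfl) ih
    rw [Multiset.coe_add] at this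
    simp
    exact this
lemma cls_bb (h2 : (2 : K) ≠ 0) (I : K) (hI : I * I = -1) {n : ℕ} {f : (Fin n → V3 K) → K}
    (hf : f ∈ Cls K n 0) : (fun v => f (fun i => Qm I (v i))) ∈ BB K (finRange n : Multiset (Fin n)) := by
  induction hf using span_induction with
  | zero => exact Submodule.zero_mem _
  | add x y _ _ hx hy => exact Submodule.add_mem _ hx hy
  | smul c x _ hx => exact smul_mem _ c hx
  | mem x h =>
    obtain ⟨L1, L2, h, rfl⟩ := h
    have : L2 = [] := List.length_eq_zero_iff.mp h.2
    subst this
    have h1 : (L1.flatten : Multiset (Fin n)) = finRange n := by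
      have := h.1; simp at this; exact Multiset.coe_eq_coe.mpr this
    rw [← h1]
    convert trs_bb h2 I hI L1 using 1
    ext v
    simp [mon, Wd, QW]
end dots
section invol
variable {α : Type} [Fintype α] [DecidableEq α]
lemma dlet_perm (D : List (α × α)) : (dlet D).Nodup → ∃ σ : Equiv.Perm α, (∀ x, σ (σ x) = x) ∧
    (∀ x, σ x ≠ x ↔ x ∈ dlet D) ∧
    ∀ w : α → Fin 3, (∀ x, w (σ x) = w x) ↔ ∀ p ∈ D, w p.1 = w p.2 := by
  induction D with
  | nil => intro _; exact ⟨1, by simp, by simp [dlet], by simp⟩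
  | cons p D ih =>
    intro hn
    obtain ⟨a, b⟩ := p
    have e : dlet ((a, b) :: D) = a ::ₘ b ::ₘ dlet D := by simp [dlet, insert_eq_cons]
    rw [e] at hn ⊢
    simp only [Multiset.nodup_cons, Multiset.mem_cons, not_or] at hn
    obtain ⟨⟨hab, ha⟩, hb, hn⟩ := hn
    obtain ⟨σ, h1, h2, h3⟩ := ih hn
    have ha' : σ a = a := by by_contra h; exact ha ((h2 a).mp h)
    have hb' : σ b = b := by by_contra h; exact hb ((h2 b).mp h)
    have hs : ∀ x, x ≠ a → x ≠ b → σ x ≠ a ∧ σ x ≠ b := by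
      intro x hxa hxb
      exact ⟨fun h => hxa (by rw [← h1 x, h, ha']), fun h => hxb (by rw [← h1 x, h, hb'])⟩
    refine ⟨Equiv.swap a b * σ, ?_, ?_, ?_⟩
    · intro x
      simp only [Equiv.Perm.mul_apply]
      by_cases hxa : x = a
      · subst hxa; simp [ha', hb']
      by_cases hxb : x = b
      · subst hxb; simp [ha', hb']
      have := hs x hxa hxb
      rw [Equiv.swap_apply_of_ne_of_ne this.1 this.2, h1, Equiv.swap_apply_of_ne_of_ne hxa hxb]
    · intro x
      simp only [Equiv.Perm.mul_apply, Multiset.mem_cons]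
      by_cases hxa : x = a
      · subst hxa; simp [ha', hb']; exact fun h => hab h.symm
      by_cases hxb : x = b
      · subst hxb; simp [ha', hb']; exact hab
      have := hs x hxa hxb
      rw [Equiv.swap_apply_of_ne_of_ne this.1 this.2, h2]
      simp [hxa, hxb]
    · intro w
      simp only [List.forall_mem_cons]
      rw [← h3]
      simp only [Equiv.Perm.mul_apply]
      constructor
      · intro h
        have hb1 := h a
        rw [ha', Equiv.swap_apply_left] at hb1
        refine ⟨hb1.symm, fun x => ?_⟩
        by_cases hxa : x = a
        · subst hxa; rw [ha']
        by_cases hxb : x = b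
        · subst hxb; rw [hb']
        have := hs x hxa hxb
        have hx := h x
        rwa [Equiv.swap_apply_of_ne_of_ne this.1 this.2] at hx
      · rintro ⟨h4, h5⟩ x
        by_cases hxa : x = a
        · subst hxa; rw [ha', Equiv.swap_apply_left, h4]
        by_cases hxb : x = b
        · subst hxb; rw [hb', Equiv.swap_apply_right, h4]
        have := hs x hxa hxb
        rw [Equiv.swap_apply_of_ne_of_ne this.1 this.2, h5]
variable {K : Type} [Field K]
lemma dt_single (i j : Fin 3) : dt (Pi.single i 1 : V3 K) (Pi.single j 1) = if i = j then 1 else 0 := by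
  fin_cases i <;> fin_cases j <;> simp [dt]
lemma bb_ev (hev : Even (Fintype.card α)) (f : (α → V3 K) → K) (hf : f ∈ BB K (univ.val : Multiset α)) :
    ∃ k : Equiv.Perm α → K, (∀ σ, ¬ Fpf σ → k σ = 0) ∧
      ∀ w : α → Fin 3, f (fun x => Pi.single (w x) 1) = ∑ σ, k σ * Ev K σ w := by
  induction hf using span_induction with
  | zero => exact ⟨0, by simp, by simp⟩
  | add x y _ _ hx hy =>
    obtain ⟨k, h1, h2⟩ := hx
    obtain ⟨k', h1', h2'⟩ := hy
    refine ⟨k + k', fun σ h => by simp [h1 σ h, h1' σ h], fun w => ?_⟩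
    simp [h2, h2', add_mul, sum_add_distrib]
  | smul c x _ hx =>
    obtain ⟨k, h1, h2⟩ := hx
    refine ⟨c • k, fun σ h => by simp [h1 σ h], fun w => ?_⟩
    simp [h2, mul_assoc, mul_sum]
  | mem x h =>
    obtain ⟨D, E, hE, hl, rfl⟩ := h
    have c1 : ∀ D : List (α × α), Even (dlet D).card := by
      intro D
      induction D with
      | nil => simp [dlet]
      | cons p D ih =>
        have : dlet (p :: D) = {p.1, p.2} + dlet D := by simp [dlet]
        rw [this, Multiset.card_add]
        exact Even.add (by simp) ih
    rcases E with _ | ⟨p, _ | ⟨_, _⟩⟩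
    · have hl' : dlet D = univ.val := by rw [← hl]; simp [elet]
      obtain ⟨σ, h1, h2, h3⟩ := dlet_perm D (by rw [hl']; exact univ.nodup)
      refine ⟨Pi.single σ 1, fun τ hτ => ?_, fun w => ?_⟩
      · apply Pi.single_eq_of_ne
        rintro rfl
        exact hτ ⟨h1, fun x => (h2 x).mpr (by rw [hl']; simp)⟩
      · simp only [Pi.single_apply, ite_mul, one_mul, zero_mul, Finset.sum_ite_eq', mem_univ, if_true]
        simp only [emon, map_nil, List.prod_nil, mul_one, dmon, dt_single, Ev, h3]
        split_ifs with h
        · apply List.prod_eq_one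
          intro y hy
          obtain ⟨p, hp, rfl⟩ := mem_map.mp hy
          rw [if_pos (h p hp)]
        · push Not at h
          obtain ⟨p, hp, hne⟩ := h
          apply List.prod_eq_zero
          exact mem_map.mpr ⟨p, hp, if_neg hne⟩
    · exfalso
      have h5 := congrArg Multiset.card hl
      have h4 := c1 D
      have : Multiset.card (univ.val : Multiset α) = Fintype.card α := rfl
      rw [this, Multiset.card_add] at h5
      simp [elet] at h5
      rw [← h5] at hev
      have h6 := (Nat.even_add.mp hev).mp h4
      exact absurd h6 (by decide)
    · simp at hE
end invol
section trans
def Rq {R : Type} [CommRing R] (a b c d : R) : M3 R :=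
  !![a*a+b*b-c*c-d*d, 2*(b*c-a*d), 2*(b*d+a*c);
     2*(b*c+a*d), a*a-b*b+c*c-d*d, 2*(c*d-a*b);
     2*(b*d-a*c), 2*(c*d+a*b), a*a-b*b-c*c+d*d]
def Nq {R : Type} [CommRing R] (a b c d : R) : R := a*a+b*b+c*c+d*d
lemma Rq_orth {R : Type} [CommRing R] (a b c d : R) :
    (Rq a b c d)ᵀ * Rq a b c d = (Nq a b c d * Nq a b c d) • 1 := by
  ext i j
  fin_cases i <;> fin_cases j <;>
    simp [Rq, Nq, Matrix.mul_apply, sum_univ_three] <;> ring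
lemma Rq_map {R S : Type} [CommRing R] [CommRing S] (f : R →+* S) (a b c d : R) (i j : Fin 3) :
    f (Rq a b c d i j) = Rq (f a) (f b) (f c) (f d) i j := by
  have f2 : f 2 = 2 := map_ofNat f 2
  fin_cases i <;> fin_cases j <;> simp [Rq, f2]
variable {F : Type} [Field F] {α : Type} [Fintype α] [DecidableEq α]
lemma transfer [Infinite F] {K : Type} [Field K] [Algebra F K] (c : (α → Fin 3) → F)
    (hc : ∀ g : M3 F, gᵀ * g = 1 → ∀ w, ∑ w' : α → Fin 3, (∏ x, g (w' x) (w x)) * c w' = c w)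
    (q : Fin 4 → K) (hN : Nq (q 0) (q 1) (q 2) (q 3) = 1) (w : α → Fin 3) :
    ∑ w' : α → Fin 3, (∏ x, Rq (q 0) (q 1) (q 2) (q 3) (w' x) (w x)) * algebraMap F K (c w') = algebraMap F K (c w) := by
  let P : MvPolynomial (Fin 4) F := ∑ w' : α → Fin 3, (∏ x, Rq (X 0) (X 1) (X 2) (X 3) (w' x) (w x)) * C (c w')
    - Nq (X 0) (X 1) (X 2) (X 3) ^ (Fintype.card α) * C (c w)
  have hP : Nq (X 0) (X 1) (X 2) (X 3) * P = 0 := by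
    apply MvPolynomial.funext
    intro r
    by_cases hr : Nq (r 0) (r 1) (r 2) (r 3) = 0
    · simp only [Nq] at hr
      simp [Nq, hr]
    · have hg : ((Nq (r 0) (r 1) (r 2) (r 3))⁻¹ • Rq (r 0) (r 1) (r 2) (r 3))ᵀ *
          ((Nq (r 0) (r 1) (r 2) (r 3))⁻¹ • Rq (r 0) (r 1) (r 2) (r 3)) = 1 := by
        rw [transpose_smul, smul_mul_smul, Rq_orth, smul_smul]
        rw [show (Nq (r 0) (r 1) (r 2) (r 3))⁻¹ * (Nq (r 0) (r 1) (r 2) (r 3))⁻¹ *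
          (Nq (r 0) (r 1) (r 2) (r 3) * Nq (r 0) (r 1) (r 2) (r 3)) = 1 by field_simp, one_smul]
      have h1 := hc _ hg w
      simp only [Matrix.smul_apply, smul_eq_mul, Finset.prod_mul_distrib, Finset.prod_const, Finset.card_univ] at h1
      rw [map_mul, map_zero]
      apply mul_eq_zero_of_right
      simp only [P, map_sub, map_sum, map_mul, _root_.map_pow, map_prod, MvPolynomial.eval_C]
      simp only [Rq_map, MvPolynomial.eval_X]
      rw [← h1, mul_sum, sub_eq_zero]
      have e : (MvPolynomial.eval r) (Nq (X 0) (X 1) (X 2) (X 3)) = Nq (r 0) (r 1) (r 2) (r 3) := by simp [Nq]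
      rw [e]
      apply sum_congr rfl
      intro w' _
      rw [← mul_assoc, ← mul_assoc, ← mul_pow, mul_inv_cancel₀ hr, one_pow, one_mul]
  have hN0 : (Nq (X 0) (X 1) (X 2) (X 3) : MvPolynomial (Fin 4) F) ≠ 0 := by
    intro h
    have := congrArg (MvPolynomial.eval (Pi.single 0 1)) h
    simp [Nq] at this
  have hP0 : P = 0 := (mul_eq_zero.mp hP).resolve_left hN0
  have h := congrArg (MvPolynomial.eval₂Hom (algebraMap F K) q) hP0
  rw [map_zero] at h
  simp only [P, map_sub, map_sum, map_mul, _root_.map_pow, map_prod] at h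
  simp only [Rq_map] at h
  simp only [coe_eval₂Hom, eval₂_X, eval₂_C] at h
  have e : eval₂ (algebraMap F K) q (Nq (X 0) (X 1) (X 2) (X 3) : MvPolynomial (Fin 4) F) = 1 := by
    rw [← hN]; simp [Nq]
  rw [e, one_pow, one_mul, sub_eq_zero] at h
  exact h
end trans
section fft
variable {F : Type} [Field F]
def stdT {K : Type} [Field K] {n : ℕ} (c : (Fin n → Fin 3) → K) :
    MultilinearMap K (fun _ : Fin n => V3 K) K :=
  ∑ w : Fin n → Fin 3, c w • (MultilinearMap.mkPiAlgebra K (Fin n) K).compLinearMap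
    (fun x => LinearMap.proj (w x))
lemma stdT_apply {K : Type} [Field K] {n : ℕ} (c : (Fin n → Fin 3) → K) (v : Fin n → V3 K) :
    stdT c v = ∑ w : Fin n → Fin 3, c w * ∏ x, v x (w x) := by
  simp [stdT, MultilinearMap.sum_apply]
lemma stdT_single {K : Type} [Field K] {n : ℕ} (c : (Fin n → Fin 3) → K) (w : Fin n → Fin 3) :
    stdT c (fun x => Pi.single (w x) 1) = c w := by
  rw [stdT_apply, Finset.sum_eq_single w]
  · simp
  · intro w' _ hne
    obtain ⟨x, hx⟩ := Function.ne_iff.mp hne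
    rw [Finset.prod_eq_zero (mem_univ x), mul_zero]
    simp [hx]
  · simp
lemma stdT_inv {K : Type} [Field K] {n : ℕ} (c : (Fin n → Fin 3) → K) (g : M3 K)
    (h : ∀ w, ∑ w' : Fin n → Fin 3, (∏ x, g (w' x) (w x)) * c w' = c w) (v : Fin n → V3 K) :
    stdT c (fun x => g.mulVec (v x)) = stdT c v := by
  have : (stdT c).compLinearMap (fun _ => g.mulVecLin) = stdT c := by
    apply Module.Basis.ext_multilinear (fun _ => Pi.basisFun K (Fin 3))
    intro w
    simp only [Pi.basisFun_apply, compLinearMap_apply, Matrix.mulVecLin_apply]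
    rw [stdT_single, stdT_apply, ← h w]
    apply sum_congr rfl
    intro w' _
    rw [mul_comm]
    simp
  exact congrArg (fun T => T v) this
def Pm {K : Type} [Field K] (I : K) : V3 K →ₗ[K] V3 K where
  toFun v := ![v 0 - v 2, I * (v 0 + v 2), v 1]
  map_add' := by intro x y; ext j; fin_cases j <;> simp <;> ring
  map_smul' := by intro x y; ext j; fin_cases j <;> simp <;> ring
lemma PQ {K : Type} [Field K] (h2 : (2 : K) ≠ 0) (I : K) (hI : I * I = -1) (x : V3 K) : Pm I (Qm I x) = x := by
  ext j; fin_cases j <;> simp [Pm, Qm]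
  · field_simp; ring
  · field_simp; linear_combination (-2 * x 1) * hI
lemma PU {K : Type} [Field K] (h2 : (2 : K) ≠ 0) (I : K) (hI : I * I = -1) (v : V3 K) :
    Pm I (Uu v) = (Rq 1 (-I/2) (1/2) 0).mulVec (Pm I v) := by
  have hI2 : I ^ 2 = -1 := by rw [sq, hI]
  have hI3 : I ^ 3 = -I := by rw [pow_succ, hI2]; ring
  ext j; fin_cases j <;> simp [Pm, Uu, Rq, mulVec, dotProduct, sum_univ_three] <;> field_simp <;>
    ring_nf <;> simp only [hI2, hI3] <;> ring
lemma PH {K : Type} [Field K] (h2 : (2 : K) ≠ 0) (I : K) (hI : I * I = -1) (c : K) (hc : c ≠ 0) (v : V3 K) :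
    Pm I (Hh c v) = (Rq ((c + c⁻¹)/2) 0 0 (I * (c - c⁻¹)/2)).mulVec (Pm I v) := by
  have hI2 : I ^ 2 = -1 := by rw [sq, hI]
  have hI3 : I ^ 3 = -I := by rw [pow_succ, hI2]; ring
  ext j; fin_cases j <;> simp [Pm, Hh, Rq, mulVec, dotProduct, sum_univ_three] <;> field_simp <;>
    ring_nf <;> simp only [hI2, hI3] <;> ring
theorem fft_aux [Infinite F] (K : Type) [Field K] [Algebra F K] [IsAlgClosed K] (h2 : N2 F) (n : ℕ) (hn : Even n) (c : (Fin n → Fin 3) → F)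
    (hc : ∀ g : M3 F, gᵀ * g = 1 → ∀ w, ∑ w' : Fin n → Fin 3, (∏ x, g (w' x) (w x)) * c w' = c w) :
    ∃ k : Equiv.Perm (Fin n) → F, (∀ σ, ¬ Fpf σ → k σ = 0) ∧ ∀ w, c w = ∑ σ, k σ * Ev F σ w := by
  have h2K : (2 : K) ≠ 0 := by
    have := (map_ne_zero (algebraMap F K)).mpr h2
    rwa [map_ofNat] at this
  haveI : Infinite K := Infinite.of_injective _ (algebraMap F K).injective
  obtain ⟨I, hI'⟩ := IsAlgClosed.exists_pow_nat_eq (-1 : K) (n := 2) (by norm_num)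
  have hI : I * I = -1 := by rw [← sq, hI']
  let cK : (Fin n → Fin 3) → K := fun w => algebraMap F K (c w)
  have htr : ∀ a b c' d : K, Nq a b c' d = 1 → ∀ v, stdT cK (fun x => (Rq a b c' d).mulVec (v x)) = stdT cK v := by
    intro a b c' d hN v
    apply stdT_inv
    intro w
    exact transfer c hc ![a, b, c', d] hN w
  have hcls : ⇑((stdT cK).compLinearMap (fun _ => Pm I)) ∈ Cls K n 0 := by
    apply core h2K
    refine ⟨fun v => ?_, fun c' hc' v => ?_⟩
    · simp only [compLinearMap_apply]
      simp only [PU h2K I hI]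
      apply htr
      simp [Nq]; field_simp; linear_combination hI
    · simp only [compLinearMap_apply, mul_zero, pow_zero, one_mul]
      simp only [PH h2K I hI c' hc']
      apply htr
      simp [Nq]; field_simp
      linear_combination ((c'^2 - 1)^2) * hI
  have hbb := cls_bb h2K I hI hcls
  simp only [compLinearMap_apply, PQ h2K I hI] at hbb
  obtain ⟨k, hk1, hk2⟩ := bb_ev (by simpa using hn) _ hbb
  obtain ⟨r, hr⟩ := LinearMap.exists_leftInverse_of_injective
   (Algebra.linearMap F K) (LinearMap.ker_eq_bot.mpr (algebraMap F K).injective)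
  have hr' : ∀ y : F, r (algebraMap F K y) = y := fun y => congrArg (fun f => f y) hr
  refine ⟨fun σ => r (k σ), fun σ h => by simp only [hk1 σ h, map_zero], fun w => ?_⟩
  have := hk2 w
  rw [stdT_single] at this
  rw [← hr' (c w)]
  change r (cK w) = _
  rw [this, map_sum]
  apply sum_congr rfl
  intro σ _
  have e : Ev K σ w = algebraMap F K (Ev F σ w) := by
    unfold Ev; split_ifs <;> simp
  rw [e, mul_comm, ← Algebra.smul_def, map_smul, smul_eq_mul, mul_comm]
theorem fft_fin [Infinite F] (h2 : N2 F) (n : ℕ) (hn : Even n) (c : (Fin n → Fin 3) → F)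
    (hc : ∀ g : M3 F, gᵀ * g = 1 → ∀ w, ∑ w' : Fin n → Fin 3, (∏ x, g (w' x) (w x)) * c w' = c w) :
    ∃ k : Equiv.Perm (Fin n) → F, (∀ σ, ¬ Fpf σ → k σ = 0) ∧ ∀ w, c w = ∑ σ, k σ * Ev F σ w :=
  fft_aux (AlgebraicClosure F) h2 n hn c hc
theorem fft [Infinite F] (h2 : N2 F) {α : Type} [Fintype α] [DecidableEq α] (hev : Even (Fintype.card α))
    (c : (α → Fin 3) → F)
    (hc : ∀ g : M3 F, gᵀ * g = 1 → ∀ w, ∑ w' : α → Fin 3, (∏ x, g (w' x) (w x)) * c w' = c w) :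
    ∃ k : Equiv.Perm α → F, (∀ σ, ¬ Fpf σ → k σ = 0) ∧ ∀ w, c w = ∑ σ, k σ * Ev F σ w := by
  let e := equivFin α
  obtain ⟨k, h1, h3⟩ := fft_fin h2 _ hev (fun w => c (w ∘ e)) (by
    intro g hg w
    rw [← hc g hg (w ∘ e)]
    refine sum_equiv (e.arrowCongr (Equiv.refl (Fin 3))).symm _ _ ?_
    intro w'
    congr 1
    · exact (Fintype.prod_equiv e _ _ (fun x => by simp [Equiv.arrowCongr])).symm)
  refine ⟨fun σ => k (e.permCongr σ), fun σ hσ => ?_, fun w => ?_⟩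
  · apply h1
    rintro ⟨h, h'⟩
    apply hσ
    refine ⟨fun x => ?_, fun x hx => ?_⟩
    · have := h (e x); simpa using this
    · exact h' (e x) (by simp [hx])
  · have := h3 (w ∘ e.symm)
    simp only [Function.comp_assoc, Equiv.symm_comp_self, Function.comp_id] at this
    rw [this]
    refine (sum_equiv e.permCongr _ _ ?_).symm
    intro σ
    congr 1
    unfold Ev
    congr 1
    apply propext
    constructor
    · intro h x
      have := h (e.symm x)
      simpa using this
    · intro h x
      have := h (e x)
      simpa using this
end fft
section basics
variable {F : Type} [Field F] {d : ℕ}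
lemma tp_add (a b : FA F d) : tp F d (a + b) = tp F d a + tp F d b := by simp [tp]
lemma tp_smul (c : F) (a : FA F d) : tp F d (c • a) = c • tp F d a := by simp [tp]
lemma tp_mul (a b : FA F d) : tp F d (a * b) = tp F d b * tp F d a := by simp [tp]
lemma tp_one : tp F d (1 : FA F d) = 1 := by simp [tp]
lemma tp_ι (p : Ltr d) : tp F d (ι F p) = ι F (p.1, !p.2) := by simp [tp]
def tpl : FA F d →ₗ[F] FA F d := ⟨⟨tp F d, tp_add⟩, tp_smul⟩
lemma tp_algebraMap (c : F) : tp F d (algebraMap F _ c) = algebraMap F _ c := by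
  rw [algebraMap_eq_smul_one, tp_smul, tp_one]
lemma tp_tp (a : FA F d) : tp F d (tp F d a) = a := by
  induction a using FreeAlgebra.induction with
  | grade0 r => rw [tp_algebraMap, tp_algebraMap]
  | grade1 x => simp [tp_ι]
  | mul a b ha hb => rw [tp_mul, tp_mul, ha, hb]
  | add a b ha hb => rw [tp_add, tp_add, ha, hb]
lemma wordOf_append (l l' : List (Ltr d)) : wordOf F d (l ++ l') = wordOf F d l * wordOf F d l' := by
  simp [wordOf]
lemma FA_span : (⊤ : Submodule F (FA F d)) ≤ Submodule.span F (Set.range (wordOf F d)) := by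
  intro a _
  induction a using FreeAlgebra.induction with
  | grade0 r =>
    rw [algebraMap_eq_smul_one]
    exact smul_mem _ _ (Submodule.subset_span ⟨[], rfl⟩)
  | grade1 x => exact Submodule.subset_span ⟨[x], by simp [wordOf]⟩
  | add a b ha hb => exact Submodule.add_mem _ (ha trivial) (hb trivial)
  | mul a b ha hb =>
    have := Submodule.mul_mem_mul (ha trivial) (hb trivial)
    rw [Submodule.span_mul_span] at this
    refine Submodule.span_mono ?_ this
    rintro _ ⟨_, ⟨l, rfl⟩, _, ⟨l', rfl⟩, rfl⟩
    exact ⟨l ++ l', wordOf_append _ _⟩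
lemma mf_mul (a b : FA F d) (h : a ∈ MFsub F d ∨ b ∈ MFsub F d) : a * b ∈ MFsub F d := by
  have key : ∀ S T : Set (FA F d), (∀ x ∈ S, ∃ l : List (Ltr d), x = wordOf F d l) →
      (∀ x ∈ T, ∃ l : List (Ltr d), x = wordOf F d l) →
      ((∀ x ∈ S, ∃ l : List (Ltr d), l ≠ [] ∧ x = wordOf F d l) ∨ (∀ x ∈ T, ∃ l : List (Ltr d), l ≠ [] ∧ x = wordOf F d l)) →
      a ∈ Submodule.span F S → b ∈ Submodule.span F T → a * b ∈ MFsub F d := by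
    intro S T hS hT h ha hb
    have := Submodule.mul_mem_mul ha hb
    rw [Submodule.span_mul_span] at this
    refine Submodule.span_mono ?_ this
    rintro _ ⟨x, hx, y, hy, rfl⟩
    rcases h with h | h
    · obtain ⟨l, hl, rfl⟩ := h x hx
      obtain ⟨l', rfl⟩ := hT y hy
      exact ⟨l ++ l', by simp [hl], (wordOf_append _ _).symm⟩
    · obtain ⟨l, hl, rfl⟩ := h y hy
      obtain ⟨l', rfl⟩ := hS x hx
      exact ⟨l' ++ l, by simp [hl], (wordOf_append _ _).symm⟩
  rcases h with h | h
  · exact key {w | ∃ l : List (Ltr d), l ≠ [] ∧ w = wordOf F d l} (Set.range (wordOf F d)) (by rintro x ⟨l, _, e⟩; exact ⟨l, e⟩)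
      (by rintro x ⟨l, e⟩; exact ⟨l, e.symm⟩) (inl fun x h => h) h (FA_span trivial)
  · exact key (Set.range (wordOf F d)) {w | ∃ l : List (Ltr d), l ≠ [] ∧ w = wordOf F d l} (by rintro x ⟨l, e⟩; exact ⟨l, e.symm⟩)
      (by rintro x ⟨l, _, e⟩; exact ⟨l, e⟩) (inr fun x h => h) (FA_span trivial) h
lemma mf_ι (p : Ltr d) : ι F p ∈ MFsub F d := Submodule.subset_span ⟨[p], by simp, by simp [wordOf]⟩
lemma tp_word (l : List (Ltr d)) : tp F d (wordOf F d l) = wordOf F d (l.map fun p => (p.1, !p.2)).reverse := by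
  induction l with
  | nil => simp [wordOf, tp_one]
  | cons p l ih =>
    have e : wordOf F d (p :: l) = ι F p * wordOf F d l := by simp [wordOf]
    rw [e, tp_mul, ih, tp_ι]
    simp [wordOf]
lemma mf_tp (a : FA F d) (h : a ∈ MFsub F d) : tp F d a ∈ MFsub F d := by
  have : MFsub F d ≤ (MFsub F d).comap tpl := by
    conv_lhs => unfold MFsub
    rw [Submodule.span_le]
    rintro _ ⟨l, hl, rfl⟩
    refine Submodule.subset_span ⟨(l.map fun p : Ltr d => ((p.1, !p.2) : Ltr d)).reverse, by simpa using hl, ?_⟩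
    exact tp_word l
  exact this h
lemma tp_I (a : FA F d) (h : a ∈ idealA F d) : tp F d a ∈ idealA F d := by
  let J : TwoSidedIdeal (FA F d) := TwoSidedIdeal.mk' {a | tp F d a ∈ idealA F d}
    (by have e : tp F d 0 = 0 := map_zero (tpl (F := F) (d := d))
        show tp F d 0 ∈ idealA F d
        rw [e]; exact (idealA F d).zero_mem)
    (by intro a b ha hb; simp only [Set.mem_setOf_eq] at *; rw [tp_add]; exact (idealA F d).add_mem ha hb)
    (by intro a ha
        have e : tp F d (-a) = - tp F d a := map_neg (tpl (F := F) (d := d)) a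
        simp only [Set.mem_setOf_eq] at *; rw [e]; exact (idealA F d).neg_mem ha)
    (by intro a b hb; simp only [Set.mem_setOf_eq] at *; rw [tp_mul]; exact (idealA F d).mul_mem_right _ _ hb)
    (by intro a b hb; simp only [Set.mem_setOf_eq] at *; rw [tp_mul]; exact (idealA F d).mul_mem_left _ _ hb)
  have hJ : ∀ x, x ∈ J ↔ tp F d x ∈ idealA F d := fun x => mem_mk' _ _ _ _ _ _ _
  have : idealA F d ≤ J := by
    conv_lhs => unfold idealA
    rw [TwoSidedIdeal.span_le]
    have tpb : ∀ b : FA F d, tp F d (bar F d b) = - bar F d b := by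
      intro b
      have e : tp F d (b - tp F d b) = tp F d b - tp F d (tp F d b) := map_sub (tpl (F := F) (d := d)) _ _
      rw [bar, e, tp_tp]; abel
    rintro x (⟨a, ha, rfl⟩ | ⟨a, ha, b, hb, c, hc, rfl⟩)
    · rw [mem_coe, hJ]
      refine TwoSidedIdeal.subset_span (inl ⟨tp F d a, mf_tp a ha, ?_⟩)
      simp [pow_succ, tp_mul, mul_assoc]
    · rw [mem_coe, hJ]
      refine TwoSidedIdeal.subset_span (inr ⟨tp F d a, mf_tp a ha, c, hc, b, hb, ?_⟩)
      simp only [Trel, tp_add, tp_mul, tpb, tp_tp]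
      noncomm_ring
  exact (hJ a).mp (this h)
abbrev QA (F : Type) [Field F] (d : ℕ) := (idealA F d).ringCon.Quotient
def pQ : FA F d →ₗ[F] QA F d := (RingCon.mkₐ F (idealA F d).ringCon).toLinearMap
lemma pQ_mul (a b : FA F d) : pQ (a * b) = pQ a * pQ b := rfl
lemma pQ_one : pQ (1 : FA F d) = 1 := rfl
lemma pQ_surj : Function.Surjective (pQ : FA F d → QA F d) := Quotient.mk''_surjective
lemma pQ_eq (a : FA F d) : pQ a = 0 ↔ a ∈ idealA F d := by
  rw [TwoSidedIdeal.mem_iff]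
  exact (RingCon.eq _)
def tQ : QA F d →ₗ[F] QA F d where
  toFun := Quotient.lift (fun a => pQ (tp F d a)) (by
    intro a b h
    have h' : a - b ∈ idealA F d := (TwoSidedIdeal.rel_iff _ _ _).mp h
    have := (pQ_eq _).mpr (tp_I _ h')
    have e : tp F d (a - b) = tp F d a - tp F d b := map_sub (tpl (F := F) (d := d)) _ _
    rw [e, map_sub, sub_eq_zero] at this
    exact this)
  map_add' := by
    intro x y
    obtain ⟨a, rfl⟩ := pQ_surj x
    obtain ⟨b, rfl⟩ := pQ_surj y
    change pQ (tp F d (a + b)) = pQ (tp F d a) + pQ (tp F d b)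
    rw [tp_add, map_add]
  map_smul' := by
    intro c x
    obtain ⟨a, rfl⟩ := pQ_surj x
    change pQ (tp F d (c • a)) = c • pQ (tp F d a)
    rw [tp_smul, map_smul]
lemma tQ_p (a : FA F d) : tQ (pQ a) = pQ (tp F d a) := rfl
def MQ (F : Type) [Field F] (d : ℕ) : Submodule F (QA F d) := (MFsub F d).map pQ
theorem asQ (h2 : N2 F) : AS F (QA F d) tQ (MQ F d) where
  two := h2
  t_mul := by
    intro x y
    obtain ⟨a, rfl⟩ := pQ_surj x
    obtain ⟨b, rfl⟩ := pQ_surj y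
    rw [← pQ_mul, tQ_p, tQ_p, tQ_p, tp_mul, pQ_mul]
  t_one := by rw [← pQ_one, tQ_p, tp_one]
  t_t := by
    intro x
    obtain ⟨a, rfl⟩ := pQ_surj x
    rw [tQ_p, tQ_p, tp_tp]
  t_mem := by rintro _ ⟨a, ha, rfl⟩; exact ⟨_, mf_tp a ha, rfl⟩
  mul_l := by
    rintro _ ⟨a, ha, rfl⟩ x
    obtain ⟨b, rfl⟩ := pQ_surj x
    exact ⟨_, mf_mul b a (inr ha), rfl⟩
  mul_r := by
    rintro _ ⟨a, ha, rfl⟩ x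
    obtain ⟨b, rfl⟩ := pQ_surj x
    exact ⟨_, mf_mul a b (inl ha), rfl⟩
  cube := by
    rintro _ ⟨a, ha, rfl⟩
    rw [← pQ_mul, ← pQ_mul, pQ_eq]
    exact TwoSidedIdeal.subset_span (inl ⟨a, ha, by rw [pow_three']⟩)
  T := by
    rintro _ ⟨a, ha, rfl⟩ _ ⟨b, hb, rfl⟩ _ ⟨c, hc, rfl⟩
    simp only [tQ_p, ← map_sub, ← pQ_mul, ← map_add]
    rw [pQ_eq]
    exact TwoSidedIdeal.subset_span (inr ⟨a, ha, b, hb, c, hc, rfl⟩)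
end basics
section dec
variable {F : Type} [Field F] {d : ℕ}
def Dec (F : Type) [Field F] (d : ℕ) : Submodule F (Rpoly F d) :=
  Submodule.span F {x | ∃ p ∈ invAlg F d, ∃ q ∈ invAlg F d,
    constantCoeff p = 0 ∧ constantCoeff q = 0 ∧ x = p * q}
lemma dec_mul {p q : Rpoly F d} (hp : p ∈ invAlg F d) (hq : q ∈ invAlg F d)
    (h1 : constantCoeff p = 0) (h2 : constantCoeff q = 0) : p * q ∈ Dec F d :=
  Submodule.subset_span ⟨p, hp, q, hq, h1, h2, rfl⟩
lemma act_hom (g : M3 F) (p : Rpoly F d) (n : ℕ) (hp : p.IsHomogeneous n) :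
    (actHom F d g p).IsHomogeneous n := by
  have := hp.aeval (fun p : Fin 3 × Fin 3 × Fin d =>
    ((g.map (algebraMap F (Rpoly F d)))ᵀ * genMat F d p.2.2 *
      g.map (algebraMap F (Rpoly F d))) p.1 p.2.1) (n := 1) (by
    intro i
    simp only [Matrix.mul_apply, map_apply, transpose_apply, algebraMap_eq, genMat, of_apply]
    refine IsHomogeneous.sum _ _ _ fun j _ => ?_
    have h1 : (∑ x, C (g x i.1) * X (x, j, i.2.2) : Rpoly F d).IsHomogeneous 1 :=
      IsHomogeneous.sum _ _ _ fun k _ => isHomogeneous_C_mul_X _ _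
    exact h1.mul (isHomogeneous_C _ _))
  rwa [one_mul] at this
lemma hc_inv (p : Rpoly F d) (hp : p ∈ invAlg F d) (n : ℕ) : homogeneousComponent n p ∈ invAlg F d := by
  intro g hg
  have h := congrArg (homogeneousComponent n) (hp g hg)
  rw [← sum_homogeneousComponent p, map_sum, map_sum, map_sum] at h
  have e1 : ∀ i, homogeneousComponent n (actHom F d g (homogeneousComponent i p)) =
      if i = n then actHom F d g (homogeneousComponent i p) else 0 := fun i => by
    rw [homogeneousComponent_of_mem (act_hom g _ i (homogeneousComponent_isHomogeneous i p))]
    simp [eq_comm]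
  have e2 : ∀ i, homogeneousComponent n (homogeneousComponent i p) =
      if i = n then (homogeneousComponent i p) else 0 := fun i => by
    rw [homogeneousComponent_of_mem (homogeneousComponent_isHomogeneous i p)]
    simp [eq_comm]
  simp only [e1, e2, Finset.sum_ite_eq', Finset.mem_range] at h
  split_ifs at h with h0
  · exact h
  · rw [homogeneousComponent_eq_zero _ _ (by omega)]; simp
lemma plus_iff (p : invAlg F d) : p ∈ plusIdeal F d ↔ constantCoeff (p : Rpoly F d) = 0 := by
  constructor
  · intro h
    have : plusIdeal F d ≤ RingHom.ker (((constantCoeff : Rpoly F d →+* F)).comp (invAlg F d).val.toRingHom) := by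
      unfold plusIdeal
      rw [Ideal.span_le]
      rintro f ⟨n, hn, hf⟩
      rw [mem_coe, RingHom.mem_ker]
      change coeff 0 (f : Rpoly F d) = 0
      exact hf.coeff_eq_zero (by simp; omega)
    exact this h
  · intro h
    have e : p = ∑ i ∈ Finset.range ((p : Rpoly F d).totalDegree + 1),
        (⟨homogeneousComponent i (p : Rpoly F d), hc_inv _ p.2 i⟩ : invAlg F d) := by
      apply Subtype.ext
      rw [AddSubmonoidClass.coe_finset_sum]
      exact (sum_homogeneousComponent _).symm
    rw [e]
    refine Ideal.sum_mem _ fun i _ => ?_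
    rcases Nat.eq_zero_or_pos i with rfl | hi
    · have : (⟨homogeneousComponent 0 (p : Rpoly F d), hc_inv _ p.2 0⟩ : invAlg F d) = 0 := by
        apply Subtype.ext
        change homogeneousComponent 0 (p : Rpoly F d) = 0
        rw [homogeneousComponent_zero]
        change C (constantCoeff (p : Rpoly F d)) = 0
        rw [h, C_0]
      rw [this]; exact Ideal.zero_mem _
    · exact Ideal.subset_span ⟨i, hi, homogeneousComponent_isHomogeneous _ _⟩
lemma dec_iff (x : Rpoly F d) : x ∈ decompSet F d ↔ x ∈ Dec F d := by
  constructor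
  · rintro ⟨y, hy, rfl⟩
    rw [mem_coe, pow_two] at hy
    change (y : Rpoly F d) ∈ Dec F d
    refine Submodule.mul_induction_on (C := fun y : invAlg F d => (y : Rpoly F d) ∈ Dec F d) (M := plusIdeal F d) (N := plusIdeal F d) (r := y) hy ?_ ?_
    · intro a ha b hb
      exact dec_mul a.2 b.2 ((plus_iff a).mp ha) ((plus_iff b).mp hb)
    · intro a b ha hb; exact Submodule.add_mem _ ha hb
  · intro h
    have : Dec F d ≤ (((plusIdeal F d ^ 2).restrictScalars F).map (invAlg F d).val.toLinearMap) := by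
      unfold Dec
      rw [Submodule.span_le]
      rintro _ ⟨p, hp, q, hq, h1, h2, rfl⟩
      refine ⟨⟨p, hp⟩ * ⟨q, hq⟩, ?_, rfl⟩
      rw [pow_two]
      exact Ideal.mul_mem_mul ((plus_iff _).mpr h1) ((plus_iff _).mpr h2)
    obtain ⟨y, hy, e⟩ := this h
    exact ⟨y, hy, e⟩
lemma ev_ι (p : Ltr d) : evMat F d (ι F p) = if p.2 then (genMat F d p.1)ᵀ else genMat F d p.1 := by
  simp [evMat]
lemma ev_tp (a : FA F d) : evMat F d (tp F d a) = (evMat F d a)ᵀ := by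
  induction a using FreeAlgebra.induction with
  | grade0 r =>
    rw [tp_algebraMap, commutes]
    simp [algebraMap_eq_diagonal]
  | grade1 x => rw [tp_ι, ev_ι, ev_ι]; cases h : x.2 <;> simp
  | mul a b ha hb => rw [tp_mul, map_mul, ha, hb, map_mul, transpose_mul]
  | add a b ha hb => rw [tp_add, map_add, ha, hb, map_add, transpose_add]
lemma act_ev (g : M3 F) (hg : gᵀ * g = 1) (a : FA F d) :
    (actHom F d g).mapMatrix (evMat F d a) = (g.map (algebraMap F (Rpoly F d)))ᵀ * evMat F d a *
      g.map (algebraMap F (Rpoly F d)) := by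
  set G := g.map (algebraMap F (Rpoly F d)) with hG
  have hGG : Gᵀ * G = 1 := by
    rw [hG, ← transpose_map, ← Matrix.map_mul, hg, Matrix.map_one _ (map_zero _) (map_one _)]
  have hGG' : G * Gᵀ = 1 := mul_eq_one_comm.mp hGG
  induction a using FreeAlgebra.induction with
  | grade0 r =>
    rw [commutes, commutes, algebraMap_eq_smul_one, Matrix.mul_smul, smul_mul, mul_one, hGG]
  | grade1 x =>
    rw [ev_ι]
    have e : (actHom F d g).mapMatrix (genMat F d x.1) = Gᵀ * genMat F d x.1 * G := by
      ext i j
      simp [actHom, genMat, hG]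
    cases h : x.2
    · simpa using e
    · have e' := congrArg Matrix.transpose e
      rw [transpose_mul, transpose_mul, transpose_transpose] at e'
      simp only [if_true]
      rw [Matrix.mul_assoc, ← e']
      ext i j; simp
  | mul a b ha hb =>
    rw [map_mul, map_mul, ha, hb]
    calc _ = Gᵀ * evMat F d a * (G * Gᵀ) * evMat F d b * G := by simp only [Matrix.mul_assoc]
      _ = _ := by rw [hGG']; simp only [Matrix.mul_assoc, Matrix.one_mul]
  | add a b ha hb => rw [map_add, map_add, ha, hb, Matrix.mul_add, Matrix.add_mul]
lemma inv_tr (a : FA F d) : Matrix.trace (evMat F d a) ∈ invAlg F d := by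
  intro g hg
  have hGG : (g.map (algebraMap F (Rpoly F d))) * (g.map (algebraMap F (Rpoly F d)))ᵀ = 1 := by
    rw [← transpose_map, ← Matrix.map_mul, mul_eq_one_comm.mp hg, Matrix.map_one _ (map_zero _) (map_one _)]
  have h := congrArg Matrix.trace (act_ev g hg a)
  rw [Matrix.trace_mul_comm, ← Matrix.mul_assoc, hGG, Matrix.one_mul] at h
  refine Eq.trans ?_ h
  simp [Matrix.trace]
lemma inv_det (a : FA F d) : Matrix.det (evMat F d a) ∈ invAlg F d := by
  intro g hg
  have hGG : (g.map (algebraMap F (Rpoly F d)))ᵀ * (g.map (algebraMap F (Rpoly F d))) = 1 := by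
    rw [← transpose_map, ← Matrix.map_mul, hg, Matrix.map_one _ (map_zero _) (map_one _)]
  have h := congrArg Matrix.det (act_ev g hg a)
  have h2 := congrArg Matrix.det hGG
  rw [det_mul, Matrix.det_one] at h2
  rw [det_mul, det_mul, mul_right_comm, h2, one_mul] at h
  refine Eq.trans ?_ h
  rw [AlgHom.map_det]
lemma cc_ev (a : FA F d) (ha : a ∈ MFsub F d) :
    (constantCoeff : Rpoly F d →+* F).mapMatrix (evMat F d a) = 0 := by
  have : MFsub F d ≤ LinearMap.ker (((aeval (fun _ => (0 : F)) : Rpoly F d →ₐ[F] F).mapMatrix.comp (evMat F d)).toLinearMap) := by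
    unfold MFsub
    rw [Submodule.span_le]
    rintro _ ⟨l, hl, rfl⟩
    cases l with
    | nil => exact absurd rfl hl
    | cons p l =>
      have e : wordOf F d (p :: l) = ι F p * wordOf F d l := by simp [wordOf]
      rw [e, mem_coe, mem_ker, AlgHom.toLinearMap_apply, map_mul]
      have e : ((aeval (fun _ => (0 : F)) : Rpoly F d →ₐ[F] F).mapMatrix.comp (evMat F d)) (ι F p) = 0 := by
        rw [AlgHom.comp_apply, ev_ι]
        ext i j
        cases p.2 <;> simp [genMat]
      rw [e, zero_mul]
  have h := this ha
  rw [mem_ker] at h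
  rw [← h]
  have e : (constantCoeff : Rpoly F d →+* F) = ((aeval (fun _ => (0 : F)) : Rpoly F d →ₐ[F] F) : Rpoly F d →+* F) := by
    ext <;> simp
  rw [e]; rfl
lemma cc_tr (a : FA F d) (ha : a ∈ MFsub F d) : constantCoeff (Matrix.trace (evMat F d a)) = 0 := by
  have h := congrArg Matrix.trace (cc_ev a ha)
  rw [Matrix.trace_zero] at h
  rw [← h]; simp [Matrix.trace]
lemma cc_det (a : FA F d) (ha : a ∈ MFsub F d) : constantCoeff (Matrix.det (evMat F d a)) = 0 := by
  have h := congrArg Matrix.det (cc_ev a ha)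
  rw [Matrix.det_zero] at h
  rw [← h, RingHom.map_det]
lemma mat_ch {S : Type*} [CommRing S] (A Y : M3 S) :
    2 * trace (A * A * A * Y) = 2 * (trace A * trace (A * A * Y)) - (trace A * (trace A * trace (A * Y)) - trace (A * A) * trace (A * Y))
      + 2 * (det A * trace Y) := by
  simp only [trace_fin_three, Matrix.mul_apply, sum_univ_three, det_fin_three]
  ring
lemma skew_form {S : Type*} [CommRing S] (B : M3 S) :
    B - Bᵀ = !![0, B 0 1 - B 1 0, B 0 2 - B 2 0; -(B 0 1 - B 1 0), 0, B 1 2 - B 2 1; -(B 0 2 - B 2 0), -(B 1 2 - B 2 1), 0] := by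
  ext i j; fin_cases i <;> fin_cases j <;> simp
lemma mat_T' {S : Type*} [CommRing S] (A Y : M3 S) (p q r p' q' r' : S)
    (B C : M3 S)
    (hB : B = !![0, p, q; -p, 0, r; -q, -r, 0]) (hC : C = !![0, p', q'; -p', 0, r'; -q', -r', 0]) :
    2 * trace ((A * B * C + B * Aᵀ * C + B * C * A) * Y) =
      2 * (trace A * trace (B * C * Y)) + (2 * (trace (A * B * C) * trace Y) - trace (B * C) * trace A * trace Y)
       + trace (B * C) * trace (A * Y) := by
  have B00 : B 0 0 = 0 := by rw [hB]; rfl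
  have B01 : B 0 1 = p := by rw [hB]; rfl
  have B02 : B 0 2 = q := by rw [hB]; rfl
  have B10 : B 1 0 = -p := by rw [hB]; rfl
  have B11 : B 1 1 = 0 := by rw [hB]; rfl
  have B12 : B 1 2 = r := by rw [hB]; rfl
  have B20 : B 2 0 = -q := by rw [hB]; rfl
  have B21 : B 2 1 = -r := by rw [hB]; rfl
  have B22 : B 2 2 = 0 := by rw [hB]; rfl
  have C00 : C 0 0 = 0 := by rw [hC]; rfl
  have C01 : C 0 1 = p' := by rw [hC]; rfl
  have C02 : C 0 2 = q' := by rw [hC]; rfl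
  have C10 : C 1 0 = -p' := by rw [hC]; rfl
  have C11 : C 1 1 = 0 := by rw [hC]; rfl
  have C12 : C 1 2 = r' := by rw [hC]; rfl
  have C20 : C 2 0 = -q' := by rw [hC]; rfl
  have C21 : C 2 1 = -r' := by rw [hC]; rfl
  have C22 : C 2 2 = 0 := by rw [hC]; rfl
  simp only [trace_fin_three, Matrix.add_apply, Matrix.mul_apply, transpose_apply, sum_univ_three, B00,B01,B02,B10,B11,B12,B20,B21,B22,C00,C01,C02,C10,C11,C12,C20,C21,C22]
  ring
lemma mat_T {S : Type*} [CommRing S] (A B C Y : M3 S) :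
    2 * trace ((A * (B - Bᵀ) * (C - Cᵀ) + (B - Bᵀ) * Aᵀ * (C - Cᵀ) + (B - Bᵀ) * (C - Cᵀ) * A) * Y) =
      2 * (trace A * trace ((B - Bᵀ) * (C - Cᵀ) * Y)) + (2 * (trace (A * (B - Bᵀ) * (C - Cᵀ)) * trace Y) - trace ((B - Bᵀ) * (C - Cᵀ)) * trace A * trace Y)
       + trace ((B - Bᵀ) * (C - Cᵀ)) * trace (A * Y) :=
  mat_T' A Y _ _ _ _ _ _ _ _ (skew_form B) (skew_form C)
lemma inv_mul_tr (f : Rpoly F d) (hf : f ∈ Dec F d) (a : Rpoly F d) (ha : a ∈ invAlg F d) : f * a ∈ Dec F d := by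
  have : Dec F d ≤ (Dec F d).comap (LinearMap.mulRight F a) := by
    conv_lhs => unfold Dec
    rw [Submodule.span_le]
    rintro _ ⟨p, hp, q, hq, h1, h2, rfl⟩
    change p * q * a ∈ Dec F d
    rw [mul_assoc]
    exact dec_mul hp (Subalgebra.mul_mem _ hq ha) h1 (by simp [h2])
  exact this hf
theorem easy (h2 : N2 F) (u : FA F d) (hu : u ∈ idealA F d) (y : FA F d) (hy : y ∈ MFsub F d) :
    trace (evMat F d u * evMat F d y) ∈ Dec F d := by
  let J : TwoSidedIdeal (FA F d) := TwoSidedIdeal.mk'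
    {u | ∀ y ∈ MFsub F d, trace (evMat F d u * evMat F d y) ∈ Dec F d}
    (by intro y _; simp)
    (by intro a b ha hb y hy; rw [map_add, Matrix.add_mul, trace_add]; exact Submodule.add_mem _ (ha y hy) (hb y hy))
    (by intro a ha y hy; rw [_root_.map_neg, Matrix.neg_mul, trace_neg]; exact Submodule.neg_mem _ (ha y hy))
    (by intro a b hb y hy
        rw [map_mul, Matrix.mul_assoc, trace_mul_comm, Matrix.mul_assoc, ← map_mul]
        exact hb _ (mf_mul _ _ (inl hy)))
    (by intro a b hb y hy
        rw [map_mul, Matrix.mul_assoc, ← map_mul]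
        exact hb _ (mf_mul _ _ (inr hy)))
  have hJ : ∀ x, x ∈ J ↔ ∀ y ∈ MFsub F d, trace (evMat F d x * evMat F d y) ∈ Dec F d :=
    fun x => mem_mk' _ _ _ _ _ _ _
  have h2D : ∀ x : Rpoly F d, 2 * x ∈ Dec F d → x ∈ Dec F d := by
    intro x hx
    have := smul_mem (Dec F d) (2⁻¹ : F) hx
    have e : (2 : Rpoly F d) * x = (2 : F) • x := by
      rw [two_mul, two_smul]
    rwa [e, smul_smul, inv_mul_cancel₀ h2, one_smul] at this
  have D2 : ∀ x : Rpoly F d, x ∈ Dec F d → 2 * x ∈ Dec F d := by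
    intro x hx; rw [two_mul]; exact Submodule.add_mem _ hx hx
  have td : ∀ a b : FA F d, a ∈ MFsub F d → b ∈ MFsub F d → trace (evMat F d a) * trace (evMat F d b) ∈ Dec F d :=
    fun a b ha hb => dec_mul (inv_tr a) (inv_tr b) (cc_tr a ha) (cc_tr b hb)
  have hle : idealA F d ≤ J := by
    conv_lhs => unfold idealA
    rw [TwoSidedIdeal.span_le]
    rintro x (⟨a, ha, rfl⟩ | ⟨a, ha, b, hb, c, hc, rfl⟩)
    · rw [mem_coe, hJ]
      intro y hy
      apply h2D
      rw [pow_three', map_mul, map_mul, mat_ch]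
      have hay : trace (evMat F d a) * (trace (evMat F d a) * trace (evMat F d a * evMat F d y)) ∈ Dec F d := by
        rw [← map_mul]
        rw [mul_comm]
        exact inv_mul_tr _ (td _ _ ha (mf_mul _ _ (inl ha))) _ (inv_tr _)
      simp only [← map_mul] at hay ⊢
      refine Submodule.add_mem _ (Submodule.sub_mem _ (D2 _ ?_) (Submodule.sub_mem _ hay ?_)) (D2 _ ?_)
      · exact td _ _ ha (mf_mul _ _ (inr hy))
      · exact td _ _ (mf_mul _ _ (inl ha)) (mf_mul _ _ (inr hy))
      · exact dec_mul (inv_det a) (inv_tr y) (cc_det a ha) (cc_tr y hy)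
    · rw [mem_coe, hJ]
      intro y hy
      apply h2D
      simp only [Trel, bar, map_add, map_mul, map_sub, ev_tp]
      rw [mat_T]
      simp only [← ev_tp, ← map_mul, ← map_sub]
      have hb' : b - tp F d b ∈ MFsub F d := Submodule.sub_mem _ hb (mf_tp _ hb)
      refine Submodule.add_mem _ (Submodule.add_mem _ (D2 _ ?_) (Submodule.sub_mem _ (D2 _ ?_) ?_)) ?_
      · exact td _ _ ha (mf_mul _ _ (inr hy))
      · exact td _ _ (mf_mul _ _ (inl (mf_mul _ _ (inl ha)))) hy
      · exact inv_mul_tr _ (td _ _ (mf_mul _ _ (inl hb')) ha) _ (inv_tr _)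
      · exact td _ _ (mf_mul _ _ (inl hb')) (mf_mul _ _ (inr hy))
  exact (hJ u).mp (hle hu) y hy
end dec
section chain
open Equiv
variable {J : Type} [Fintype J] [DecidableEq J]
lemma ml_mem {o : J} {l : List (J × Bool)} (h : Ml o l) (x : J × Bool) :
    x ∉ (o, false) :: l ↔ th x ∈ (o, false) :: l := by
  obtain ⟨h1, h2⟩ := h
  have h1' : (((o, false) :: l).map Prod.fst).Nodup := h1
  have h2' : x.1 ∈ ((o, false) :: l).map Prod.fst := h2 x.1
  constructor
  · intro h
    obtain ⟨y, hy, e⟩ := mem_map.mp h2'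
    have : y = th x := by
      have : y ≠ x := fun e => h (e ▸ hy)
      obtain ⟨a, b⟩ := x
      obtain ⟨a', b'⟩ := y
      simp only at e; subst e
      simp only [th, Prod.mk.injEq, true_and, ne_eq] at this ⊢
      cases b <;> cases b' <;> simp_all
    exact this ▸ hy
  · intro h h'
    have := List.inj_on_of_nodup_map h1' h h' rfl
    exact th_ne x this
theorem sig_ex (F : Type) [Field F] {o : J} {l : List (J × Bool)} (h : Ml o l) :
    ∃ σ : Perm (J × Bool), Fpf σ ∧ Lk o σ l ∧ ∀ w : J × Bool → Fin 3, Ev F σ w =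
      if List.IsChain (fun x y => w (th x) = w y) ((o, false) :: (l ++ [(o, false)])) then 1 else 0 := by
  classical
  set cc := (o, false) :: l with hc
  have hcl : (o, false) :: (l ++ [(o, false)]) = cc ++ [(o, false)] := rfl
  have hnd : cc.Nodup := List.Nodup.of_map Prod.fst h.1
  let θ : Perm (J × Bool) := ⟨th, th, th_th, th_th⟩
  have hθ : ∀ x, θ x = th x := fun _ => rfl
  let A : Perm (J × Bool) := cc.formPerm
  have hA : ∀ x, x ∉ cc → A x = x := fun x hx => List.formPerm_apply_of_notMem hx
  have hlen : 0 < cc.length := by simp [hc]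
  have hAi : ∀ x, A (A⁻¹ x) = x := A.apply_symm_apply
  have hAi' : ∀ x, A⁻¹ (A x) = x := A.symm_apply_apply
  let σ := A * θ * A⁻¹
  have hth : ∀ x ∈ cc, σ (th x) = A x := by
    intro x hx
    have hx' : th x ∉ cc := by rw [ml_mem h, th_th]; exact hx
    change A (θ (A⁻¹ (th x))) = A x
    have : A⁻¹ (th x) = th x := by rw [Perm.inv_eq_iff_eq]; exact (hA _ hx').symm
    rw [this, hθ, th_th]
  have hF : Fpf σ := by
    constructor
    · intro x
      change A (θ (A⁻¹ (A (θ (A⁻¹ x))))) = x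
      rw [hAi', hθ, hθ, th_th, hAi]
    · intro x hx
      have : θ (A⁻¹ x) = A⁻¹ x := by
        apply A.injective; rw [hAi]; exact hx
      exact th_ne _ this
  have hel : ∀ i (hi : i + 1 < (cc ++ [(o, false)]).length),
      (cc ++ [(o, false)])[i] ∈ cc ∧ σ (th ((cc ++ [(o, false)])[i])) = (cc ++ [(o, false)])[i + 1] := by
    intro i hi
    have hi' : i < cc.length := by simpa using hi
    have e1 : (cc ++ [(o, false)])[i] = cc[i] := List.getElem_append_left hi'
    refine ⟨e1 ▸ List.getElem_mem _, ?_⟩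
    rw [e1, hth _ (List.getElem_mem _)]
    change cc.formPerm cc[i] = _
    rw [List.formPerm_apply_getElem _ hnd]
    by_cases h3 : i + 1 < cc.length
    · rw [List.getElem_append_left h3]
      congr 1
      exact Nat.mod_eq_of_lt h3
    · have h4 : i + 1 = cc.length := by omega
      rw [List.getElem_append_right (by omega)]
      simp [h4, hc]
  refine ⟨σ, hF, ?_, ?_⟩
  · rw [Lk, hcl, List.isChain_iff_getElem]
    exact fun i hi => (hel i hi).2
  · intro w
    rw [Ev]
    congr 1
    rw [eq_iff_iff, hcl, List.isChain_iff_getElem]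
    constructor
    · intro hw i hi
      rw [← (hel i hi).2, hw]
    · intro hw
      have key : ∀ x ∈ cc, w (σ (th x)) = w (th x) := by
        intro x hx
        obtain ⟨i, hi, rfl⟩ := List.getElem_of_mem hx
        have hi' : i + 1 < (cc ++ [(o, false)]).length := by simpa using hi
        have e1 : (cc ++ [(o, false)])[i] = cc[i] := List.getElem_append_left hi
        have := hw i hi'
        rw [← (hel i hi').2, e1] at this
        exact this.symm
      intro z
      by_cases hz : z ∈ cc
      · have h5 : σ z ∉ cc := by
          have h6 : A⁻¹ z ∈ cc := by
            by_contra h7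
            have := hA _ h7
            rw [hAi] at this
            exact h7 (this ▸ hz)
          have h8 : th (A⁻¹ z) ∉ cc := by rw [ml_mem h, th_th]; exact h6
          change A (θ (A⁻¹ z)) ∉ cc
          rw [hθ, hA _ h8]; exact h8
        have := key _ ((ml_mem h _).mp h5)
        rw [th_th, hF.1] at this
        exact this.symm
      · have := key _ ((ml_mem h _).mp hz)
        rwa [th_th] at this
lemma chainE {S : Type} [CommRing S] (w : J × Bool → Fin 3) : ∀ (l : List (J × Bool)) (x z : J × Bool),
    ((l.map fun y => Matrix.single (w y) (w (th y)) (1 : S)).prod) (w (th x)) (w z) =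
      if List.IsChain (fun x y => w (th x) = w y) (x :: (l ++ [z])) then 1 else 0
  | [], x, z => by
    simp [Matrix.one_apply]
  | y :: l, x, z => by
    have ih := chainE (S := S) w l y z
    rw [map_cons, prod_cons, List.cons_append]
    simp only [List.isChain_cons_cons]
    by_cases h : w (th x) = w y
    · rw [h, Matrix.single_mul_apply_same, one_mul, ih]
      simp
    · rw [Matrix.single_mul_apply_of_ne _ _ _ _ _ h]
      simp [h]
end chain
section pol
open Equiv
variable {F : Type} [Field F] {d : ℕ} {J : Type} [Fintype J] [DecidableEq J]
def RelM (F : Type) [Field F] {A : Type} [Ring A] [Algebra F A] (o : J) (W : J × Bool → A) :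
    Submodule F (((J × Bool → Fin 3) → F) × A) :=
  Submodule.span F {y | ∃ σ : Perm (J × Bool), Fpf σ ∧ y = (Ev F σ, Psi o W σ)}
lemma rel_ex {A : Type} [Ring A] [Algebra F A] (o : J) (W : J × Bool → A) (y) (hy : y ∈ RelM F o W) :
    ∃ k : Perm (J × Bool) → F, (∀ σ, ¬ Fpf σ → k σ = 0) ∧ (∀ w, y.1 w = ∑ σ, k σ * Ev F σ w) ∧
      y.2 = ∑ σ, k σ • Psi o W σ := by
  refine span_induction (p := fun y _ => ∃ k : Perm (J × Bool) → F, (∀ σ, ¬ Fpf σ → k σ = 0) ∧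
    (∀ w, y.1 w = ∑ σ, k σ * Ev F σ w) ∧ y.2 = ∑ σ, k σ • Psi o W σ) ?_ ?_ ?_ ?_ hy
  · rintro _ ⟨σ, hσ, rfl⟩
    classical
    refine ⟨Pi.single σ 1, ?_, ?_, ?_⟩
    · intro τ hτ
      rw [Pi.single_apply, if_neg]; rintro rfl; exact hτ hσ
    · intro w; simp [Pi.single_apply]
    · simp [Pi.single_apply]
  · exact ⟨0, by simp, by simp, by simp⟩
  · rintro x y _ _ ⟨k, h1, h2, h3⟩ ⟨k', h1', h2', h3'⟩
    refine ⟨k + k', fun σ h => by simp [h1 σ h, h1' σ h], fun w => ?_, ?_⟩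
    · simp [h2, h2', add_mul, sum_add_distrib]
    · simp [h3, h3', add_smul, sum_add_distrib]
  · rintro c x _ ⟨k, h1, h2, h3⟩
    refine ⟨c • k, fun σ h => by simp [h1 σ h], fun w => ?_, ?_⟩
    · simp [h2, mul_sum, mul_assoc]
    · simp [h3, Finset.smul_sum, mul_smul]
theorem rel_zero {A : Type} [Ring A] [Algebra F A] {t : A →ₗ[F] A}
    {M : Submodule F A} (h : AS F A t M) (o : J) (W : J × Bool → A)
    (hW : ∀ x, x.1 ≠ o → W x ∈ M) (hWt : ∀ x, x.1 ≠ o → t (W x) = W (th x)) (x : A)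
    (hx : (0, x) ∈ RelM F o W) : x = 0 := by
  obtain ⟨k, h1, h2, h3⟩ := rel_ex o W _ hx
  change x = _ at h3
  rw [h3]
  refine sft h.two (Psi o W) (fun σ hσ q hd => psi_alt h o W hW hWt σ hσ q hd) k h1 ?_
  intro w; exact (h2 w).symm
def ell (lab : J → Fin d) (ee : J → F) (v : J × Bool → Fin 3 → F) (j : J) (a b : Fin 3) (k : Fin d) : F :=
  if lab j = k then v (j, false) a * v (j, true) b + ee j * (v (j, false) b * v (j, true) a) else 0
def pev (lab : J → Fin d) (ee : J → F) (v : J × Bool → Fin 3 → F) : Rpoly F d →ₐ[F] MvPolynomial J F :=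
  aeval fun p => ∑ j, X j * C (ell lab ee v j p.1 p.2.1 p.2.2)
def Mlt (F : Type) [Field F] (S : Finset J) : Submodule F ((J × Bool → Fin 3 → F) → F) :=
  Submodule.span F {f | ∃ w : J × Bool → Fin 3, f = fun v => ∏ j ∈ S, ∏ b, v (j, b) (w (j, b))}
lemma mlt_mul {S : Finset J} {j : J} (hj : j ∈ S) (a b : Fin 3) (f) (hf : f ∈ Mlt F (S.erase j)) :
    (fun v => f v * (v (j, false) a * v (j, true) b)) ∈ Mlt F S := by
  refine span_induction (p := fun f _ => (fun v => f v * (v (j, false) a * v (j, true) b)) ∈ Mlt F S) ?_ ?_ ?_ ?_ hf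
  · rintro _ ⟨w, rfl⟩
    refine Submodule.subset_span ⟨fun x => if x.1 = j then (if x.2 then b else a) else w x, ?_⟩
    funext v
    rw [← Finset.mul_prod_erase S _ hj, mul_comm]
    congr 1
    · simp [mul_comm]
    · refine prod_congr rfl fun i hi => ?_
      simp [Finset.ne_of_mem_erase hi]
  · simp only [Pi.zero_apply, zero_mul]; exact Submodule.zero_mem _
  · intro f g _ _ h1 h2
    simp only [Pi.add_apply, add_mul]; exact Submodule.add_mem _ h1 h2
  · intro c f _ h1
    simp only [Pi.smul_apply, smul_eq_mul, mul_assoc]; exact smul_mem _ c h1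
lemma kap_mlt (lab : J → Fin d) (ee : J → F) (p : Rpoly F d) : ∀ a : J →₀ ℕ, (∀ j, a j ≤ 1) →
    (fun v => coeff a (pev lab ee v p)) ∈ Mlt F a.support := by
  induction p using induction_on with
  | C c =>
    intro a ha
    simp only [pev, aeval_C, algebraMap_eq, coeff_C]
    split_ifs with h
    · subst h
      have : (fun v : J × Bool → Fin 3 → F => c) = c • (fun v => 1) := by funext; simp
      rw [this]
      refine smul_mem _ _ (Submodule.subset_span ⟨fun _ => 0, by simp⟩)
    · exact Submodule.zero_mem _
  | add p q hp hq =>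
    intro a ha
    simp only [map_add, coeff_add]
    exact Submodule.add_mem _ (hp a ha) (hq a ha)
  | mul_X p i hp =>
    intro a ha
    have e : (fun v => coeff a (pev lab ee v (p * X i))) = ∑ j, fun v => (coeff a (pev lab ee v p * X j)) * ell lab ee v j i.1 i.2.1 i.2.2 := by
      funext v
      rw [map_mul, Finset.sum_apply]
      conv_lhs => rw [pev, aeval_X, mul_sum]
      rw [coeff_sum]
      refine sum_congr rfl fun j _ => ?_
      rw [← mul_assoc, mul_comm _ (C _), coeff_C_mul, mul_comm]
      rfl
    rw [e]
    refine Submodule.sum_mem _ fun j _ => ?_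
    simp only [coeff_mul_X', ell]
    by_cases hj : j ∈ a.support
    · simp only [hj, if_true]
      have hs : (a - Finsupp.single j 1).support = a.support.erase j := by
        ext i
        have := ha j
        simp only [Finsupp.mem_support_iff, Finsupp.coe_tsub, Pi.sub_apply, Finset.mem_erase, ne_eq, Finsupp.single_apply]
        by_cases h : i = j
        · subst h; simp; omega
        · simp [h, Ne.symm h, eq_comm]
      have ih := hp (a - Finsupp.single j 1) (fun i => (Nat.sub_le _ _).trans (ha i))
      rw [hs] at ih
      split_ifs with hl
      · simp only [mul_add]
        refine Submodule.add_mem _ (mlt_mul hj _ _ _ ih) ?_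
        have := smul_mem _ (ee j) (mlt_mul hj i.2.1 i.1 _ ih)
        convert this using 1
        funext v; simp only [Pi.smul_apply, smul_eq_mul]; ring
      · simp only [mul_zero]; exact Submodule.zero_mem _
    · simp only [hj, if_false, zero_mul]; exact Submodule.zero_mem _
def gact (g : M3 F) (v : J × Bool → Fin 3 → F) : J × Bool → Fin 3 → F :=
  fun x i => ∑ a, g i a * v x a
lemma pev_inv (lab : J → Fin d) (ee : J → F) (g : M3 F) (hg : gᵀ * g = 1) (v)
    (p : Rpoly F d) (hp : p ∈ invAlg F d) : pev lab ee (gact g v) p = pev lab ee v p := by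
  have hg' : (gᵀ)ᵀ * gᵀ = 1 := by rw [transpose_transpose]; exact mul_eq_one_comm.mp hg
  conv_rhs => rw [← hp gᵀ hg']
  have : pev lab ee (gact g v) = (pev lab ee v).comp (actHom F d gᵀ) := by
    apply algHom_ext
    rintro ⟨i, i', k⟩
    rw [AlgHom.comp_apply, actHom, aeval_X]
    simp only [Matrix.mul_apply, map_apply, transpose_apply, genMat, of_apply, map_sum, map_mul, commutes]
    simp only [pev, aeval_X, algebraMap_eq]
    simp only [sum_univ_three, ← sum_add_distrib, mul_sum, Finset.sum_mul]
    refine sum_congr rfl fun j _ => ?_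
    have e : ell lab ee (gact g v) j i i' k = ∑ b, (∑ a, g i a * ell lab ee v j a b k) * g i' b := by
      simp only [ell, gact]
      split_ifs
      · simp only [sum_univ_three]; ring
      · simp
    rw [e]
    simp only [sum_univ_three, C_add, C_mul]
    ring
  rw [this]; rfl
def ew (w : J × Bool → Fin 3) : J × Bool → Fin 3 → F := fun x => Pi.single (w x) 1
lemma mlt_congr {S : Finset J} (f) (hf : f ∈ Mlt F S) (v v' : J × Bool → Fin 3 → F)
    (h : ∀ x, x.1 ∈ S → v x = v' x) : f v = f v' := by
  refine span_induction (p := fun f _ => f v = f v') ?_ ?_ ?_ ?_ hf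
  · rintro _ ⟨w, rfl⟩
    exact prod_congr rfl fun j hj => prod_congr rfl fun b _ => by rw [h (j, b) hj]
  · rfl
  · intro f g _ _ h1 h2; simp [h1, h2]
  · intro c f _ h1; simp [h1]
lemma mlt_exp {S : Finset J} (P : J → Prop) [DecidablePred P] (hP : ∀ j, j ∈ S ↔ P j) (f) (hf : f ∈ Mlt F S)
    (g : M3 F) (w : {x : J × Bool // P x.1} → Fin 3) :
    ∑ w' : {x : J × Bool // P x.1} → Fin 3, (∏ x, g (w' x) (w x)) *
      f (ew fun x => if h : P x.1 then w' ⟨x, h⟩ else 0) =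
    f (gact g (ew fun x => if h : P x.1 then w ⟨x, h⟩ else 0)) := by
  have hprod : ∀ h : J × Bool → F, ∏ j ∈ S, ∏ b, h (j, b) = ∏ x : {x : J × Bool // P x.1}, h x := by
    intro h
    rw [← Finset.prod_product' S univ (fun j b => h (j, b))]
    exact Finset.prod_subtype (S ×ˢ univ) (p := fun x : J × Bool => P x.1) (fun x => by simp [hP]) h
  refine span_induction (p := fun f _ => ∑ w' : {x : J × Bool // P x.1} → Fin 3, (∏ x, g (w' x) (w x)) *
      f (ew fun x => if h : P x.1 then w' ⟨x, h⟩ else 0) =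
    f (gact g (ew fun x => if h : P x.1 then w ⟨x, h⟩ else 0))) ?_ ?_ ?_ ?_ hf
  · rintro _ ⟨w0, rfl⟩
    have hp2 : ∀ V : J × Bool → Fin 3 → F, ∏ j ∈ S, ∏ b, V (j, b) (w0 (j, b)) = ∏ x : {x : J × Bool // P x.1}, V x (w0 x) :=
      fun V => hprod fun x => V x (w0 x)
    simp only [hp2]
    refine Eq.trans (Finset.sum_eq_single (fun x : {x : J × Bool // P x.1} => w0 x.1) ?_ ?_) ?_
    · intro w' _ hw
      obtain ⟨x, hx⟩ := Function.ne_iff.mp hw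
      refine mul_eq_zero_of_right _ (Finset.prod_eq_zero (i := x) (mem_univ _) ?_)
      have := x.2
      simp [ew, this, Pi.single_apply, Ne.symm hx]
    · simp
    · rw [Finset.prod_eq_one (s := univ) (f := fun x : {x : J × Bool // P x.1} => ew (F := F) _ _ _), mul_one]
      · refine prod_congr rfl fun x _ => ?_
        have := x.2
        simp [gact, ew, this, Pi.single_apply]
      · intro x _
        have := x.2
        simp [ew, this]
  · simp
  · intro f g _ _ h1 h2
    simp only [Pi.add_apply, mul_add, sum_add_distrib, h1, h2]
  · intro c f _ h1
    simp only [Pi.smul_apply, smul_eq_mul, ← h1, mul_sum]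
    exact sum_congr rfl fun _ _ => by ring
lemma kap_fft [Infinite F] (h2 : N2 F) (lab : J → Fin d) (ee : J → F) (p : Rpoly F d) (hp : p ∈ invAlg F d)
    (a : J →₀ ℕ) (ha : ∀ j, a j ≤ 1) (P : J → Prop) [DecidablePred P] (hP : ∀ j, j ∈ a.support ↔ P j) :
    ∃ k : Perm {x : J × Bool // P x.1} → F, (∀ σ, ¬ Fpf σ → k σ = 0) ∧
      ∀ w : J × Bool → Fin 3, coeff a (pev lab ee (ew w) p) = ∑ σ, k σ * Ev F σ (fun x => w x) := by
  have hm := kap_mlt lab ee p a ha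
  obtain ⟨k, hk, h⟩ := fft h2 (α := {x : J × Bool // P x.1}) (by
      have e : {x : J × Bool // P x.1} ≃ {j // P j} × Bool :=
        ⟨fun x => (⟨x.1.1, x.2⟩, x.1.2), fun x => ⟨(x.1.1, x.2), x.1.2⟩, fun _ => rfl, fun _ => rfl⟩
      rw [Fintype.card_congr e]; simp)
    (fun w => coeff a (pev lab ee (ew fun x => if h : P x.1 then w ⟨x, h⟩ else 0) p)) (by
      intro g hg w
      rw [mlt_exp P hP _ hm, pev_inv lab ee g hg _ p hp])
  refine ⟨k, hk, fun w => ?_⟩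
  rw [← h]
  refine mlt_congr _ hm _ _ ?_
  intro x hx
  simp [ew, (hP _).mp hx]
lemma pev_zero (lab : J → Fin d) (ee : J → F) (v) (p : Rpoly F d) :
    coeff 0 (pev lab ee v p) = constantCoeff p := by
  have : (constantCoeff : MvPolynomial J F →+* F).comp (pev lab ee v).toRingHom = constantCoeff := by
    apply MvPolynomial.ringHom_ext
    · intro r; simp [pev]
    · intro i; simp [pev]
  exact congrArg (fun f => f p) this
lemma ev_congr_mul (P : J → Prop) [DecidablePred P] (σ : Perm {x : J × Bool // P x.1})
    (τ : Perm {x : J × Bool // ¬ P x.1}) (w : J × Bool → Fin 3) :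
    Ev F σ (fun x => w x) * Ev F τ (fun x => w x) = Ev F (Perm.subtypeCongr (p := fun x : J × Bool => P x.1) σ τ) w := by
  simp only [Ev, mul_ite, mul_one, mul_zero, ← ite_and]
  congr 1
  rw [eq_iff_iff]
  constructor
  · rintro ⟨h1, h2⟩ x
    by_cases hx : P x.1
    · rw [Perm.subtypeCongr.left_apply (p := fun x : J × Bool => P x.1) _ _ hx]; exact h2 ⟨x, hx⟩
    · rw [Perm.subtypeCongr.right_apply (p := fun x : J × Bool => P x.1) _ _ hx]; exact h1 ⟨x, hx⟩
  · intro h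
    constructor
    · rintro ⟨x, hx⟩
      have := h x
      rw [Perm.subtypeCongr.right_apply (p := fun x : J × Bool => P x.1) _ _ hx] at this; exact this
    · rintro ⟨x, hx⟩
      have := h x
      rw [Perm.subtypeCongr.left_apply (p := fun x : J × Bool => P x.1) _ _ hx] at this; exact this
theorem dec_rel [Infinite F] (h2 : N2 F) (lab : J → Fin d) (ee : J → F) {A : Type} [Ring A] [Algebra F A]
    (o : J) (W : J × Bool → A) (one : J →₀ ℕ) (h1 : ∀ j, one j = 1)
    (p : Rpoly F d) (hp : p ∈ Dec F d) :
    ((fun w => coeff one (pev lab ee (ew w) p) : (J × Bool → Fin 3) → F), (0 : A)) ∈ RelM F o W := by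
  classical
  refine span_induction (p := fun p _ => ((fun w => coeff one (pev lab ee (ew w) p) : (J × Bool → Fin 3) → F), (0 : A)) ∈ RelM F o W) ?_ ?_ ?_ ?_ hp
  · rintro _ ⟨p, hp, q, hq, hp0, hq0, rfl⟩
    have e : ((fun w => coeff one (pev lab ee (ew w) (p * q)) : (J × Bool → Fin 3) → F), (0 : A)) =
        ∑ ab ∈ Finset.HasAntidiagonal.antidiagonal one,
          ((fun w => coeff ab.1 (pev lab ee (ew w) p) * coeff ab.2 (pev lab ee (ew w) q) : (J × Bool → Fin 3) → F), (0 : A)) := by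
      ext w
      · simp [Prod.fst_sum, Finset.sum_apply, map_mul, coeff_mul]
      · simp [Prod.snd_sum]
    rw [e]
    refine Submodule.sum_mem _ ?_
    rintro ⟨a, b⟩ hab
    rw [Finset.HasAntidiagonal.mem_antidiagonal] at hab
    simp only at hab ⊢
    have hab' : ∀ j, a j + b j = 1 := fun j => by
      have := DFunLike.congr_fun hab j
      simpa [h1] using this
    by_cases ha0 : a = 0
    · subst ha0
      simp only [pev_zero, hp0, zero_mul]; exact Submodule.zero_mem _
    by_cases hb0 : b = 0
    · subst hb0
      simp only [pev_zero, hq0, mul_zero]; exact Submodule.zero_mem _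
    obtain ⟨k1, hk1, e1⟩ := kap_fft h2 lab ee p hp a (fun j => by have := hab' j; omega) (fun j => j ∈ a.support) (fun j => Iff.rfl)
    obtain ⟨k2, hk2, e2⟩ := kap_fft h2 lab ee q hq b (fun j => by have := hab' j; omega) (fun j => ¬ j ∈ a.support)
      (fun j => by have := hab' j; simp only [Finsupp.mem_support_iff, ne_eq]; omega)
    have e : ((fun w => coeff a (pev lab ee (ew w) p) * coeff b (pev lab ee (ew w) q) : (J × Bool → Fin 3) → F), (0 : A)) =
        ∑ σ, ∑ τ, (k1 σ * k2 τ) • (Ev F (Perm.subtypeCongr (p := fun x : J × Bool => x.1 ∈ a.support) σ τ), (0 : A)) := by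
      ext w
      · simp only [Prod.fst_sum, Finset.sum_apply, e1, e2, Prod.smul_fst, Pi.smul_apply, smul_eq_mul, Finset.sum_mul_sum]
        refine sum_congr rfl fun σ _ => sum_congr rfl fun τ _ => ?_
        rw [← ev_congr_mul (F := F) (fun j => j ∈ a.support) σ τ w]; ring
      · simp [Prod.snd_sum]
    rw [e]
    refine Submodule.sum_mem _ fun σ _ => Submodule.sum_mem _ fun τ _ => ?_
    by_cases hσ : Fpf σ
    swap
    · rw [hk1 σ hσ, zero_mul, zero_smul]; exact Submodule.zero_mem _
    by_cases hτ : Fpf τ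
    swap
    · rw [hk2 τ hτ, mul_zero, zero_smul]; exact Submodule.zero_mem _
    refine smul_mem _ _ (Submodule.subset_span ⟨Perm.subtypeCongr (p := fun x : J × Bool => x.1 ∈ a.support) σ τ, ?_, ?_⟩)
    · constructor
      · intro x
        by_cases hx : x.1 ∈ a.support
        · have := hσ.1 ⟨x, hx⟩
          rw [Perm.subtypeCongr.left_apply (p := fun x : J × Bool => x.1 ∈ a.support) _ _ hx, Perm.subtypeCongr.left_apply_subtype, this]
        · have := hτ.1 ⟨x, hx⟩
          rw [Perm.subtypeCongr.right_apply (p := fun x : J × Bool => x.1 ∈ a.support) _ _ hx, Perm.subtypeCongr.right_apply_subtype, this]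
      · intro x hx'
        by_cases hx : x.1 ∈ a.support
        · rw [Perm.subtypeCongr.left_apply (p := fun x : J × Bool => x.1 ∈ a.support) _ _ hx] at hx'
          exact hσ.2 ⟨x, hx⟩ (Subtype.ext hx')
        · rw [Perm.subtypeCongr.right_apply (p := fun x : J × Bool => x.1 ∈ a.support) _ _ hx] at hx'
          exact hτ.2 ⟨x, hx⟩ (Subtype.ext hx')
    · congr 1
      symm
      by_cases ho : o ∈ a.support
      · obtain ⟨j, hj⟩ := Finsupp.ne_iff.mp hb0
        refine psi_closed W {j | j ∈ a.support} ho ?_ (j := j) ?_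
        · intro x hx
          rw [Perm.subtypeCongr.left_apply (p := fun x : J × Bool => x.1 ∈ a.support) _ _ hx]
          exact (σ ⟨x, hx⟩).2
        · have := hab' j
          simp only [Finsupp.coe_zero, Pi.zero_apply] at hj
          simp only [Set.mem_setOf_eq, Finsupp.mem_support_iff]; omega
      · obtain ⟨j, hj⟩ := Finsupp.ne_iff.mp ha0
        refine psi_closed W {j | ¬ j ∈ a.support} ho ?_ (j := j) ?_
        · intro x hx
          rw [Perm.subtypeCongr.right_apply (p := fun x : J × Bool => x.1 ∈ a.support) _ _ hx]
          exact (τ ⟨x, hx⟩).2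
        · simpa using hj
  · simp only [_root_.map_zero, coeff_zero]; exact Submodule.zero_mem _
  · intro x y _ _ h h'
    have := Submodule.add_mem _ h h'
    simpa only [Prod.mk_add_mk, add_zero, Pi.add_def, ← coeff_add, ← map_add] using this
  · intro c x _ h
    have := smul_mem _ c h
    simpa only [Prod.smul_mk, smul_zero, Pi.smul_def, ← coeff_smul, ← map_smul] using this
end pol
section words
open Equiv
variable {F : Type} [Field F] {d : ℕ}
def eps (F : Type) [Field F] (b : Bool) : F := if b then -1 else 1
lemma eps_sq (b : Bool) : eps F b * eps F b = 1 := by cases b <;> simp [eps]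
def nl (F : Type) [Field F] {d : ℕ} (s : Ltr d) : FA F d := ι F (s.1, false) + eps F s.2 • ι F (s.1, true)
def Thw (F : Type) [Field F] {d : ℕ} (l : List (Ltr d)) : FA F d := (l.map (nl F)).prod
lemma tp_nl (s : Ltr d) : tp F d (nl F s) = eps F s.2 • nl F s := by
  rw [nl, tp_add, tp_smul, tp_ι, tp_ι, smul_add, smul_smul, eps_sq, one_smul, add_comm]; rfl
lemma mf_nl (s : Ltr d) : nl F s ∈ MFsub F d :=
  Submodule.add_mem _ (mf_ι _) (smul_mem _ _ (mf_ι _))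
lemma list_smul_prod {S A Y : Type} [CommSemiring S] [Semiring A] [Algebra S A] (c : Y → S) (E : Y → A) (l : List Y) :
    (l.map fun y => c y • E y).prod = (l.map c).prod • (l.map E).prod := by
  induction l with
  | nil => simp
  | cons y l ih => simp [ih, smul_smul, mul_comm]
variable {n : ℕ} (l0 : Fin n → Ltr d) (z : Fin d)
def labJ : Option (Fin n) → Fin d := fun j => j.elim z fun i => (l0 i).1
def eeJ (F : Type) [Field F] : Option (Fin n) → F := fun j => j.elim 0 fun i => eps F (l0 i).2
def Phi (w : Option (Fin n) × Bool → Fin 3) : FA F d →ₐ[F] M3 (MvPolynomial (Option (Fin n)) F) :=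
  (pev (labJ l0 z) (eeJ l0 F) (ew w)).mapMatrix.comp (evMat F d)
def jy (y : Fin n × Bool) : Option (Fin n) × Bool := (some y.1, y.2)
def sg (F : Type) [Field F] (y : Fin n × Bool) : F := if y.2 then eps F (l0 y.1).2 else 1
lemma sg_sq (y : Fin n × Bool) : sg l0 F y * sg l0 F y = 1 := by
  unfold sg; split_ifs <;> simp [eps_sq]
lemma phi_gen (w : Option (Fin n) × Bool → Fin 3) (k : Fin d) (a b : Fin 3) :
    (pev (labJ l0 z) (eeJ l0 F) (ew w)) (X (a, b, k)) = ∑ j, X j * C (ell (labJ l0 z) (eeJ l0 F) (ew w) j a b k) := by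
  simp [pev]
lemma ite_C {J : Type} (a b x y : Fin 3) : (if x = a ∧ y = b then (1 : MvPolynomial J F) else 0) =
    C ((if a = x then (1 : F) else 0) * (if b = y then (1 : F) else 0)) := by
  by_cases h : a = x <;> by_cases h' : b = y <;> simp [h, h', @eq_comm _ x a, @eq_comm _ y b]
lemma phi_nl (w : Option (Fin n) × Bool → Fin 3) (s : Ltr d) (hs : s.1 ≠ z) :
    Phi l0 z w (nl F s) = ∑ y : Fin n × Bool, (if l0 y.1 = s then monomial (Finsupp.single (some y.1) 1) (2 * sg l0 F y) else 0 : MvPolynomial (Option (Fin n)) F) •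
      Matrix.single (w (jy y)) (w (th (jy y))) (1 : MvPolynomial (Option (Fin n)) F) := by
  ext1 a b
  rw [nl, map_add, map_smul]
  simp only [Phi, AlgHom.comp_apply, ev_ι, false_eq_true, if_false, if_true, Matrix.add_apply, Matrix.smul_apply,
    AlgHom.mapMatrix_apply, map_apply, transpose_apply, genMat, of_apply, phi_gen]
  rw [Matrix.sum_apply, Fintype.sum_prod_type, Fintype.sum_option, Fintype.sum_option, smul_add, Finset.smul_sum]
  have e0 : ∀ a b, ell (labJ l0 z) (eeJ l0 F) (ew w) none a b s.1 = 0 := fun a b => if_neg (Ne.symm hs)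
  rw [e0, e0, C_0, mul_zero, smul_zero, zero_add, zero_add, ← sum_add_distrib]
  refine sum_congr rfl fun i _ => ?_
  rw [Fintype.sum_bool]
  simp only [Matrix.smul_apply, smul_eq_mul, ell, labJ, eeJ, Option.elim_some, ew, Matrix.single_apply, Pi.single_apply, jy, th, sg,
    Bool.not_true, Bool.not_false, false_eq_true, if_false, if_true]
  by_cases h : l0 i = s
  · subst h
    rw [if_pos rfl, if_pos rfl, if_pos rfl, if_pos rfl, ← C_mul_X_eq_monomial, ← C_mul_X_eq_monomial]
    rw [ite_C, ite_C]
    generalize (if a = w (some i, false) then (1 : F) else 0) = p1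
    generalize (if b = w (some i, true) then (1 : F) else 0) = p2
    generalize (if b = w (some i, false) then (1 : F) else 0) = p3
    generalize (if a = w (some i, true) then (1 : F) else 0) = p4
    cases (l0 i).2 <;> simp only [eps, if_true, if_false, false_eq_true, smul_eq_C_mul, map_add, map_mul, map_one, map_neg, map_ofNat] <;> ring
  · rw [if_neg h, if_neg h]
    by_cases h1 : (l0 i).1 = s.1
    · have h2 : (l0 i).2 = !s.2 := by
        have : (l0 i).2 ≠ s.2 := fun h2 => h (Prod.ext h1 h2)
        revert this; cases (l0 i).2 <;> cases s.2 <;> simp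
      rw [if_pos h1, if_pos h1, h2]
      simp only [zero_mul, add_zero]
      cases s.2 <;> simp only [eps, Bool.not_true, Bool.not_false, if_true, if_false, false_eq_true, smul_eq_C_mul, map_add, map_mul, map_one, map_neg] <;> ring
    · simp [h1]
lemma phi_z (hz : ∀ i, (l0 i).1 ≠ z) (w : Option (Fin n) × Bool → Fin 3) :
    (pev (labJ l0 z) (eeJ l0 F) (ew w)).mapMatrix (genMat F d z) =
      (X none : MvPolynomial (Option (Fin n)) F) • Matrix.single (w (none, false)) (w (none, true)) (1 : MvPolynomial (Option (Fin n)) F) := by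
  ext1 a b
  simp only [AlgHom.mapMatrix_apply, map_apply, genMat, of_apply, phi_gen, Fintype.sum_option]
  simp only [ell, labJ, eeJ, Option.elim_some, Option.elim_none, hz, if_false, if_true, ew, Pi.single_apply, Matrix.smul_apply, Matrix.single_apply]
  by_cases p1 : a = w (none, false) <;> by_cases p2 : b = w (none, true) <;>
    simp [p1, p2, eq_comm]
end words
section words
open Equiv
variable {F : Type} [Field F] {d : ℕ} {n : ℕ} (l0 : Fin n → Ltr d) (z : Fin d)
def TT (l : Fin n → Ltr d) (r : Fin n → Fin n × Bool) : Prop :=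
  Injective (fun i => (r i).1) ∧ ∀ i, l0 (r i).1 = l i
lemma prod_exp {S A Y : Type} [Fintype Y] [CommSemiring S] [Semiring A] [Algebra S A] (G : Fin n → Y → S) (E : Y → A) :
    (ofFn fun i => ∑ y, G i y • E y).prod = ∑ r : Fin n → Y, (∏ i, G i (r i)) • ((ofFn r).map E).prod := by
  classical
  have h := (MultilinearMap.mkPiAlgebraFin S n A).map_sum (fun i y => G i y • E y)
  rw [mkPiAlgebraFin_apply] at h
  rw [h]
  refine sum_congr rfl fun r _ => ?_
  rw [MultilinearMap.map_smul_univ, mkPiAlgebraFin_apply, map_ofFn]; rfl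
lemma tr_map {R S : Type} [CommRing R] [CommRing S] [Algebra F R] [Algebra F S] (f : R →ₐ[F] S) (M : M3 R) :
    f (trace M) = trace (f.mapMatrix M) := by simp [Matrix.trace, map_sum]
lemma prod_mono {J Y : Type} (s : Finset Y) (f : Y → J →₀ ℕ) (c : Y → F) :
    ∏ i ∈ s, monomial (f i) (c i) = monomial (∑ i ∈ s, f i) (∏ i ∈ s, c i) := by
  classical
  induction s using Finset.induction_on with
  | empty => simp
  | insert a s ha ih => rw [Finset.prod_insert ha, Finset.sum_insert ha, Finset.prod_insert ha, ih, monomial_mul]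
lemma sumE (f : Fin n → Fin n) :
    (Injective f → ∀ j, (∑ i, Finsupp.single (some (f i)) 1 + Finsupp.single none 1 : Option (Fin n) →₀ ℕ) j = 1) ∧
    ((∀ j, (∑ i, Finsupp.single (some (f i)) 1 + Finsupp.single none 1 : Option (Fin n) →₀ ℕ) j = 1) → Injective f) := by
  have e : ∀ j, (∑ i, Finsupp.single (some (f i)) 1 + Finsupp.single none 1 : Option (Fin n) →₀ ℕ) (some j) = ∑ i, if f i = j then 1 else 0 := by
    intro j
    rw [Finsupp.add_apply, Finsupp.finset_sum_apply]
    simp [Finsupp.single_apply]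
  constructor
  · intro h j
    cases j with
    | none => rw [Finsupp.add_apply, Finsupp.finset_sum_apply]; simp [Finsupp.single_apply]
    | some j =>
      rw [e, (Finite.injective_iff_bijective.mp h).sum_comp (fun i => if i = j then 1 else 0)]; simp
  · intro h
    refine Finite.injective_iff_surjective.mpr fun j => ?_
    by_contra hj
    push Not at hj
    have := h (some j)
    rw [e] at this
    simp [hj] at this
open Classical in
lemma coef_Thw (l : Fin n → Ltr d) (hz : ∀ i, (l0 i).1 ≠ z) (hl : ∀ i, (l i).1 ≠ z)
    (one : Option (Fin n) →₀ ℕ) (h1 : ∀ j, one j = 1) (w : Option (Fin n) × Bool → Fin 3) :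
    coeff one (pev (labJ l0 z) (eeJ l0 F) (ew w) (trace (evMat F d (Thw F (ofFn l)) * genMat F d z))) =
    ∑ r : Fin n → Fin n × Bool, if TT l0 l r then (∏ i, (2 * sg l0 F (r i))) *
      (if List.IsChain (fun x y => w (th x) = w y) ((none, false) :: ((ofFn r).map jy ++ [(none, false)])) then 1 else 0) else 0 := by
  have e1 : pev (labJ l0 z) (eeJ l0 F) (ew w) (trace (evMat F d (Thw F (ofFn l)) * genMat F d z)) =
      trace (Phi l0 z w (Thw F (ofFn l)) * (pev (labJ l0 z) (eeJ l0 F) (ew w)).mapMatrix (genMat F d z)) := by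
    rw [Phi, AlgHom.comp_apply, ← map_mul, tr_map]
  have e2 : Phi l0 z w (Thw F (ofFn l)) = (ofFn fun i => ∑ y : Fin n × Bool, (if l0 y.1 = l i then monomial (Finsupp.single (some y.1) 1) (2 * sg l0 F y) else 0 : MvPolynomial (Option (Fin n)) F) •
      Matrix.single (w (jy y)) (w (th (jy y))) (1 : MvPolynomial (Option (Fin n)) F)).prod := by
    rw [Thw, map_list_prod, List.map_map, map_ofFn]
    congr 2; funext i
    exact phi_nl l0 z w (l i) (hl i)
  rw [e1, e2, prod_exp, phi_z l0 z hz, Finset.sum_mul, Matrix.trace_sum, coeff_sum]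
  refine sum_congr rfl fun r _ => ?_
  have e3 := chainE (S := MvPolynomial (Option (Fin n)) F) w ((ofFn r).map jy) (none, false) (none, false)
  rw [List.map_map] at e3
  have e4 : ∀ P : M3 (MvPolynomial (Option (Fin n)) F), ∀ c : MvPolynomial (Option (Fin n)) F,
      trace ((c • P) * ((X none : MvPolynomial (Option (Fin n)) F) • Matrix.single (w (none, false)) (w (none, true)) (1 : MvPolynomial (Option (Fin n)) F))) =
      c * X none * P (w (th (none, false))) (w (none, false)) := by
    intro P c
    rw [smul_mul, Matrix.mul_smul, Matrix.trace_smul, Matrix.trace_smul, Matrix.trace_mul_single]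
    simp [th]; ring
  rw [e4]
  have e5 : (∏ i, (if l0 (r i).1 = l i then monomial (Finsupp.single (some (r i).1) 1) (2 * sg l0 F (r i)) else 0 : MvPolynomial (Option (Fin n)) F)) =
      if ∀ i, l0 (r i).1 = l i then monomial (∑ i, Finsupp.single (some (r i).1) 1) (∏ i, (2 * sg l0 F (r i))) else 0 := by
    split_ifs with h
    · rw [← prod_mono]
      exact prod_congr rfl fun i _ => if_pos (h i)
    · push Not at h
      obtain ⟨i, hi⟩ := h
      exact Finset.prod_eq_zero (mem_univ i) (if_neg hi)
  rw [e5]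
  refine (congrArg (coeff one) (congrArg (_ * ·) e3)).trans ?_
  by_cases h : ∀ i, l0 (r i).1 = l i
  · rw [if_pos h, X, monomial_mul, mul_one]
    split_ifs with hc hT hT
    · rw [mul_one, coeff_monomial, if_pos, mul_one]
      ext j
      exact ((sumE _).1 hT.1 j).trans (h1 j).symm
    · rw [mul_one, coeff_monomial, if_neg]
      intro e
      exact hT ⟨(sumE fun i => (r i).1).2 fun j => (DFunLike.congr_fun e j).trans (h1 j), h⟩
    · simp
    · simp
  · rw [if_neg h, if_neg (show ¬ TT l0 l r from fun h' => h h'.2)]; simp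
open Classical in
lemma cnt_perm (τ : Perm (Fin n)) : (∑ r : Fin n → Fin n × Bool, if TT l0 (l0 ∘ τ) r then (1 : F) else 0) =
    ∑ r : Fin n → Fin n × Bool, if TT l0 l0 r then (1 : F) else 0 := by
  refine sum_equiv (Equiv.arrowCongr τ (Equiv.refl _)) _ _ fun r => if_congr ?_ rfl rfl
  simp only [TT, Equiv.arrowCongr_apply, Function.comp, Equiv.refl_apply, id]
  refine and_congr ⟨fun h => h.comp τ.symm.injective, fun h => ?_⟩ ⟨fun h i => by simpa using h (τ.symm i), fun h i => by simpa using h (τ i)⟩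
  simpa [comp_def] using h.comp τ.injective
open Classical in
lemma cnt_val : (∑ r : Fin n → Fin n × Bool, if TT l0 l0 r then (1 : F) else 0) =
    ((2 ^ n * ∏ s, (Fintype.card {a // l0 a = s}).factorial : ℕ) : F) := by
  rw [← DomMulAct.stabilizer_card, Finset.sum_boole, ← Fintype.card_subtype]
  congr 1
  have : Fintype.card (Fin n → Bool) = 2 ^ n := by simp
  rw [← this, mul_comm, ← Fintype.card_prod]
  refine Fintype.card_congr ⟨fun r => ⟨⟨Equiv.ofBijective (fun i => (r.1 i).1) (Finite.injective_iff_bijective.mp r.2.1), funext r.2.2⟩, fun i => (r.1 i).2⟩,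
    fun p => ⟨fun i => (p.1.1 i, p.2 i), p.1.1.injective, congrFun p.1.2⟩, fun r => rfl, fun p => ?_⟩
  refine Prod.ext (Subtype.ext (Equiv.ext fun i => rfl)) rfl
def WJ (F : Type) [Field F] : Option (Fin n) × Bool → QA F d := fun x => x.1.elim 0 fun i => sg l0 F (i, x.2) • pQ (nl F (l0 i))
open Classical in
lemma rel_Thw (l : Fin n → Ltr d) (hz : ∀ i, (l0 i).1 ≠ z) (hl : ∀ i, (l i).1 ≠ z)
    (one : Option (Fin n) →₀ ℕ) (h1 : ∀ j, one j = 1) :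
    ((fun w => coeff one (pev (labJ l0 z) (eeJ l0 F) (ew w) (trace (evMat F d (Thw F (ofFn l)) * genMat F d z)))),
      (2 ^ n * ∑ r : Fin n → Fin n × Bool, if TT l0 l r then (1 : F) else 0) • (pQ (Thw F (ofFn l)) : QA F d)) ∈ RelM F none (WJ l0 F) := by
  have key : ∀ r : Fin n → Fin n × Bool, TT l0 l r → ((fun w : Option (Fin n) × Bool → Fin 3 => (∏ i, (2 * sg l0 F (r i))) *
      (if List.IsChain (fun x y => w (th x) = w y) ((none, false) :: ((ofFn r).map jy ++ [(none, false)])) then 1 else 0)),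
      (2 : F) ^ n • (pQ (Thw F (ofFn l)) : QA F d)) ∈ RelM F none (WJ l0 F) := by
    intro r hr
    have hM : Ml (none : Option (Fin n)) ((ofFn r).map jy) := by
      have e : ((ofFn r).map jy).map Prod.fst = (ofFn fun i => (r i).1).map some := by
        simp only [List.map_map, map_ofFn]; rfl
      rw [Ml, e]
      refine ⟨nodup_cons.mpr ⟨by simp, (List.nodup_ofFn.mpr hr.1).map (Option.some_injective _)⟩, fun j => ?_⟩
      cases j with
      | none => simp
      | some j =>
        obtain ⟨i, hi⟩ := Finite.injective_iff_surjective.mp hr.1 j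
        refine List.mem_cons_of_mem _ (List.mem_map_of_mem (List.mem_ofFn.mpr ⟨i, hi⟩))
    obtain ⟨σ, hσ, hL, hE⟩ := sig_ex F hM
    have hm : (Ev F σ, Psi none (WJ l0 F) σ) ∈ RelM F none (WJ l0 F) := Submodule.subset_span ⟨σ, hσ, rfl⟩
    have hP : (Psi none (WJ l0 F) σ : QA F d) = (∏ i, sg l0 F (r i)) • pQ (Thw F (ofFn l)) := by
      rw [psi_val _ hL hM, List.map_map, map_ofFn]
      have h := (MultilinearMap.mkPiAlgebraFin F n (QA F d)).map_smul_univ (fun i => sg l0 F (r i)) (fun i => pQ (nl F (l i)))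
      rw [mkPiAlgebraFin_apply, mkPiAlgebraFin_apply] at h
      rw [Thw]
      refine Eq.trans ?_ (h.trans ?_)
      · congr 2; funext i
        simp only [Function.comp, WJ, jy, Option.elim_some, hr.2]
      · congr 1
        rw [map_ofFn]
        refine Eq.trans ?_ (map_list_prod (RingCon.mkₐ F (idealA F d).ringCon) _).symm
        rw [map_ofFn]; rfl
    have := smul_mem _ (∏ i, (2 * sg l0 F (r i))) hm
    rw [hP] at this
    convert this using 1
    refine Prod.ext ?_ ?_
    · funext w
      simp only [Prod.smul_fst, Pi.smul_apply, smul_eq_mul, hE]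
    · rw [Prod.smul_snd, smul_smul, ← Finset.prod_mul_distrib]
      simp [mul_assoc, sg_sq]
  have := Submodule.sum_mem (RelM F none (WJ l0 F)) (t := univ) (f := fun r : Fin n → Fin n × Bool => if TT l0 l r then ((fun w : Option (Fin n) × Bool → Fin 3 => (∏ i, (2 * sg l0 F (r i))) *
      (if List.IsChain (fun x y => w (th x) = w y) ((none, false) :: ((ofFn r).map jy ++ [(none, false)])) then 1 else 0)),
      (2 : F) ^ n • (pQ (Thw F (ofFn l)) : QA F d)) else 0) (fun r _ => by
        split_ifs with h
        · exact key r h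
        · exact Submodule.zero_mem _)
  convert this using 1
  refine Prod.ext ?_ ?_
  · funext w
    rw [Prod.fst_sum, Finset.sum_apply]
    refine (coef_Thw l0 z l hz hl one h1 w).trans ?_
    refine sum_congr rfl fun r _ => ?_
    by_cases h : TT l0 l r
    · rw [if_pos h, if_pos h]
    · rw [if_neg h, if_neg h]; rfl
  · rw [Prod.snd_sum, mul_sum, Finset.sum_smul]
    refine sum_congr rfl fun r _ => ?_
    split_ifs <;> simp
theorem pol_main [Infinite F] (h2 : N2 F) (hz : ∀ i, (l0 i).1 ≠ z)
    (hα : ((∏ s, (Fintype.card {a // l0 a = s}).factorial : ℕ) : F) ≠ 0) (u : FA F d)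
    (hu : u ∈ Submodule.span F {x | ∃ τ : Perm (Fin n), x = Thw F (ofFn (l0 ∘ τ))})
    (hD : trace (evMat F d u * genMat F d z) ∈ Dec F d) : u ∈ idealA F d := by
  classical
  set K : F := 2 ^ n * ((2 ^ n * ∏ s, (Fintype.card {a // l0 a = s}).factorial : ℕ) : F) with hK
  have hK0 : K ≠ 0 := by
    rw [hK, Nat.cast_mul]; push_cast at hα ⊢
    exact mul_ne_zero (pow_ne_zero _ h2) (mul_ne_zero (pow_ne_zero _ h2) hα)
  set one : Option (Fin n) →₀ ℕ := Finsupp.equivFunOnFinite.symm fun _ => 1 with ho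
  have h1 : ∀ j, one j = 1 := fun j => rfl
  have hR : ((fun w => coeff one (pev (labJ l0 z) (eeJ l0 F) (ew w) (trace (evMat F d u * genMat F d z)))), K • (pQ u : QA F d)) ∈ RelM F none (WJ l0 F) := by
    refine span_induction (p := fun u _ => ((fun w => coeff one (pev (labJ l0 z) (eeJ l0 F) (ew w) (trace (evMat F d u * genMat F d z)))), K • (pQ u : QA F d)) ∈ RelM F none (WJ l0 F)) ?_ ?_ ?_ ?_ hu
    · rintro _ ⟨τ, rfl⟩
      have := rel_Thw (F := F) l0 z (l0 ∘ τ) hz (fun i => hz _) one h1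
      rw [cnt_perm, cnt_val] at this
      exact this
    · convert Submodule.zero_mem _ using 1
      refine Prod.ext ?_ ?_
      · funext w; simp
      · simp
    · intro x y _ _ hx hy
      convert Submodule.add_mem _ hx hy using 1
      refine Prod.ext ?_ ?_
      · funext w; simp [add_mul]
      · simp
    · intro a x _ hx
      convert smul_mem _ a hx using 1
      refine Prod.ext ?_ ?_
      · funext w; simp
      · simp [smul_smul, mul_comm]
  have hR' := dec_rel h2 (labJ l0 z) (eeJ l0 F) none (WJ l0 F) one h1 _ hD
  have := Submodule.sub_mem _ hR hR'
  rw [Prod.mk_sub_mk, sub_self, sub_zero] at this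
  have h0 := rel_zero (asQ h2) none (WJ l0 F) ?_ ?_ _ this
  · rw [← pQ_eq]
    exact (smul_eq_zero.mp h0).resolve_left hK0
  · rintro ⟨_ | i, b⟩ hx
    · exact absurd rfl hx
    · exact smul_mem _ _ ⟨_, mf_nl _, rfl⟩
  · rintro ⟨_ | i, b⟩ hx
    · exact absurd rfl hx
    · simp only [WJ, Option.elim_some, map_smul, tQ_p, tp_nl, th, smul_smul]
      cases b <;> simp [sg, eps_sq]
end words
section om
variable {F A : Type} [Field F] [Ring A] [Algebra F A] {t : A →ₗ[F] A} {M : Submodule F A}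
lemma AS.c2 (h : AS F A t M) {x a : A} (hx : x ∈ M) (ha : a ∈ M) : x * a * x = -(x * x * a) - a * x * x := by
  have h2 := h.two
  have e1 := h.cube (x + a) (M.add_mem hx ha)
  have e2 := h.cube (x - a) (M.sub_mem hx ha)
  have e3 := h.cube a ha
  have : (2 : F) • (x * a * x + x * x * a + a * x * x) = 0 := by
    rw [two_smul]
    linear_combination (norm := noncomm_ring) e1 - e2 - 2 * e3
  have := (smul_eq_zero.mp this).resolve_left h2
  linear_combination (norm := noncomm_ring) this
lemma AS.T' (h : AS F A t M) {a b c : A} (ha : a ∈ M) (hb : b ∈ M) (hc : c ∈ M) (tb : t b = -b) (tc : t c = -c) :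
    a * b * c + b * t a * c + b * c * a = 0 := by
  have e := h.T a ha b hb c hc
  rw [tb, tc] at e
  have : (2 * 2 : F) • (a * b * c + b * t a * c + b * c * a) = 0 := by
    rw [mul_smul, two_smul, two_smul]
    linear_combination (norm := noncomm_ring) e
  exact (smul_eq_zero.mp this).resolve_left (mul_ne_zero h.two h.two)
def One (M : Submodule F A) : Prop := ∀ q : A, ∃ c : F, ∃ m ∈ M, q = c • 1 + m
lemma AS.four (h : AS F A t M) (ho : One M) {x : A} (hx : x ∈ M) (a b c : A) : x * a * x * b * x * c * x = 0 := by
  have h3 := h.cube x hx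
  have z0 : ∀ y, x * x * y * x * x = 0 := by
    intro y
    obtain ⟨r, m, hm, rfl⟩ := ho y
    have e := h.c2 hx hm
    have : x * x * (r • 1 + m) * x * x = r • (x * x * x * x) + x * (x * m * x) * x := by
      simp only [mul_add, add_mul, mul_smul_comm, smul_mul_assoc, mul_one, mul_assoc]
    rw [this, e, h3, zero_mul, smul_zero]
    linear_combination (norm := noncomm_ring) -h3 * m * x - x * m * h3
  have z1 : ∀ y c, x * x * y * x * c * x = 0 := by
    intro y c
    obtain ⟨r, m, hm, rfl⟩ := ho c
    have e := h.c2 hx hm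
    have : x * x * y * x * (r • 1 + m) * x = r • (x * x * y * x * x) + x * x * y * (x * m * x) := by
      simp only [mul_add, add_mul, mul_smul_comm, smul_mul_assoc, mul_one, mul_assoc]
    rw [this, e, z0, smul_zero]
    linear_combination (norm := noncomm_ring) -(z0 y * m) - z0 (y * m)
  obtain ⟨r, m, hm, rfl⟩ := ho a
  have e := h.c2 hx hm
  have : x * (r • 1 + m) * x * b * x * c * x = r • (x * x * b * x * c * x) + (x * m * x) * b * x * c * x := by
    simp only [mul_add, add_mul, mul_smul_comm, smul_mul_assoc, mul_one, mul_assoc]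
  rw [this, e, z1, smul_zero]
  linear_combination (norm := noncomm_ring) -z1 (m * b) c - m * z1 b c
variable (h : AS F A t M) (ho : One M) (h3 : (3 : F) = 0) {k : A} (hk : k ∈ M) (tk : t k = -k)
lemma dec3 (h : AS F A t M) (ho : One M) (q : A) :
    ∃ c : F, ∃ s l : A, q = c • 1 + s + l ∧ s ∈ M ∧ t s = s ∧ l ∈ M ∧ t l = -l := by
  obtain ⟨c, m, hm, rfl⟩ := ho q
  have h2 := h.two
  refine ⟨c, (2⁻¹ : F) • (m + t m), (2⁻¹ : F) • (m - t m), ?_, M.smul_mem _ (M.add_mem hm (h.t_mem _ hm)), ?_,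
    M.smul_mem _ (M.sub_mem hm (h.t_mem _ hm)), ?_⟩
  · rw [add_assoc, ← smul_add]
    congr 1
    have : m + t m + (m - t m) = (2 : F) • m := by rw [two_smul]; abel
    rw [this, smul_smul, inv_mul_cancel₀ h2, one_smul]
  · rw [map_smul, map_add, h.t_t, add_comm]
  · rw [map_smul, map_sub, h.t_t, ← smul_neg, neg_sub]
def om (k y : A) : A := k * k * y * k
include h hk tk in
lemma om_all :
    (∀ b ∈ M, t b = -b → om k b = 0) ∧
    (∀ s ∈ M, t s = s → ∀ l ∈ M, t l = -l → om k s * l = 0 ∧ l * om k s = 0 ∧ om k (s * l) = 0 ∧ om k (l * s) = 0) ∧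
    (∀ a ∈ M, t a = -a → ∀ b ∈ M, t b = -b → om k (a * b) = 0) ∧
    (∀ s ∈ M, t s = s → ∀ r ∈ M, t r = r → om k s * r = r * om k s ∧ 2 * om k (r * s) + r * om k s + s * om k r = 0) := by
  have k3 : k * k * k = 0 := h.cube k hk
  have kbk : ∀ b ∈ M, t b = -b → k * b * k = 0 := by
    intro b hb tb
    have e1 := h.c2 hk hb
    have e2 := h.T' hb hk hk tk tk
    rw [tb] at e2
    have : (2 : F) • (k * b * k) = 0 := by
      rw [two_smul]
      linear_combination (norm := noncomm_ring) e1 - e2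
    exact (smul_eq_zero.mp this).resolve_left h.two
  have kkb : ∀ b ∈ M, t b = -b → k * k * b = - (b * k * k) := by
    intro b hb tb
    have e1 := h.c2 hk hb
    rw [kbk b hb tb] at e1
    linear_combination (norm := noncomm_ring) e1
  have om' : ∀ y ∈ M, om k y = -(k * y * k * k) := by
    intro y hy
    have e1 := h.c2 hk hy
    unfold om
    linear_combination (norm := noncomm_ring) k * e1 - k3 * y
  have p1 : ∀ b ∈ M, t b = -b → om k b = 0 := by
    intro b hb tb
    unfold om
    linear_combination (norm := noncomm_ring) k * kbk b hb tb
  refine ⟨p1, ?_, ?_, ?_⟩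
  · intro s hs ts l hl tl
    have q1 : om k s * l = 0 := by
      have e := h.T' hs hk hl tk tl
      rw [ts] at e
      unfold om
      linear_combination (norm := noncomm_ring) k * k * e - k3 * (s * l + l * s)
    have q2 : om k (s * l) = 0 := by
      have e1 := om' s hs
      have e2 := om' (s * l) (h.mul_l _ hl _)
      have e3 := kkb l hl tl
      linear_combination (norm := noncomm_ring) e2 - q1 + e1 * l - k * s * e3
    have q3 : om k (l * s) = 0 := by
      have e2 := om' (l * s) (h.mul_r _ hl _)
      have e := congrArg t q2
      rw [_root_.map_zero] at e
      unfold om at e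
      simp only [h.t_mul, tk, ts, tl] at e
      linear_combination (norm := noncomm_ring) e2 - e
    refine ⟨q1, ?_, q2, q3⟩
    unfold om at q3 ⊢
    linear_combination (norm := noncomm_ring) kkb l hl tl * s * k - q3
  · intro a ha ta b hb tb
    have e1 := p1 b hb tb
    have e2 := kkb a ha ta
    unfold om at e1 ⊢
    linear_combination (norm := noncomm_ring) e2 * b * k - a * e1
  · intro s hs ts r hr tr
    have hl : k * s + s * k ∈ M := M.add_mem (h.mul_r _ hk _) (h.mul_l _ hk _)
    have tl : t (k * s + s * k) = -(k * s + s * k) := by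
      rw [map_add, h.t_mul, h.t_mul, tk, ts]; noncomm_ring
    have e1 := h.T' hr hk hl tk tl
    have e2 := h.T' hr hl hk tl tk
    rw [tr] at e1 e2
    have f1 := h.c2 hk hr
    have f2 := h.c2 hk hs
    have g1 := om' s hs
    have g2 := om' (r * s) (h.mul_l _ hs _)
    constructor
    · unfold om
      linear_combination (norm := noncomm_ring) k * e1 - f1 * (k * s + s * k)- k3 * s * r + r * k3 * s
    · unfold om at g1 g2 ⊢
      linear_combination (norm := noncomm_ring) g2 - k * e2 + f1 * s * k + f2 * r * k + g1 * r
lemma om_add (k x y : A) : om k (x + y) = om k x + om k y := by unfold om; noncomm_ring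
lemma om_smul (k : A) (c : F) (x : A) : om k (c • x) = c • om k x := by simp [om]
include h ho hk tk in
lemma om_C :
    (∀ y, ∀ l ∈ M, t l = -l → om k y * l = 0 ∧ l * om k y = 0) ∧ (∀ y m, om k y * m = m * om k y) := by
  obtain ⟨p1, p2, p3, p4⟩ := om_all h hk tk
  have k3 : om k 1 = 0 := by rw [om, mul_one]; exact h.cube k hk
  have red : ∀ y, ∃ s ∈ M, t s = s ∧ om k y = om k s := by
    intro y
    obtain ⟨c, s, l, rfl, hs, ts, hl, tl⟩ := dec3 h ho y
    refine ⟨s, hs, ts, ?_⟩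
    rw [om_add, om_add, om_smul, k3, p1 l hl tl]; simp
  have q1 : ∀ y, ∀ l ∈ M, t l = -l → om k y * l = 0 ∧ l * om k y = 0 := by
    intro y l hl tl
    obtain ⟨s, hs, ts, e⟩ := red y
    rw [e]
    exact ⟨(p2 s hs ts l hl tl).1, (p2 s hs ts l hl tl).2.1⟩
  refine ⟨q1, fun y m => ?_⟩
  obtain ⟨s, hs, ts, e⟩ := red y
  obtain ⟨c, r, l, rfl, hr, tr, hl, tl⟩ := dec3 h ho m
  rw [mul_add, mul_add, add_mul, add_mul, (q1 y l hl tl).1, (q1 y l hl tl).2, e, (p4 s hs ts r hr tr).1]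
  simp
include h ho hk tk in
lemma om_comm (y m n : A) : om k y * (m * n) = om k y * (n * m) := by
  obtain ⟨q1, q2⟩ := om_C h ho hk tk
  have e : ∀ m, om k y * m = om k y * t m := by
    intro m
    obtain ⟨c, r, l, rfl, hr, tr, hl, tl⟩ := dec3 h ho m
    simp only [map_add, map_smul, h.t_one, tr, tl, mul_add, mul_neg, (q1 y l hl tl).1, neg_zero]
  calc om k y * (m * n) = om k y * (t n * t m) := by rw [e, h.t_mul]
    _ = n * (om k y * m) := by rw [← mul_assoc, ← e n, q2, mul_assoc, ← e m]
    _ = om k y * (n * m) := by rw [← mul_assoc, ← q2, mul_assoc]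
include h ho hk tk h3 in
lemma om_der (x y : A) : om k (x * y) = om k x * y + om k y * x := by
  obtain ⟨p1, p2, p3, p4⟩ := om_all h hk tk
  obtain ⟨q1, q2⟩ := om_C h ho hk tk
  have k3 : om k 1 = 0 := by rw [om, mul_one]; exact h.cube k hk
  obtain ⟨c, s, l, rfl, hs, ts, hl, tl⟩ := dec3 h ho x
  obtain ⟨c', r, l', rfl, hr, tr, hl', tl'⟩ := dec3 h ho y
  have e := (p4 r hr tr s hs ts).2
  have e3 : ∀ x : A, x + x + x = 0 := by
    intro x
    have : (3 : F) • x = 0 := by rw [h3, zero_smul]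
    rw [← this, show (3 : F) = 1 + 1 + 1 by norm_num, add_smul, add_smul, one_smul]
  have e4 : om k (s * r) = om k s * r + om k r * s := by
    rw [q2 s r, q2 r s]
    linear_combination (norm := noncomm_ring) e3 (om k (s * r)) - e
  simp only [mul_add, add_mul, om_add, smul_mul_assoc, mul_smul_comm, one_mul, mul_one, om_smul, k3, smul_zero, p1 l hl tl, p1 l' hl' tl',
    (p2 r hr tr l hl tl).2.2.2, (p2 s hs ts l' hl' tl').2.2.1, p3 l hl tl l' hl' tl', (q1 _ l hl tl).1, (q1 _ l' hl' tl').1, e4]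
  simp only [zero_add, add_zero, zero_mul]
  abel
end om
section der
variable {F : Type} [Field F] {d : ℕ}
def ddh (F : Type) [Field F] {d : ℕ} (j : Fin d) : FA F d →ₐ[F] TrivSqZeroExt (FA F d) (FA F d) :=
  FreeAlgebra.lift F fun p : Ltr d => TrivSqZeroExt.inl (ι F p) + TrivSqZeroExt.inr (if p.1 = j then 1 else 0)
lemma ddh_fst (j : Fin d) (a : FA F d) : (ddh F j a).fst = a := by
  have : (TrivSqZeroExt.fstHom F (FA F d) (FA F d)).comp (ddh F j) = AlgHom.id F _ := by
    ext p; simp [ddh]; split_ifs <;> simp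
  exact DFunLike.congr_fun this a
def dd (j : Fin d) : FA F d →ₗ[F] FA F d := (TrivSqZeroExt.sndHom (FA F d) (FA F d)).restrictScalars F ∘ₗ (ddh F j).toLinearMap
lemma dd_mul (j : Fin d) (a b : FA F d) : dd j (a * b) = a * dd j b + dd j a * b := by
  simp [dd, ddh_fst]
lemma dd_one (j : Fin d) : dd j (1 : FA F d) = 0 := by simp [dd]
lemma dd_ι (j : Fin d) (p : Ltr d) : dd j (ι F p) = if p.1 = j then 1 else 0 := by
  simp [dd, ddh]; split_ifs <;> simp
lemma oneF (a : FA F d) : ∃ c : F, ∃ m ∈ MFsub F d, a = c • 1 + m := by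
  refine span_induction (p := fun a _ => ∃ c : F, ∃ m ∈ MFsub F d, a = c • 1 + m) ?_ ?_ ?_ ?_ (FA_span (Submodule.mem_top : a ∈ ⊤))
  · rintro _ ⟨l, rfl⟩
    rcases eq_or_ne l [] with rfl | hl
    · exact ⟨1, 0, Submodule.zero_mem _, by simp [wordOf]⟩
    · exact ⟨0, _, Submodule.subset_span ⟨l, hl, rfl⟩, by simp⟩
  · exact ⟨0, 0, Submodule.zero_mem _, by simp⟩
  · rintro _ _ _ _ ⟨c, m, hm, rfl⟩ ⟨c', m', hm', rfl⟩
    exact ⟨c + c', m + m', Submodule.add_mem _ hm hm', by rw [add_smul]; abel⟩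
  · rintro r _ _ ⟨c, m, hm, rfl⟩
    exact ⟨r * c, r • m, smul_mem _ _ hm, by rw [smul_add, mul_smul]⟩
lemma oneQ : One (MQ F d) := by
  intro q
  obtain ⟨a, rfl⟩ := pQ_surj q
  obtain ⟨c, m, hm, rfl⟩ := oneF a
  exact ⟨c, pQ m, ⟨m, hm, rfl⟩, by rw [map_add, map_smul, pQ_one]⟩
lemma dd_tp (j : Fin d) (a : FA F d) : dd j (tp F d a) = tp F d (dd j a) := by
  induction a using FreeAlgebra.induction with
  | grade0 r => rw [tp_algebraMap, algebraMap_eq_smul_one, map_smul, dd_one, smul_zero]; exact (map_zero tpl).symm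
  | grade1 x => rw [tp_ι, dd_ι, dd_ι]; split_ifs; exacts [tp_one.symm, (map_zero tpl).symm]
  | mul a b ha hb => rw [tp_mul, dd_mul, dd_mul, tp_add, tp_mul, tp_mul, ha, hb, add_comm]
  | add a b ha hb => rw [tp_add, map_add, ha, hb, map_add, tp_add]
lemma dd_I (h2 : N2 F) (h3 : (3 : F) = 0) (j : Fin d) (a : FA F d) (ha : a ∈ idealA F d) : dd j a ∈ idealA F d := by
  have h := asQ (F := F) (d := d) h2
  have e3 : ∀ x : QA F d, x + x + x = 0 := by
    intro x
    have : (3 : F) • x = 0 := by rw [h3, zero_smul]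
    rw [← this, show (3 : F) = 1 + 1 + 1 by norm_num, add_smul, add_smul, one_smul]
  let f : FA F d → FA F d := dd j
  let J : TwoSidedIdeal (FA F d) := TwoSidedIdeal.mk' {a | a ∈ idealA F d ∧ dd j a ∈ idealA F d}
    ⟨zero_mem _, by rw [_root_.map_zero]; exact zero_mem _⟩
    (fun hx hy => ⟨add_mem hx.1 hy.1, by rw [map_add]; exact add_mem hx.2 hy.2⟩)
    (fun hx => ⟨neg_mem hx.1, by rw [map_neg]; exact neg_mem hx.2⟩)
    (fun {x y} hy => ⟨mul_mem_left _ _ _ hy.1, by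
      rw [dd_mul]; exact add_mem (mul_mem_left _ _ _ hy.2) (mul_mem_left _ _ _ hy.1)⟩)
    (fun {x y} hx => ⟨mul_mem_right _ _ _ hx.1, by
      rw [dd_mul]; exact add_mem (mul_mem_right _ _ _ hx.1) (mul_mem_right _ _ _ hx.2)⟩)
  have hJ : idealA F d ≤ J := by
    refine TwoSidedIdeal.span_le.mpr ?_
    rintro x hx
    have hxI : x ∈ idealA F d := TwoSidedIdeal.subset_span hx
    refine (mem_mk' _ _ _ _ _ _ _).mpr ⟨hxI, ?_⟩
    rw [← pQ_eq]
    have hb : ∀ b, ∃ m ∈ MFsub F d, dd j (bar F d b) = bar F d m := by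
      intro b
      obtain ⟨c, m, hm, e⟩ := oneF (dd j b)
      refine ⟨m, hm, ?_⟩
      rw [bar, map_sub, dd_tp, e, tp_add, tp_smul, tp_one, bar]; abel
    rcases hx with ⟨a, ha, rfl⟩ | ⟨a, ha, b, hb', c, hc, rfl⟩
    · obtain ⟨c, m, hm, e⟩ := oneF (dd j a)
      have := h.c2 (x := pQ a) (a := pQ m) ⟨a, ha, rfl⟩ ⟨m, hm, rfl⟩
      have e4 := e3 (c • (pQ a * pQ a))
      rw [pow_succ, pow_two, dd_mul, dd_mul, e]
      simp only [pQ_mul, map_add, mul_add, add_mul, map_smul, pQ_one, mul_smul_comm, smul_mul_assoc, mul_one, one_mul]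
      linear_combination (norm := noncomm_ring) this + e4
    · obtain ⟨r, m, hm, e⟩ := oneF (dd j a)
      obtain ⟨b1, hb1, eb⟩ := hb b
      obtain ⟨c1, hc1, ec⟩ := hb c
      have t1 := h.T (pQ m) ⟨m, hm, rfl⟩ (pQ b) ⟨b, hb', rfl⟩ (pQ c) ⟨c, hc, rfl⟩
      have t2 := h.T (pQ a) ⟨a, ha, rfl⟩ (pQ b1) ⟨b1, hb1, rfl⟩ (pQ c) ⟨c, hc, rfl⟩
      have t3 := h.T (pQ a) ⟨a, ha, rfl⟩ (pQ b) ⟨b, hb', rfl⟩ (pQ c1) ⟨c1, hc1, rfl⟩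
      have e4 := e3 (r • (pQ (bar F d b) * pQ (bar F d c)))
      simp only [tQ_p, ← map_sub] at t1 t2 t3
      simp only [← bar.eq_1] at t1 t2 t3
      rw [Trel]
      simp only [map_add, dd_mul, eb, ec, dd_tp, e]
      simp only [pQ_mul, map_add, tp_add, tp_smul, tp_one, mul_add, add_mul, map_smul, pQ_one, mul_smul_comm, smul_mul_assoc, mul_one, one_mul]
      linear_combination (norm := noncomm_ring) t1 + t2 + t3 + e4
  exact ((mem_mk' _ _ _ _ _ _ _).mp (hJ ha)).2
end der
section nf
variable {F : Type} [Field F] {d : ℕ}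
lemma Thw_app (l l' : List (Ltr d)) : Thw F (l ++ l') = Thw F l * Thw F l' := by simp [Thw]
lemma Thw_cons (x) (l : List (Ltr d)) : Thw F (x :: l) = nl F x * Thw F l := by simp [Thw]
lemma Thw_nil : Thw F ([] : List (Ltr d)) = 1 := rfl
lemma split1 {Y : Type} [BEq Y] [LawfulBEq Y] (x : Y) (l : List Y) (n : ℕ) (h : n + 1 ≤ l.count x) :
    ∃ p q, l = p ++ x :: q ∧ n ≤ q.count x := by
  induction l with
  | nil => simp at h
  | cons y l ih =>
    by_cases e : y = x
    · subst e; exact ⟨[], l, rfl, by simpa using h⟩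
    · rw [List.count_cons_of_ne e] at h
      obtain ⟨p, q, rfl, hq⟩ := ih h
      exact ⟨y :: p, q, rfl, hq⟩
lemma I_four (h2 : N2 F) (x) (l : List (Ltr d)) (h : 4 ≤ l.count x) : Thw F l ∈ idealA F d := by
  obtain ⟨p, q, rfl, ha⟩ := split1 x l 3 h
  obtain ⟨a, q, rfl, hb⟩ := split1 x q 2 ha
  obtain ⟨b, q, rfl, hc⟩ := split1 x q 1 hb
  obtain ⟨c, q, rfl, hd⟩ := split1 x q 0 hc
  rw [← pQ_eq]
  have := (asQ h2).four oneQ ⟨nl F x, mf_nl x, rfl⟩ (pQ (Thw F a)) (pQ (Thw F b)) (pQ (Thw F c))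
  simp only [Thw_app, Thw_cons, pQ_mul]
  linear_combination (norm := noncomm_ring) (pQ (Thw F p)) * this * pQ (Thw F q)
variable (k : Fin d)
def V (F : Type) [Field F] (k : Fin d) (x : Ltr d) (c : List (Ltr d)) : FA F d := om (nl F (k, true)) (nl F x) * Thw F c
def SV (F : Type) [Field F] (k : Fin d) (β : Multiset (Ltr d)) : Submodule F (QA F d) :=
  Submodule.span F {v | ∃ (x : Ltr d) (c : List (Ltr d)), x ::ₘ (↑c : Multiset (Ltr d)) = β ∧ v = pQ (V F k x c)}
lemma pQ_om (k y : FA F d) : pQ (om k y) = om (pQ k) (pQ y) := rfl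
lemma hk0 : pQ (nl F (k, true)) ∈ MQ F d := ⟨_, mf_nl _, rfl⟩
lemma tk0 : tQ (pQ (nl F (k, true))) = -pQ (nl F (k, true)) := by rw [tQ_p, tp_nl]; simp [eps]
variable (h2 : N2 F) (h3 : (3 : F) = 0)
include h2 h3 in
lemma nf1 : ∀ b c : List (Ltr d), pQ (om (nl F (k, true)) (Thw F b) * Thw F c) ∈ SV F k ((↑b : Multiset (Ltr d)) + (↑c : Multiset (Ltr d))) := by
  intro b
  induction b with
  | nil =>
    intro c
    rw [Thw_nil, pQ_mul, pQ_om, pQ_one, om, mul_one, (asQ h2).cube _ (hk0 k), zero_mul]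
    exact Submodule.zero_mem _
  | cons x b ih =>
    intro c
    have e : pQ (om (nl F (k, true)) (Thw F (x :: b)) * Thw F c) = pQ (V F k x (b ++ c)) + pQ (om (nl F (k, true)) (Thw F b) * Thw F (x :: c)) := by
      rw [V]
      simp only [pQ_mul, pQ_om, Thw_app, Thw_cons, om_der (asQ h2) oneQ h3 (hk0 k) (tk0 k)]
      noncomm_ring
    rw [e]
    refine Submodule.add_mem _ (Submodule.subset_span ⟨x, b ++ c, ?_, rfl⟩) ?_
    · simp
    · have := ih (x :: c)
      convert this using 2
      simpa using List.perm_middle.symm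
include h3 in
lemma e3Q (x : QA F d) : x + x + x = 0 := by
  have : (3 : F) • x = 0 := by rw [h3, zero_smul]
  rw [← this, show (3 : F) = 1 + 1 + 1 by norm_num, add_smul, add_smul, one_smul]
include h2 h3 in
lemma nf2 (l : List (Ltr d)) (h : 3 ≤ l.count (k, true)) (β : Multiset (Ltr d))
    (hβ : (l : Multiset _) = (k, true) ::ₘ (k, true) ::ₘ (k, true) ::ₘ β) : pQ (Thw F l) ∈ SV F k β := by
  obtain ⟨p, q, rfl, ha⟩ := split1 (k, true) l 2 h
  obtain ⟨a, q, rfl, hb⟩ := split1 _ q 1 ha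
  obtain ⟨b, q, rfl, hc⟩ := split1 _ q 0 hb
  have hβ' : β = ((↑p : Multiset (Ltr d)) + (↑a : Multiset (Ltr d)) + (↑b : Multiset (Ltr d)) + (↑q : Multiset (Ltr d))) := by
    have : ((p ++ (k, true) :: (a ++ (k, true) :: (b ++ (k, true) :: q)) : List _) : Multiset (Ltr d)) =
      (k, true) ::ₘ (k, true) ::ₘ (k, true) ::ₘ ((↑p : Multiset (Ltr d)) + (↑a : Multiset (Ltr d)) + (↑b : Multiset (Ltr d)) + (↑q : Multiset (Ltr d))) := by
      simp only [← Multiset.coe_add, ← cons_coe, Multiset.cons_add, Multiset.add_cons, add_assoc]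
    rw [this] at hβ
    exact ((Multiset.cons_inj_right _).1 ((Multiset.cons_inj_right _).1 ((Multiset.cons_inj_right _).1 hβ))).symm
  obtain ⟨q1, q2⟩ := om_C (asQ h2) oneQ (hk0 (F := F) k) (tk0 k)
  have e : pQ (Thw F (p ++ (k, true) :: (a ++ (k, true) :: (b ++ (k, true) :: q)))) =
      pQ (om (nl F (k, true)) (Thw F b) * Thw F (p ++ a ++ q)) - pQ (om (nl F (k, true)) (Thw F a) * Thw F (p ++ b ++ q)) := by
    simp only [Thw_app, Thw_cons, pQ_mul, pQ_om]
    have := om_der (asQ h2) oneQ h3 (hk0 (F := F) k) (tk0 k)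
    generalize pQ (Thw F p) = P at *
    generalize pQ (Thw F b) = B at *
    generalize pQ (Thw F q) = Z at *
    generalize pQ (Thw F a) = A at *
    obtain ⟨c, m, hm, rfl⟩ := oneQ A
    have f1 := (asQ h2).c2 (hk0 k) hm
    have f2 := this m B
    generalize hK : pQ (nl F (k, true)) = K at *
    have f0 : om K 1 = 0 := by rw [om, mul_one, ← hK]; exact (asQ h2).cube _ (hk0 k)
    have f3 := e3Q h3 (om K B * m)
    have f4 := q2 B m
    have f5 := q2 (m * B) P
    have f6 := q2 B P
    have f7 := q2 m P
    rw [om_add, om_smul, f0]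
    have g : P * (K * ((c • 1 + m) * (K * (B * (K * Z))))) = P * (c • om K B + K * m * K * B * K) * Z := by
      simp only [om, mul_add, add_mul, smul_mul_assoc, mul_smul_comm, one_mul, mul_assoc]
    rw [g, f1]
    have g2 : P * (c • om K B + (-(K * K * m) - m * K * K) * B * K) * Z = (c • om K B - om K (m * B) - m * om K B) * (P * Z) := by
      have : c • om K B + (-(K * K * m) - m * K * K) * B * K = c • om K B - om K (m * B) - om K B * m := by
        rw [f4]; simp only [om]; noncomm_ring
      rw [this, f4, ← mul_assoc]
      congr 1
      rw [← f4, f2]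
      have : om K B * m * P = P * (om K B * m) := by
        rw [← mul_assoc P, ← f6, mul_assoc, mul_assoc, ← hK, om_comm (asQ h2) oneQ (hk0 k) (tk0 k)]
      have h' : om K m * B * P = P * (om K m * B) := by
        rw [← mul_assoc P, ← f7, mul_assoc, mul_assoc, ← hK, om_comm (asQ h2) oneQ (hk0 k) (tk0 k)]
      simp only [mul_add, add_mul, mul_sub, sub_mul, mul_smul_comm, smul_mul_assoc, f6, this, h']
    rw [g2, f2]
    have g3 : om K B * (P * (c • 1 + m) * Z) = c • (om K B * (P * Z)) + om K B * m * (P * Z) := by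
      have : om K B * (P * m) = om K B * (m * P) := by rw [← hK]; exact om_comm (asQ h2) oneQ (hk0 k) (tk0 k) _ _ _
      simp only [mul_add, add_mul, mul_smul_comm, smul_mul_assoc, mul_one]
      rw [← mul_assoc (om K B) (P * m), this]; simp only [mul_assoc]
    have g4 : om K m * (P * B * Z) = om K m * B * (P * Z) := by
      have : om K m * (P * B) = om K m * (B * P) := by rw [← hK]; exact om_comm (asQ h2) oneQ (hk0 k) (tk0 k) _ _ _
      rw [← mul_assoc (om K m) (P * B), this]; simp only [mul_assoc]
    rw [g3, smul_zero, zero_add, g4, ← f4, sub_mul, sub_mul, smul_mul_assoc]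
    linear_combination (norm := noncomm_ring) -f3 * (P * Z)
  rw [e, hβ']
  refine Submodule.sub_mem _ ?_ ?_
  · convert nf1 k h2 h3 b (p ++ a ++ q) using 2
    simp only [← Multiset.coe_add]; abel
  · convert nf1 k h2 h3 a (p ++ b ++ q) using 2
    simp only [← Multiset.coe_add]; abel
end nf
section euler
variable {F : Type} [Field F] {d : ℕ}
lemma dd_nl (j : Fin d) (s : Ltr d) : dd j (nl F s) = (if s.1 = j then (1 + eps F s.2) else 0) • (1 : FA F d) := by
  rw [nl, map_add, map_smul, dd_ι, dd_ι]
  split_ifs <;> simp [add_smul]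
variable (k : Fin d) (h2 : N2 F) (h3 : (3 : F) = 0)
include h2 in
lemma euler1 (y : QA F d) (j : Fin d) : ∀ c : List (Ltr d), (∀ s ∈ c, s.2 = false) →
    om (pQ (nl F (k, true))) y * pQ (dd j (Thw F c)) * pQ (nl F (j, false)) =
      ((2 * (↑c : Multiset (Ltr d)).count (j, false) : ℕ) : F) • (om (pQ (nl F (k, true))) y * pQ (Thw F c)) := by
  intro c
  obtain ⟨q1, q2⟩ := om_C (asQ h2) oneQ (hk0 (F := F) k) (tk0 k)
  have q3 := om_comm (asQ h2) oneQ (hk0 (F := F) k) (tk0 k) y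
  have q2 := q2 y
  generalize om (pQ (nl F (k, true))) y = O at *
  induction c with
  | nil => intro _; rw [Thw_nil, dd_one]; simp
  | cons s c ih =>
    intro hs
    have ih := ih (fun s h => hs s (List.mem_cons_of_mem _ h))
    have e := hs s List.mem_cons_self
    rw [Thw_cons, dd_mul, dd_nl, map_add, pQ_mul, mul_add, add_mul, ← mul_assoc O, q2, mul_assoc (pQ (nl F s)), mul_assoc (pQ (nl F s)), ih, mul_smul_comm, ← mul_assoc (pQ (nl F s)), ← q2, pQ_mul,
      mul_assoc O (pQ (nl F s))]
    obtain ⟨i, b⟩ := s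
    simp only at e; subst e
    by_cases hij : i = j
    · subst hij
      rw [← cons_coe, Multiset.count_cons_self, if_pos rfl, map_smul, pQ_one, smul_mul_assoc, one_mul, pQ_mul, mul_smul_comm, smul_mul_assoc, mul_assoc, q3, ← add_smul]
      congr 1
      simp [eps]; ring
    · rw [← cons_coe, Multiset.count_cons_of_ne (by simpa using Ne.symm hij), if_neg (by simpa using hij), pQ_mul]
      simp
include h2 in
lemma euler2 (j : Fin d) (x) (c : List (Ltr d)) (hc : ∀ s ∈ c, s.2 = false) :
    pQ (dd j (V F k x c) * nl F (j, false)) = ((2 * (↑c : Multiset (Ltr d)).count (j, false) : ℕ) : F) • pQ (V F k x c) := by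
  have e : dd j (om (nl F (k, true)) (nl F x)) = om (nl F (k, true)) (dd j (nl F x)) := by
    simp only [om, dd_mul]
    rw [dd_nl j (k, true)]
    simp [eps]
  have e2 : pQ (om (nl F (k, true)) (dd j (nl F x))) = 0 := by
    rw [dd_nl, om_smul, map_smul, pQ_om, pQ_one, om, mul_one, (asQ h2).cube _ (hk0 k), smul_zero]
  rw [V, dd_mul, e, add_mul, map_add, pQ_mul, pQ_mul, pQ_mul, pQ_mul, e2, zero_mul, zero_mul, add_zero, pQ_mul, pQ_om, euler1 k h2 _ j c hc]
def SF (F : Type) [Field F] (k : Fin d) (β : Multiset (Ltr d)) : Submodule F (FA F d) :=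
  Submodule.span F {v | ∃ (x : Ltr d) (c : List (Ltr d)), x ::ₘ (↑c : Multiset (Ltr d)) = β ∧ v = V F k x c}
lemma SV_SF (β : Multiset (Ltr d)) (q : QA F d) (h : q ∈ SV F k β) : ∃ v ∈ SF F k β, pQ v = q := by
  have : SV F k β ≤ (SF F k β).map pQ := by
    rw [SV, Submodule.span_le]
    rintro _ ⟨x, c, h, rfl⟩
    exact ⟨_, Submodule.subset_span ⟨x, c, h, rfl⟩, rfl⟩
  exact this h
include h2 in
lemma euler3 (β : Multiset (Ltr d)) (hβ : ∀ s ∈ β, s.2 = false) (j : Fin d) (v : FA F d) (hv : v ∈ SF F k β) :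
    ∃ w : FA F d, pQ (dd j v * nl F (j, false)) = ((2 * β.count (j, false) : ℕ) : F) • pQ v - (2 : F) • pQ w ∧
      ∀ i : Fin d, pQ (dd i w * nl F (i, false)) = ((2 * (β.erase (j, false)).count (i, false) : ℕ) : F) • pQ w := by
  induction hv using span_induction with
  | mem v hv =>
    obtain ⟨x, c, rfl, rfl⟩ := hv
    have hc : ∀ s ∈ c, s.2 = false := fun s hs => hβ s (by simp [hs])
    by_cases hx : x = (j, false)
    · subst hx
      refine ⟨V F k (j, false) c, ?_, fun i => ?_⟩
      · rw [euler2 k h2 j _ c hc, ← sub_smul]; congr 1; rw [Multiset.count_cons_self]; push_cast; ring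
      · rw [euler2 k h2 i _ c hc]; rw [Multiset.erase_cons_head]
    · refine ⟨0, ?_, fun i => by simp⟩
      rw [euler2 k h2 j _ c hc, Multiset.count_cons_of_ne (Ne.symm hx)]; simp
  | zero => exact ⟨0, by simp, by simp⟩
  | add a b _ _ ha hb =>
    obtain ⟨w, h, h'⟩ := ha
    obtain ⟨w1, h1, h1'⟩ := hb
    refine ⟨w + w1, ?_, fun i => ?_⟩
    · rw [map_add, add_mul, map_add, h, h1, map_add, map_add, smul_add, smul_add]; abel
    · rw [map_add, add_mul, map_add, h', h1', map_add, smul_add]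
  | smul r a _ ha =>
    obtain ⟨w, h, h'⟩ := ha
    refine ⟨r • w, ?_, fun i => ?_⟩
    · rw [map_smul, smul_mul_assoc, map_smul, h, map_smul, map_smul, smul_sub, smul_comm r, smul_comm r]
    · rw [map_smul, smul_mul_assoc, map_smul, h', map_smul, smul_comm r]
lemma cnt_ne (h2 : N2 F) {n : ℕ} (h : 0 < n) (h' : n ≤ 2) : ((2 * n : ℕ) : F) ≠ 0 := by
  interval_cases n
  · simpa using h2
  · rw [Nat.cast_mul]; exact mul_ne_zero (by simpa using h2) (by simpa using h2)
include h2 in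
lemma skew0 (β : Multiset (Ltr d)) (s) (hs : s ∈ β) (hs' : s.2 = true) (q : QA F d) (hq : q ∈ SV F k β) : q = 0 := by
  have : SV F k β ≤ ⊥ := by
    rw [SV, Submodule.span_le]
    rintro _ ⟨x, c, rfl, rfl⟩
    show _ = _
    obtain ⟨i, b⟩ := s
    simp only at hs'; subst hs'
    rw [V, pQ_mul, pQ_om]
    rcases Multiset.mem_cons.1 hs with rfl | hs
    · rw [(om_all (asQ h2) (hk0 k) (tk0 k)).1 _ (hk0 i) (tk0 i), zero_mul]
    · obtain ⟨p, q, rfl⟩ := List.append_of_mem (Multiset.mem_coe.1 hs)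
      obtain ⟨q1, q2⟩ := om_C (asQ h2) oneQ (hk0 (F := F) k) (tk0 k)
      rw [Thw_app, Thw_cons, pQ_mul, pQ_mul, ← mul_assoc, q2, mul_assoc, ← mul_assoc (om _ _), (q1 _ _ (hk0 i) (tk0 i)).1, zero_mul, mul_zero]
  exact this hq
include h2 h3 in
lemma skewmain (β : Multiset (Ltr d)) (hβ : ∀ s, s.2 = false → β.count s ≤ 2) (u : FA F d) (hu : pQ u ∈ SV F k β)
    (hd : ∀ j, dd j u ∈ idealA F d) : u ∈ idealA F d ∨ ∃ (i : Fin d) (c : F), β = {(i, false)} ∧ pQ u = c • pQ (om (nl F (k, true)) (nl F (i, false))) := by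
  by_cases hsk : ∃ s ∈ β, s.2 = true
  · obtain ⟨s, hs, hs'⟩ := hsk
    left; rw [← pQ_eq]; exact skew0 k h2 β s hs hs' _ hu
  have hsy : ∀ s ∈ β, s.2 = false := fun s hs => by
    by_contra h; exact hsk ⟨s, hs, by simpa using h⟩
  obtain ⟨v, hv, hvu⟩ := SV_SF k β _ hu
  have hvd : ∀ j, pQ (dd j v) = 0 := by
    intro j
    have : u - v ∈ idealA F d := by rw [← pQ_eq, map_sub, hvu, sub_self]
    have := dd_I h2 h3 j _ this
    rw [← pQ_eq, map_sub, map_sub, (pQ_eq _).2 (hd j), zero_sub, neg_eq_zero] at this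
    exact this
  rcases Multiset.empty_or_exists_mem β with rfl | ⟨⟨j, b⟩, hj⟩
  · left
    have : SV F k (0 : Multiset (Ltr d)) ≤ ⊥ := by
      rw [SV, Submodule.span_le]
      rintro _ ⟨x, c, h, rfl⟩
      exact absurd h (Multiset.cons_ne_zero)
    rw [← pQ_eq]; exact this hu
  have hb := hsy _ hj
  simp only at hb; subst hb
  obtain ⟨w, hw, hw'⟩ := euler3 k h2 β hsy j v hv
  rcases Multiset.empty_or_exists_mem (β.erase (j, false)) with h0 | ⟨⟨i, b⟩, hi⟩
  · right
    have hβ1 : β = {(j, false)} := by rw [← Multiset.cons_erase hj, h0]; rfl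
    subst hβ1
    have : SV F k {(j, false)} ≤ Submodule.span F {pQ (om (nl F (k, true)) (nl F (j, false)))} := by
      rw [SV, Submodule.span_le]
      rintro _ ⟨x, c, h, rfl⟩
      have hc : c = [] ∧ x = (j, false) := by
        have h1 := congrArg Multiset.card h
        simp at h1
        subst h1
        simpa using h
      obtain ⟨rfl, rfl⟩ := hc
      apply Submodule.subset_span
      simp [V, Thw_nil]
    obtain ⟨c, hc⟩ := Submodule.mem_span_singleton.1 (this hu)
    exact ⟨j, c, rfl, hc.symm⟩
  · left
    have hb := hsy _ (Multiset.mem_of_mem_erase hi)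
    simp only at hb; subst hb
    rw [pQ_mul, hvd, zero_mul] at hw
    have hww : pQ w = (β.count (j, false) : F) • pQ v := by
      have : (2 : F) • (pQ w - (β.count (j, false) : F) • pQ v) = 0 := by
        rw [smul_sub, smul_smul]; push_cast at hw; rw [← neg_sub, ← hw, neg_zero]
      exact sub_eq_zero.1 ((smul_eq_zero.1 this).resolve_left h2)
    have hwi : pQ (dd i w) = 0 := by
      have : w - (β.count (j, false) : F) • v ∈ idealA F d := by rw [← pQ_eq, map_sub, map_smul, hww, sub_self]
      have := dd_I h2 h3 i _ this
      rw [← pQ_eq, map_sub, map_sub, map_smul, map_smul, hvd, smul_zero, sub_zero] at this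
      exact this
    have h4 := hw' i
    rw [pQ_mul, hwi, zero_mul] at h4
    have h5 := (smul_eq_zero.1 h4.symm).resolve_left (cnt_ne h2 (Multiset.count_pos.2 hi) ((Multiset.count_le_of_le _ (Multiset.erase_le _ _)).trans (hβ _ rfl)))
    rw [h5, smul_zero, sub_zero] at hw
    have := (smul_eq_zero.1 hw.symm).resolve_left (cnt_ne h2 (Multiset.count_pos.2 hj) (hβ _ rfl))
    rw [← pQ_eq, ← hvu, this]
end euler
section base
variable {F : Type} [Field F] {d : ℕ} {B B' : Type} [CommRing B] [Algebra F B] [CommRing B'] [Algebra F B']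
def sub (Y : Fin d → M3 B) : Rpoly F d →ₐ[F] B := aeval fun p => Y p.2.2 p.1 p.2.1
lemma sub_gen (Y : Fin d → M3 B) (k : Fin d) : (sub (F := F) Y).mapMatrix (genMat F d k) = Y k := by
  ext i j; simp [sub, genMat]
lemma sub_comp (f : B →ₐ[F] B') (Y : Fin d → M3 B) (p : Rpoly F d) :
    f (sub Y p) = sub (fun k => f.mapMatrix (Y k)) p := by
  have : f.comp (sub Y) = sub (fun k => f.mapMatrix (Y k)) := by
    apply algHom_ext; intro i; simp [sub]
  exact DFunLike.congr_fun this p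
lemma sub_act (Y : Fin d → M3 B) (g : M3 F) (p : Rpoly F d) :
    sub Y (actHom F d g p) = sub (fun k => (g.map (algebraMap F B))ᵀ * Y k * g.map (algebraMap F B)) p := by
  have : (sub Y).comp (actHom F d g) = sub (fun k => (g.map (algebraMap F B))ᵀ * Y k * g.map (algebraMap F B)) := by
    apply algHom_ext
    rintro ⟨i, j, k⟩
    have e : ∀ k i j, sub Y (genMat F d k i j) = Y k i j := by intro k i j; simp [sub, genMat]
    have e2 : ∀ r, sub Y (algebraMap F (Rpoly F d) r) = algebraMap F B r := fun r => commutes _ _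
    have e3 : ∀ Z : Fin d → M3 B, sub (F := F) Z (X (i, j, k)) = Z k i j := fun Z => by simp [sub]
    rw [e3]
    simp only [AlgHom.comp_apply, actHom, aeval_X, Matrix.mul_apply, map_sum, map_mul, map_apply, transpose_apply, e, e2]
  exact DFunLike.congr_fun this p
lemma inv_sub (Y Y' : Fin d → M3 B) (g : M3 F) (hg : gᵀ * g = 1)
    (h : ∀ k, Y' k = (g.map (algebraMap F B))ᵀ * Y k * g.map (algebraMap F B)) (p : Rpoly F d) (hp : p ∈ invAlg F d) :
    sub Y' p = sub Y p := by
  rw [show Y' = _ from funext h, ← sub_act, hp g hg]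
def YM (α γ δ : B) (v : Fin 4 → B) : M3 B :=
  !![γ * v 2, α * v 1 + δ * v 3, 0; -(α * v 1) + δ * v 3, -(γ * v 2), α * v 0; 0, -(α * v 0), 0]
variable (k i z : Fin d)
def pv (F : Type) [Field F] [Algebra F B] (k i z : Fin d) (v : Fin 4 → B) : Rpoly F d →ₐ[F] B :=
  sub (fun q => YM (if q = k then 1 else 0) (if q = i then 1 else 0) (if q = z then 1 else 0) v)
lemma pv_map (f : B →ₐ[F] B') (v : Fin 4 → B) (p : Rpoly F d) : f (pv F k i z v p) = pv F k i z (fun j => f (v j)) p := by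
  rw [pv, sub_comp, pv]
  congr 2; funext q
  ext a b
  fin_cases a <;> fin_cases b <;> simp [YM, apply_ite f]
lemma pv1 (a c s x : B) (p : Rpoly F d) (hp : p ∈ invAlg F d) : pv F k i z ![a, -c, s, -x] p = pv F k i z ![a, c, s, x] p := by
  refine inv_sub _ _ !![-1, 0, 0; 0, 1, 0; 0, 0, 1] ?_ ?_ p hp
  · ext a b; fin_cases a <;> fin_cases b <;> simp [Matrix.mul_apply, sum_univ_three]
  · intro q
    generalize (if q = k then (1 : B) else 0) = α
    generalize (if q = i then (1 : B) else 0) = γ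
    generalize (if q = z then (1 : B) else 0) = δ
    ext a b; fin_cases a <;> fin_cases b <;> simp [YM, Matrix.mul_apply, sum_univ_three] <;> ring
lemma pv2 (a c s x : B) (p : Rpoly F d) (hp : p ∈ invAlg F d) : pv F k i z ![-a, c, s, x] p = pv F k i z ![a, c, s, x] p := by
  refine inv_sub _ _ !![1, 0, 0; 0, 1, 0; 0, 0, -1] ?_ ?_ p hp
  · ext a b; fin_cases a <;> fin_cases b <;> simp [Matrix.mul_apply, sum_univ_three]
  · intro q
    generalize (if q = k then (1 : B) else 0) = α
    generalize (if q = i then (1 : B) else 0) = γ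
    generalize (if q = z then (1 : B) else 0) = δ
    ext a b; fin_cases a <;> fin_cases b <;> simp [YM, Matrix.mul_apply, sum_univ_three]
lemma pv3 (c s x : B) (p : Rpoly F d) (hp : p ∈ invAlg F d) : pv F k i z ![0, -c, -s, x] p = pv F k i z ![0, c, s, x] p := by
  refine inv_sub _ _ !![0, 1, 0; 1, 0, 0; 0, 0, 1] ?_ ?_ p hp
  · ext a b; fin_cases a <;> fin_cases b <;> simp [Matrix.mul_apply, sum_univ_three]
  · intro q
    generalize (if q = k then (1 : B) else 0) = α
    generalize (if q = i then (1 : B) else 0) = γ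
    generalize (if q = z then (1 : B) else 0) = δ
    ext a b; fin_cases a <;> fin_cases b <;> simp [YM, Matrix.mul_apply, sum_univ_three]
lemma pv4 (a c : B) (p : Rpoly F d) (hp : p ∈ invAlg F d) : pv F k i z ![-c, -a, 0, 0] p = pv F k i z ![a, c, 0, 0] p := by
  refine inv_sub _ _ !![0, 0, 1; 0, 1, 0; 1, 0, 0] ?_ ?_ p hp
  · ext a b; fin_cases a <;> fin_cases b <;> simp [Matrix.mul_apply, sum_univ_three]
  · intro q
    generalize (if q = k then (1 : B) else 0) = α
    generalize (if q = i then (1 : B) else 0) = γ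
    generalize (if q = z then (1 : B) else 0) = δ
    ext a b; fin_cases a <;> fin_cases b <;> simp [YM, Matrix.mul_apply, sum_univ_three]
def dil (σ : Fin 4 → F) : MvPolynomial (Fin 4) F →ₐ[F] MvPolynomial (Fin 4) F := aeval fun i => C (σ i) * X i
lemma coeff_dil (σ : Fin 4 → F) (m : Fin 4 →₀ ℕ) (p : MvPolynomial (Fin 4) F) :
    coeff m (dil σ p) = (∏ i, σ i ^ m i) * coeff m p := by
  induction p using MvPolynomial.induction_on' with
  | monomial e c =>
    have : dil σ (monomial e c) = monomial e ((∏ i, σ i ^ e i) * c) := by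
      rw [dil, aeval_monomial, Finsupp.prod_fintype _ _ (by simp)]
      simp only [mul_pow, Finset.prod_mul_distrib]
      rw [monomial_eq (a := _ * c), Finsupp.prod_fintype _ _ (by simp)]
      simp [algebraMap_eq]; ring
    rw [this, coeff_monomial, coeff_monomial]
    split_ifs with h
    · rw [h]
    · simp
  | add p q hp hq => rw [map_add, coeff_add, hp, hq, coeff_add, mul_add]
def m4 (a c s x : ℕ) : Fin 4 →₀ ℕ := Finsupp.equivFunOnFinite.symm ![a, c, s, x]
lemma m4_eq (e : Fin 4 →₀ ℕ) : e = m4 (e 0) (e 1) (e 2) (e 3) := by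
  ext j; fin_cases j <;> simp [m4]
lemma neg_pow_sel (h2 : N2 F) {n : ℕ} {c : F} (h : c = (-1) ^ n * c) (hc : c ≠ 0) : n % 2 = 0 := by
  by_contra hn
  rw [Odd.neg_one_pow (Nat.odd_iff.2 (by omega))] at h
  apply hc
  have : (2 : F) * c = 0 := by linear_combination h
  exact (mul_eq_zero.1 this).resolve_left h2
abbrev pX (k i z : Fin d) : Rpoly F d →ₐ[F] MvPolynomial (Fin 4) F := pv F k i z X
def P4 (p : Rpoly F d) : MvPolynomial (Fin 4) F := pv F k i z X p
lemma X4 : (X : Fin 4 → MvPolynomial (Fin 4) F) = ![X 0, X 1, X 2, X 3] := by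
  ext j : 1; fin_cases j <;> rfl
lemma dil_P4 (σ : Fin 4 → F) (p : Rpoly F d) : dil σ (P4 k i z p) = pv F k i z ![C (σ 0) * X 0, C (σ 1) * X 1, C (σ 2) * X 2, C (σ 3) * X 3] p := by
  rw [P4, pv_map]; congr 2; ext j : 1; fin_cases j <;> simp [dil]
lemma sel (h2 : N2 F) (p : Rpoly F d) (hp : p ∈ invAlg F d) (e : Fin 4 →₀ ℕ) (h : coeff e (P4 k i z p) ≠ 0) :
    e 0 % 2 = 0 ∧ (e 1 + e 3) % 2 = 0 ∧ (e 0 = 0 → (e 1 + e 2) % 2 = 0) := by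
  refine ⟨?_, ?_, ?_⟩
  · refine neg_pow_sel h2 ?_ h
    have := coeff_dil ![-1, 1, 1, 1] e (P4 k i z p)
    rw [dil_P4] at this
    simp [Fin.prod_univ_four] at this
    rw [pv2 _ _ _ _ _ _ _ p hp, ← X4] at this
    exact this
  · refine neg_pow_sel h2 ?_ h
    have := coeff_dil ![1, -1, 1, -1] e (P4 k i z p)
    rw [dil_P4] at this
    simp [Fin.prod_univ_four] at this
    rw [pv1 _ _ _ _ _ _ _ p hp, ← X4] at this
    rw [pow_add]; exact this
  · intro h0
    refine neg_pow_sel h2 ?_ h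
    have := coeff_dil ![0, -1, -1, 1] e (P4 k i z p)
    have h' := coeff_dil ![0, 1, 1, 1] e (P4 k i z p)
    rw [dil_P4] at this h'
    simp [Fin.prod_univ_four, h0] at this h'
    rw [pv3 _ _ _ _ _ _ p hp, h'] at this
    rw [pow_add]; exact this
lemma sel2 (p : Rpoly F d) (hp : p ∈ invAlg F d) : coeff (m4 2 0 0 0) (P4 k i z p) = coeff (m4 0 2 0 0) (P4 k i z p) := by
  have e1 := coeff_dil ![1, 1, 0, 0] (m4 2 0 0 0) (P4 k i z p)
  have e2 := coeff_dil ![-1, -1, 0, 0] (m4 0 2 0 0) (P4 k i z p)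
  rw [dil_P4] at e1 e2
  simp [Fin.prod_univ_four, m4] at e1 e2
  rw [← pv4 _ _ _ _ _ p hp] at e1
  simp only [m4]
  rw [← e1, ← e2]
  have : pv F k i z ![-X 1, -X 0, 0, (0 : MvPolynomial (Fin 4) F)] p = rename (Equiv.swap 0 1) (pv F k i z ![-X 0, -X 1, 0, 0] p) := by
    rw [pv_map]; congr 2; ext j : 1; fin_cases j <;> simp
  rw [this, ← coeff_rename_mapDomain (Equiv.swap (0 : Fin 4) 1) (Equiv.injective _) _ (Finsupp.equivFunOnFinite.symm ![0, 2, 0, 0])]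
  congr 1
  ext j; rw [Finsupp.mapDomain_equiv_apply]; fin_cases j <;> simp [Equiv.swap_apply_def]
lemma sel0 (p : Rpoly F d) (hp : constantCoeff p = 0) : coeff 0 (P4 k i z p) = 0 := by
  have : (constantCoeff (P4 k i z p)) = constantCoeff p := by
    have e : (aeval (fun _ => (0 : F)) : MvPolynomial (Fin 4) F →ₐ[F] F).comp (pX k i z) = (aeval (fun _ => (0 : F)) : Rpoly F d →ₐ[F] F) := by
      apply algHom_ext
      rintro ⟨a, b, q⟩
      simp only [AlgHom.comp_apply, pv, sub, aeval_X]
      fin_cases a <;> fin_cases b <;> (simp [YM]; try split_ifs <;> simp)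
    have := DFunLike.congr_fun e p
    simpa [P4, aeval_zero'] using this
  rw [← constantCoeff_eq, this, hp]
def LL : Rpoly F d →ₗ[F] F :=
  (lcoeff F (m4 2 1 1 1) - lcoeff F (m4 0 3 1 1)) ∘ₗ (pX k i z).toLinearMap
lemma m4_ne {a b c e a' b' c' e' : ℕ} (h : a ≠ a') : m4 a b c e ≠ m4 a' b' c' e' := by
  intro h'; exact h (by simpa [m4] using DFunLike.congr_fun h' 0)
lemma m4_ne1 {a b c e a' b' c' e' : ℕ} (h : b ≠ b') : m4 a b c e ≠ m4 a' b' c' e' := by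
  intro h'; exact h (by simpa [m4] using DFunLike.congr_fun h' 1)
lemma m4_add {a b c e a' b' c' e' : ℕ} : m4 a b c e + m4 a' b' c' e' = m4 (a + a') (b + b') (c + c') (e + e') := by
  ext j; fin_cases j <;> simp [m4]
lemma m4_zero : m4 0 0 0 0 = 0 := by
  ext j; fin_cases j <;> simp [m4]
lemma par (a b x0 x1 x2 x3 y0 y1 y2 y3 : ℕ) (hab : a = 2 ∧ b = 0 ∨ a = 0 ∧ b = 2)
    (s1 : x0 % 2 = 0 ∧ (x1 + x3) % 2 = 0 ∧ (x0 = 0 → (x1 + x2) % 2 = 0))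
    (s2 : y0 % 2 = 0 ∧ (y1 + y3) % 2 = 0 ∧ (y0 = 0 → (y1 + y2) % 2 = 0))
    (e0 : x0 + y0 = a) (e1 : x1 + y1 = b + 1) (e2 : x2 + y2 = 1) (e3 : x3 + y3 = 1) :
    (x0 = 0 ∧ x1 = 0 ∧ x2 = 0 ∧ x3 = 0) ∨ (y0 = 0 ∧ y1 = 0 ∧ y2 = 0 ∧ y3 = 0) ∨
        (x0 = a ∧ x1 = b ∧ x2 = 0 ∧ x3 = 0 ∧ y0 = 0 ∧ y1 = 1 ∧ y2 = 1 ∧ y3 = 1) ∨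
        (y0 = a ∧ y1 = b ∧ y2 = 0 ∧ y3 = 0 ∧ x0 = 0 ∧ x1 = 1 ∧ x2 = 1 ∧ x3 = 1) := by
  obtain ⟨p1, p2, p3⟩ := s1
  obtain ⟨q1, q2, q3⟩ := s2
  have h2 : x2 = 0 ∧ y2 = 1 ∨ x2 = 1 ∧ y2 = 0 := by omega
  have h3 : x3 = 0 ∧ y3 = 1 ∨ x3 = 1 ∧ y3 = 0 := by omega
  have h0 : x0 = 0 ∧ y0 = a ∨ x0 = a ∧ y0 = 0 := by omega
  rcases hab with ⟨rfl, rfl⟩ | ⟨rfl, rfl⟩ <;> rcases h2 with ⟨rfl, rfl⟩ | ⟨rfl, rfl⟩ <;> rcases h3 with ⟨rfl, rfl⟩ | ⟨rfl, rfl⟩ <;>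
    rcases h0 with ⟨rfl, rfl⟩ | ⟨rfl, rfl⟩ <;> simp at p3 q3 ⊢ <;> omega
lemma prod_c (h2 : N2 F) (p q : Rpoly F d) (hp : p ∈ invAlg F d) (hq : q ∈ invAlg F d)
    (h0 : constantCoeff p = 0) (h1 : constantCoeff q = 0) (a b : ℕ) (hab : a = 2 ∧ b = 0 ∨ a = 0 ∧ b = 2) :
    coeff (m4 a (b + 1) 1 1) (P4 k i z p * P4 k i z q) = coeff (m4 a b 0 0) (P4 k i z p) * coeff (m4 0 1 1 1) (P4 k i z q) +
      coeff (m4 0 1 1 1) (P4 k i z p) * coeff (m4 a b 0 0) (P4 k i z q) := by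
  classical
  rw [coeff_mul, Finset.sum_eq_add (m4 a b 0 0, m4 0 1 1 1) (m4 0 1 1 1, m4 a b 0 0)]
  · intro h
    have := (Prod.ext_iff.1 h).1
    rcases hab with ⟨rfl, rfl⟩ | ⟨rfl, rfl⟩
    · exact m4_ne (by norm_num) this
    · exact m4_ne1 (by norm_num) this
  · rintro ⟨x, y⟩ hxy ⟨n1, n2⟩
    rw [Finset.HasAntidiagonal.mem_antidiagonal] at hxy
    by_contra h
    have s1 := sel k i z h2 p hp x (left_ne_zero_of_mul h)
    have s2 := sel k i z h2 q hq y (right_ne_zero_of_mul h)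
    have z1 : x ≠ 0 := by rintro rfl; exact h (by rw [sel0 _ _ _ p h0, zero_mul])
    have z2 : y ≠ 0 := by rintro rfl; exact h (by rw [sel0 _ _ _ q h1, mul_zero])
    rw [m4_eq x] at n1 n2 z1
    rw [m4_eq y] at n1 n2 z2
    have e0 : x 0 + y 0 = a := by simpa [m4] using DFunLike.congr_fun hxy 0
    have e1 : x 1 + y 1 = b + 1 := by simpa [m4] using DFunLike.congr_fun hxy 1
    have e2 : x 2 + y 2 = 1 := by simpa [m4] using DFunLike.congr_fun hxy 2
    have e3 : x 3 + y 3 = 1 := by simpa [m4] using DFunLike.congr_fun hxy 3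
    generalize x 0 = x0 at *
    generalize x 1 = x1 at *
    generalize x 2 = x2 at *
    generalize x 3 = x3 at *
    generalize y 0 = y0 at *
    generalize y 1 = y1 at *
    generalize y 2 = y2 at *
    generalize y 3 = y3 at *
    have c := par a b x0 x1 x2 x3 y0 y1 y2 y3 hab s1 s2 e0 e1 e2 e3
    rcases c with ⟨rfl, rfl, rfl, rfl⟩ | ⟨rfl, rfl, rfl, rfl⟩ | ⟨rfl, rfl, rfl, rfl, rfl, rfl, rfl, rfl⟩ | ⟨rfl, rfl, rfl, rfl, rfl, rfl, rfl, rfl⟩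
    · exact z1 m4_zero
    · exact z2 m4_zero
    · exact n1 rfl
    · exact n2 rfl
  · intro h; exact absurd (by rw [Finset.HasAntidiagonal.mem_antidiagonal, m4_add]; rfl) h
  · intro h; exact absurd (by rw [Finset.HasAntidiagonal.mem_antidiagonal, m4_add, Nat.add_comm 0 a, Nat.add_comm 1 b]; rfl) h
lemma LL_dec (h2 : N2 F) (f : Rpoly F d) (hf : f ∈ Dec F d) : LL k i z f = 0 := by
  have : Dec F d ≤ LinearMap.ker (LL k i z) := by
    rw [Dec, Submodule.span_le]
    rintro _ ⟨p, hp, q, hq, h0, h1, rfl⟩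
    have e1 := prod_c k i z h2 p q hp hq h0 h1 2 0 (by simp)
    have e2 := prod_c k i z h2 p q hp hq h0 h1 0 2 (by simp)
    rw [sel2 _ _ _ p hp, sel2 _ _ _ q hq, ← e2] at e1
    show coeff _ (pX k i z (p * q)) - coeff _ (pX k i z (p * q)) = 0
    rw [map_mul]
    exact sub_eq_zero.2 e1
  exact this hf
lemma mono4 (a b c e : ℕ) : (X 0 ^ a * X 1 ^ b * X 2 ^ c * X 3 ^ e : MvPolynomial (Fin 4) F) = monomial (m4 a b c e) 1 := by
  rw [monomial_eq, Finsupp.prod_fintype _ _ (by simp), Fin.prod_univ_four]; simp [m4]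
lemma LL_base (hk : k ≠ z) (hi : i ≠ z) :
    LL k i z (trace (evMat F d (om (nl F (k, true)) (nl F (i, false))) * genMat F d z)) = 16 := by
  have g : ∀ q, (pX k i z).mapMatrix (genMat F d q) = YM (if q = k then 1 else 0) (if q = i then 1 else 0) (if q = z then 1 else 0) (X : Fin 4 → MvPolynomial (Fin 4) F) := fun q => sub_gen _ q
  have gt : ∀ q, (pX k i z).mapMatrix (genMat F d q)ᵀ = (YM (if q = k then 1 else 0) (if q = i then 1 else 0) (if q = z then 1 else 0) (X : Fin 4 → MvPolynomial (Fin 4) F))ᵀ := fun q => by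
    rw [← g q]; ext a b; simp
  have eK : (pX k i z).mapMatrix (evMat F d (nl F (k, true))) = !![0, 2 * X 1, 0; -(2 * X 1), 0, 2 * X 0; 0, -(2 * X 0), 0] := by
    rw [nl, map_add, map_smul, ev_ι, ev_ι, map_add, map_smul]
    simp only [if_true, false_eq_true, if_false, g, gt, hk]
    refine Matrix.ext fun a b => ?_; fin_cases a <;> fin_cases b <;> simp [YM, eps] <;> ring
  have eS : (pX k i z).mapMatrix (evMat F d (nl F (i, false))) = !![2 * X 2, 0, 0; 0, -(2 * X 2), 0; 0, 0, 0] := by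
    rw [nl, map_add, map_smul, ev_ι, ev_ι, map_add, map_smul]
    simp only [if_true, false_eq_true, if_false, g, gt, hi]
    refine Matrix.ext fun a b => ?_; fin_cases a <;> fin_cases b <;> simp [YM, eps] <;> ring
  have eX : (pX k i z).mapMatrix (genMat F d z) = !![0, X 3, 0; X 3, 0, 0; 0, 0, 0] := by
    rw [g, if_neg hk.symm, if_neg hi.symm, if_pos rfl]
    refine Matrix.ext fun a b => ?_; fin_cases a <;> fin_cases b <;> simp [YM]
  have e : pX k i z (trace (evMat F d (om (nl F (k, true)) (nl F (i, false))) * genMat F d z)) =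
      monomial (m4 2 1 1 1) (-16) + monomial (m4 0 3 1 1) (-32) := by
    rw [tr_map, om, map_mul, map_mul, map_mul, map_mul, map_mul, map_mul, map_mul, eK, eS, eX]
    have : ∀ (m : Fin 4 →₀ ℕ) (c : F), monomial m c = C c * monomial m 1 := by intro m c; rw [C_mul_monomial, mul_one]
    rw [this, this _ (-32), ← mono4, ← mono4, show (C (-16 : F) : MvPolynomial (Fin 4) F) = -16 by rw [C_neg, map_ofNat], show (C (-32 : F) : MvPolynomial (Fin 4) F) = -32 by rw [C_neg, map_ofNat]]
    simp [Matrix.trace_fin_three, Matrix.mul_apply, sum_univ_three]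
    ring
  have : ∀ x, LL k i z x = coeff (m4 2 1 1 1) (pX (F := F) k i z x) - coeff (m4 0 3 1 1) (pX (F := F) k i z x) := fun x => rfl
  rw [this, e]
  simp only [coeff_add, coeff_monomial, if_true, if_neg (m4_ne (show (2 : ℕ) ≠ 0 by norm_num)), if_neg (m4_ne (show (0 : ℕ) ≠ 2 by norm_num))]
  norm_num
lemma base_case (h2 : N2 F) (hk : k ≠ z) (hi : i ≠ z) (c : F) (u : FA F d)
    (hu : pQ u = c • pQ (om (nl F (k, true)) (nl F (i, false)))) (hD : trace (evMat F d u * genMat F d z) ∈ Dec F d) : u ∈ idealA F d := by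
  have h1 : u - c • om (nl F (k, true)) (nl F (i, false)) ∈ idealA F d := by
    rw [← pQ_eq, map_sub, map_smul, hu, sub_self]
  have h3 := easy h2 _ h1 (ι F (z, false)) (mf_ι _)
  rw [ev_ι, map_sub, sub_mul, trace_sub, map_smul, smul_mul_assoc, Matrix.trace_smul] at h3
  have h4 := Submodule.sub_mem _ hD h3
  simp only [false_eq_true, if_false, sub_sub_cancel] at h4
  have h5 := LL_dec k i z h2 _ h4
  rw [map_smul, LL_base k i z hk hi, smul_eq_mul] at h5
  have h16 : (16 : F) ≠ 0 := by
    rw [show (16 : F) = 2 ^ 4 by norm_num]; exact pow_ne_zero _ h2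
  have hc := (mul_eq_zero.1 h5).resolve_right h16
  rw [← pQ_eq, hu, hc, zero_smul]
end base
section gen
variable {F : Type} [Field F] {d : ℕ} {Λ : Type}
def GoodY (Y : Fin d → M3 (MvPolynomial Λ (Rpoly F d))) : Prop :=
  ∀ g : M3 F, gᵀ * g = 1 → ∀ q, (mapAlgHom (σ := Λ) (actHom F d g)).mapMatrix (Y q) =
    (g.map (algebraMap F (MvPolynomial Λ (Rpoly F d))))ᵀ * Y q * g.map (algebraMap F (MvPolynomial Λ (Rpoly F d)))
variable {Y : Fin d → M3 (MvPolynomial Λ (Rpoly F d))}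
lemma gl_inv (hY : GoodY Y) (p : Rpoly F d) (hp : p ∈ invAlg F d) (m : Λ →₀ ℕ) : coeff m (sub Y p) ∈ invAlg F d := by
  intro g hg
  have : mapAlgHom (σ := Λ) (actHom F d g) (sub Y p) = sub Y p := by
    rw [sub_comp]; exact inv_sub _ _ g hg (hY g hg) p hp
  conv_rhs => rw [← this]
  rw [mapAlgHom_apply]
  exact (coeff_map _ _ _).symm
def ccA : Rpoly F d →ₐ[F] F := aeval fun _ => (0 : F)
lemma ccA_eq (p : Rpoly F d) : ccA p = constantCoeff p := by rw [ccA, aeval_zero']; rfl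
lemma gl_cc (p : Rpoly F d) (m : Λ →₀ ℕ) : constantCoeff (coeff m (sub Y p)) = coeff m (sub (F := F) (fun q => (mapAlgHom (σ := Λ) ccA).mapMatrix (Y q)) p) := by
  rw [← sub_comp, ← ccA_eq]
  exact (coeff_map _ _ _).symm
lemma gl_dec (hY : GoodY Y) (m : Λ →₀ ℕ)
    (hc : ∀ p ∈ invAlg F d, constantCoeff p = 0 → ∀ e ≤ m, constantCoeff (coeff e (sub Y p)) = 0)
    (x : Rpoly F d) (hx : x ∈ Dec F d) : coeff m (sub Y x) ∈ Dec F d := by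
  classical
  induction hx using span_induction with
  | mem x hx =>
    obtain ⟨p, hp, q, hq, h0, h1, rfl⟩ := hx
    rw [map_mul, coeff_mul]
    refine Submodule.sum_mem _ fun e he => ?_
    rw [Finset.HasAntidiagonal.mem_antidiagonal] at he
    exact dec_mul (gl_inv hY p hp _) (gl_inv hY q hq _) (hc p hp h0 _ (he ▸ le_self_add)) (hc q hq h1 _ (he ▸ le_add_self))
  | zero => rw [map_zero, coeff_zero]; exact Submodule.zero_mem _
  | add a b _ _ ha hb => rw [map_add, coeff_add]; exact Submodule.add_mem _ ha hb
  | smul r a _ ha => rw [map_smul, coeff_smul]; exact smul_mem _ _ ha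
def cM (Λ : Type) (M : M3 (Rpoly F d)) : M3 (MvPolynomial Λ (Rpoly F d)) :=
  (C : Rpoly F d →+* MvPolynomial Λ (Rpoly F d)).mapMatrix M
lemma gl_G (g : M3 F) : g.map (algebraMap F (MvPolynomial Λ (Rpoly F d))) = cM Λ (g.map (algebraMap F (Rpoly F d))) := by
  refine Matrix.ext fun a b => ?_
  simp only [cM, map_apply, RingHom.mapMatrix_apply]; exact MvPolynomial.algebraMap_apply _
lemma cM_t (M : M3 (Rpoly F d)) : cM Λ Mᵀ = (cM Λ M)ᵀ := by refine Matrix.ext fun a b => ?_; simp [cM]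
lemma cM_ok (g : M3 F) (hg : gᵀ * g = 1) (a : FA F d) :
    (mapAlgHom (σ := Λ) (actHom F d g)).mapMatrix (cM Λ (evMat F d a)) =
      (g.map (algebraMap F (MvPolynomial Λ (Rpoly F d))))ᵀ * cM Λ (evMat F d a) * g.map (algebraMap F (MvPolynomial Λ (Rpoly F d))) := by
  rw [gl_G, ← cM_t, cM, cM, cM, ← map_mul, ← map_mul, ← act_ev g hg]
  refine Matrix.ext fun x y => ?_
  simp
lemma cM_cc (a : FA F d) (ha : a ∈ MFsub F d) : (mapAlgHom (σ := Λ) (ccA (F := F) (d := d))).mapMatrix (cM Λ (evMat F d a)) = 0 := by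
  have := cc_ev a ha
  refine Matrix.ext fun x y => ?_
  have h := congrFun (congrFun this x) y
  simp only [RingHom.mapMatrix_apply, map_apply, Matrix.zero_apply] at h
  simp [cM, ccA_eq, h]
end gen
section der
variable {F : Type} [Field F] {d : ℕ} (k : Fin d)
abbrev u1 : Unit →₀ ℕ := Finsupp.single () 1
lemma c0_mul {R : Type} [CommRing R] (p q : MvPolynomial Unit R) : coeff 0 (p * q) = coeff 0 p * coeff 0 q := by
  simp only [← constantCoeff_eq, map_mul]
lemma c1_mul {R : Type} [CommRing R] (p q : MvPolynomial Unit R) : coeff u1 (p * q) = coeff 0 p * coeff u1 q + coeff u1 p * coeff 0 q := by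
  classical
  rw [coeff_mul, Finsupp.antidiagonal_single, Finset.sum_map, Finset.Nat.antidiagonal_succ]
  simp
def Yd (k : Fin d) : Fin d → M3 (MvPolynomial Unit (Rpoly F d)) := fun q =>
  cM Unit (genMat F d q) + (if q = k then (X () : MvPolynomial Unit (Rpoly F d)) else 0) • (1 : M3 (MvPolynomial Unit (Rpoly F d)))
lemma gen_ev (q : Fin d) : genMat F d q = evMat F d (ι F (q, false)) := by rw [ev_ι]; rfl
lemma Yd_good : GoodY (F := F) (Yd k) := by
  intro g hg q
  have hG : (g.map (algebraMap F (MvPolynomial Unit (Rpoly F d))))ᵀ * g.map (algebraMap F (MvPolynomial Unit (Rpoly F d))) = 1 := by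
    rw [← transpose_map, ← Matrix.map_mul, hg, Matrix.map_one _ (map_zero _) (map_one _)]
  rw [Yd, map_add, gen_ev, cM_ok g hg, mul_add, add_mul, mul_smul_comm, mul_one, smul_mul_assoc, hG]
  congr 1
  split_ifs
  · refine Matrix.ext fun x y => ?_; simp [Matrix.one_apply, apply_ite]; intro h1 h2; exact absurd h1 h2
  · refine Matrix.ext fun x y => ?_; simp
def lin (Z : Fin d → M3 F) (p : Rpoly F d) : F :=
  coeff u1 (sub (F := F) (fun q => (X () : MvPolynomial Unit F) • (Z q).map (C : F → MvPolynomial Unit F)) p)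
lemma lin0 (Z : Fin d → M3 F) (p : Rpoly F d) :
    coeff 0 (sub (F := F) (fun q => (X () : MvPolynomial Unit F) • (Z q).map (C : F → MvPolynomial Unit F)) p) = constantCoeff p := by
  induction p using induction_on with
  | C a => simp [sub]
  | add p q hp hq => rw [map_add, coeff_add, hp, hq, map_add]
  | mul_X p i hp => rw [map_mul, c0_mul, hp, map_mul]; simp [sub]; right; rw [c0_mul]; simp
lemma lin_add (Z Z' : Fin d → M3 F) (p : Rpoly F d) : lin (Z + Z') p = lin Z p + lin Z' p := by
  induction p using induction_on with
  | C a =>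
    have : (0 : Unit →₀ ℕ) ≠ u1 := fun h => by simpa using DFunLike.congr_fun h ()
    simp [sub, lin, coeff_C, algebraMap_eq, this]
  | add p q hp hq =>
    simp only [lin, map_add, coeff_add] at *
    rw [hp, hq]; ring
  | mul_X p i hp =>
    have e : ∀ Z : Fin d → M3 F, lin Z (p * X i) = constantCoeff p * Z i.2.2 i.1 i.2.1 := by
      intro Z
      rw [lin, map_mul, c1_mul, lin0]
      have : sub (F := F) (fun q => (X () : MvPolynomial Unit F) • (Z q).map (C : F → MvPolynomial Unit F)) (X i) = C (Z i.2.2 i.1 i.2.1) * X () := by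
        simp [sub, mul_comm]
      rw [this, coeff_C_mul, coeff_C_mul]; simp [coeff_X']
    rw [e, e, e]; simp [mul_add]
def Ei (k : Fin d) (i : Fin 3) : Fin d → M3 F := fun q => if q = k then Matrix.diagonal (Pi.single i 1) else 0
def sgi : Fin 2 → Fin 3 → Fin 3 := ![![1, 0, 2], ![2, 1, 0]]
lemma lin_inv (e : Fin 2) (p : Rpoly F d) (hp : p ∈ invAlg F d) : lin (Ei k (sgi e 0)) p = lin (Ei k 0) p := by
  have hs : ∀ a b, sgi e a = b ↔ a = sgi e b := by revert e; decide
  have hi : ∀ a b, sgi e a = sgi e b ↔ a = b := by revert e; decide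
  have hss : ∀ a, sgi e (sgi e a) = a := by revert e; decide
  unfold lin
  congr 1
  refine inv_sub _ _ (Matrix.of fun a b => if sgi e a = b then 1 else 0) ?_ ?_ p hp
  · ext a b; simp [Matrix.mul_apply, hs, Matrix.one_apply, hi, hss, eq_comm]
  · intro q
    unfold Ei
    split_ifs
    · refine Matrix.ext fun a b => ?_
      simp [Matrix.mul_apply, diagonal_apply, Pi.single_apply, hs, apply_ite, hi]
      rw [hss]
      by_cases h1 : a = b
      · subst h1; by_cases h2 : a = sgi e 0
        · simp [h2]
        · simp [h2]
      · simp [h1, Ne.symm h1]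
    · simp
lemma Yd_cc (h3 : (3 : F) = 0) (p : Rpoly F d) (hp : p ∈ invAlg F d) : constantCoeff (coeff u1 (sub (F := F) (Yd (F := F) k) p)) = 0 := by
  rw [gl_cc]
  have e : (fun q => (mapAlgHom (σ := Unit) (ccA (F := F) (d := d))).mapMatrix (Yd k q)) = fun q => (X () : MvPolynomial Unit F) • ((Ei k 0 + Ei k 1 + Ei k 2 : Fin d → M3 F) q).map (C : F → MvPolynomial Unit F) := by
    funext q
    rw [Yd, map_add, gen_ev, cM_cc _ (mf_ι _), zero_add]
    refine Matrix.ext fun a b => ?_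
    by_cases h : q = k
    · fin_cases a <;> fin_cases b <;> simp [Ei, h, Matrix.one_apply, diagonal_apply, Pi.single_apply]
    · simp [Ei, h]
  rw [e]
  change lin _ p = 0
  rw [lin_add, lin_add, show lin (Ei k 1) p = _ from lin_inv k 0 p hp, show lin (Ei k 2) p = _ from lin_inv k 1 p hp]
  linear_combination (lin (Ei k 0) p) * h3
lemma Yd_0 (p : Rpoly F d) : coeff 0 (sub (F := F) (Yd k) p) = p := by
  induction p using induction_on with
  | C a => simp [sub, MvPolynomial.algebraMap_apply]
  | add p q hp hq => rw [map_add, coeff_add, hp, hq]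
  | mul_X p i hp =>
    rw [map_mul, c0_mul, hp]
    congr 1
    simp [sub, Yd, cM, genMat]
    split_ifs <;> simp [Matrix.one_apply]
    split_ifs <;> simp
lemma ev_0 (u : FA F d) (a b) : coeff 0 (((sub (F := F) (Yd k)).mapMatrix (evMat F d u)) a b) = evMat F d u a b := by
  simp only [AlgHom.mapMatrix_apply, map_apply, Yd_0]
lemma ev_1 (u : FA F d) : ∀ a b, coeff u1 (((sub (F := F) (Yd k)).mapMatrix (evMat F d u)) a b) = evMat F d (dd k u) a b := by
  induction u using FreeAlgebra.induction with
  | grade0 r =>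
    intro a b
    have e : dd k (algebraMap F (FA F d) r) = 0 := by rw [algebraMap_eq_smul_one, map_smul, dd_one, smul_zero]
    have : (0 : Unit →₀ ℕ) ≠ u1 := fun h => by simpa using DFunLike.congr_fun h ()
    rw [e, commutes, commutes, map_zero, algebraMap_eq_diagonal, diagonal_apply]
    split_ifs <;> simp [MvPolynomial.algebraMap_apply, coeff_C, this]
  | grade1 x =>
    intro a b
    have e : ∀ i j q, coeff u1 (sub (F := F) (Yd k) (X (i, j, q))) = if q = k then (1 : M3 (Rpoly F d)) i j else 0 := by
      intro i j q
      simp only [sub, aeval_X, Yd, Matrix.add_apply, coeff_add, cM, RingHom.mapMatrix_apply, map_apply, genMat, of_apply, coeff_C]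
      rw [if_neg (fun h => by simpa using DFunLike.congr_fun h ())]
      split_ifs <;> simp [Matrix.one_apply, apply_ite (coeff u1), coeff_X']
    obtain ⟨q, t⟩ := x
    rw [ev_ι, dd_ι]
    cases t <;> simp only [AlgHom.mapMatrix_apply, map_apply, genMat, of_apply, transpose_apply, e, false_eq_true, if_false, if_true] <;> split_ifs <;> simp [Matrix.one_apply, eq_comm]
  | mul u v hu hv =>
    intro a b
    rw [map_mul, map_mul, Matrix.mul_apply, coeff_sum, dd_mul, map_add, map_mul, map_mul, Matrix.add_apply, Matrix.mul_apply, Matrix.mul_apply, ← sum_add_distrib]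
    exact sum_congr rfl fun i _ => by rw [c1_mul, hu, hv, ev_0, ev_0]
  | add u v hu hv =>
    intro a b
    rw [map_add, map_add, Matrix.add_apply, coeff_add, hu, hv, map_add, map_add, Matrix.add_apply]
lemma D_dd (h3 : (3 : F) = 0) (z : Fin d) (hz : k ≠ z) (u : FA F d) (hD : trace (evMat F d u * genMat F d z) ∈ Dec F d) :
    trace (evMat F d (dd k u) * genMat F d z) ∈ Dec F d := by
  have h := gl_dec (Yd_good k) u1 ?_ _ hD
  · convert h using 1
    rw [gen_ev, ← map_mul, ← map_mul, tr_map, Matrix.trace, Matrix.trace, coeff_sum]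
    refine sum_congr rfl fun i _ => ?_
    rw [diag_apply, diag_apply, ev_1, dd_mul, dd_ι, if_neg (Ne.symm hz), mul_zero, zero_add]
  · intro p hp h0 e he
    have : e = 0 ∨ e = u1 := by
      have h1 := he ()
      rcases Nat.le_one_iff_eq_zero_or_eq_one.1 (by simpa using h1) with h | h
      · left; ext; simpa using h
      · right; ext; simpa using h
    rcases this with rfl | rfl
    · rw [Yd_0, h0]
    · exact Yd_cc k h3 p hp
end der
section hom
variable {F : Type} [Field F] {d : ℕ} (z : Fin d)
def Hs (F : Type) [Field F] {d : ℕ} (z : Fin d) (α : Multiset (Ltr d)) : Submodule F (FA F d) :=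
  Submodule.span F {x | ∃ l : List (Ltr d), (l : Multiset (Ltr d)) = α ∧ (∀ p ∈ l, p.1 ≠ z) ∧ x = Thw F l}
def cA : M3 (Rpoly F d) →ₐ[F] M3 (MvPolynomial (Ltr d) (Rpoly F d)) :=
  (IsScalarTower.toAlgHom F (Rpoly F d) (MvPolynomial (Ltr d) (Rpoly F d))).mapMatrix
lemma cA_eq (M : M3 (Rpoly F d)) : cM (Ltr d) M = cA M := rfl
lemma cA_t (M : M3 (Rpoly F d)) : (cA M)ᵀ = cA Mᵀ := (cM_t M).symm
def Yh (F : Type) [Field F] {d : ℕ} (z : Fin d) : Fin d → M3 (MvPolynomial (Ltr d) (Rpoly F d)) := fun q =>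
  if q = z then cM _ (evMat F d (ι F (z, false))) else
    (X (q, false) : MvPolynomial (Ltr d) (Rpoly F d)) • cM _ (evMat F d ((2⁻¹ : F) • nl F (q, false))) +
    (X (q, true) : MvPolynomial (Ltr d) (Rpoly F d)) • cM _ (evMat F d ((2⁻¹ : F) • nl F (q, true)))
lemma mA_smul {S : Type} [CommRing S] [Algebra F S] (f : Rpoly F d →ₐ[F] S) (q : Ltr d) (M : M3 (MvPolynomial (Ltr d) (Rpoly F d))) :
    (mapAlgHom (σ := Ltr d) f).mapMatrix ((X q : MvPolynomial (Ltr d) (Rpoly F d)) • M) = (X q : MvPolynomial (Ltr d) S) • (mapAlgHom (σ := Ltr d) f).mapMatrix M := by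
  refine Matrix.ext fun a b => ?_
  simp
lemma Yh_good : GoodY (F := F) (Yh F z) := by
  intro g hg q
  unfold Yh
  split_ifs
  · exact cM_ok g hg _
  · rw [map_add, mA_smul, mA_smul, cM_ok g hg, cM_ok g hg, mul_add, add_mul, mul_smul_comm, smul_mul_assoc, mul_smul_comm, smul_mul_assoc]
lemma Yh_cc (p : Rpoly F d) (h : constantCoeff p = 0) (e : Ltr d →₀ ℕ) : constantCoeff (coeff e (sub (F := F) (Yh F z) p)) = 0 := by
  rw [gl_cc]
  have : (fun q => (mapAlgHom (σ := Ltr d) (ccA (F := F) (d := d))).mapMatrix (Yh F z q)) = fun q => 0 := by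
    funext q
    unfold Yh
    split_ifs
    · exact cM_cc _ (mf_ι _)
    · rw [map_add, mA_smul, mA_smul, cM_cc _ (smul_mem _ _ (mf_nl _)), cM_cc _ (smul_mem _ _ (mf_nl _))]; simp
  rw [this]
  have : sub (F := F) (fun q : Fin d => (0 : M3 (MvPolynomial (Ltr d) F))) p = 0 := by
    have : sub (F := F) (fun q : Fin d => (0 : M3 (MvPolynomial (Ltr d) F))) = aeval fun _ => 0 := by
      unfold sub; simp
    rw [this, aeval_zero', h, map_zero]
  rw [this, coeff_zero]
lemma hlp {V : Type} [AddCommGroup V] [Module F V] (h : F) (hh : h + h = 1) (P Q : V) : h • (P + Q) + (-1 : F) • h • (P - Q) = Q := by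
  rw [neg_smul, one_smul, ← sub_eq_add_neg, ← smul_sub, add_sub_sub_cancel, smul_add, ← add_smul, hh, one_smul]
lemma hlp2 {V : Type} [AddCommGroup V] [Module F V] (P : V) : (-1 : F) • P = -P := by rw [neg_smul, one_smul]
lemma Yh_nl (h2 : N2 F) (s : Ltr d) (hs : s.1 ≠ z) : (sub (F := F) (Yh F z)).mapMatrix (evMat F d (nl F s)) =
    (X s : MvPolynomial (Ltr d) (Rpoly F d)) • cA (evMat F d (nl F s)) := by
  have tr : ∀ M : M3 (Rpoly F d), (sub (F := F) (Yh F z)).mapMatrix Mᵀ = ((sub (F := F) (Yh F z)).mapMatrix M)ᵀ := fun M => rfl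
  have t : ∀ b, (evMat F d (nl F (s.1, b)))ᵀ = eps F b • evMat F d (nl F (s.1, b)) := fun b => by
    rw [← ev_tp, tp_nl, map_smul]
  have e : Yh F z s.1 = (2⁻¹ : F) • ((X (s.1, false) : MvPolynomial (Ltr d) (Rpoly F d)) • cA (evMat F d (nl F (s.1, false))) +
    (X (s.1, true) : MvPolynomial (Ltr d) (Rpoly F d)) • cA (evMat F d (nl F (s.1, true)))) := by
    rw [Yh, if_neg hs, cA_eq, cA_eq]
    simp only [map_smul, smul_add, smul_comm (2⁻¹ : F)]
  have hh : (2⁻¹ : F) + 2⁻¹ = 1 := by field_simp; norm_num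
  obtain ⟨q, b⟩ := s
  conv_lhs => rw [nl]
  simp only [map_add, map_smul, ev_ι, false_eq_true, if_false, if_true]
  simp only at e t
  rw [tr, sub_gen, e, transpose_smul, transpose_add, transpose_smul, transpose_smul, cA_t, cA_t, t, t]
  generalize hP : (X (q, false) : MvPolynomial (Ltr d) (Rpoly F d)) • cA (evMat F d (nl F (q, false))) = P
  generalize hQ : (X (q, true) : MvPolynomial (Ltr d) (Rpoly F d)) • cA (evMat F d (nl F (q, true))) = Q
  have e1 : (2⁻¹ : F) • (P + Q) + (2⁻¹ : F) • (P - Q) = P := by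
    rw [← smul_add, add_add_sub_cancel, smul_add, ← add_smul, hh, one_smul]
  have e3 : (X (q, true) : MvPolynomial (Ltr d) (Rpoly F d)) • cA (eps F true • evMat F d (nl F (q, true))) = -Q := by
    rw [show eps F true = -1 by simp [eps], hlp2, map_neg, smul_neg, hQ]
  have e4 : (X (q, false) : MvPolynomial (Ltr d) (Rpoly F d)) • cA (eps F false • evMat F d (nl F (q, false))) = P := by
    rw [map_smul, ← hP]; simp [eps]
  rw [e3, e4, ← sub_eq_add_neg]
  cases b
  · rw [hP, show eps F false = 1 by simp [eps], one_smul, e1]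
  · rw [hQ, show eps F true = -1 by simp [eps]]; exact hlp _ hh P Q
lemma Yh_Thw (h2 : N2 F) (l : List (Ltr d)) (hl : ∀ p ∈ l, p.1 ≠ z) : (sub (F := F) (Yh F z)).mapMatrix (evMat F d (Thw F l)) =
    (monomial (toFinsupp (l : Multiset (Ltr d))) 1 : MvPolynomial (Ltr d) (Rpoly F d)) • cA (evMat F d (Thw F l)) := by
  induction l with
  | nil => simp [Thw_nil]
  | cons s l ih =>
    rw [Thw_cons, map_mul, map_mul, map_mul, Yh_nl z h2 s (hl s (by simp)), ih fun p hp => hl p (by simp [hp]), smul_mul_smul_comm,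
      ← cons_coe, ← singleton_add, map_add, Multiset.toFinsupp_singleton]
    congr 1
    rw [X, monomial_mul, one_mul]
lemma Hs_coeff (h2 : N2 F) (α β : Multiset (Ltr d)) (v : FA F d) (hv : v ∈ Hs F z β) :
    coeff (toFinsupp α) (sub (F := F) (Yh F z) (trace (evMat F d v * genMat F d z))) = if β = α then trace (evMat F d v * genMat F d z) else 0 := by
  classical
  induction hv using span_induction with
  | mem x hx =>
    obtain ⟨l, rfl, hl, rfl⟩ := hx
    rw [tr_map, map_mul, Yh_Thw z h2 l hl, sub_gen, Yh, if_pos rfl, cA_eq, smul_mul_assoc, ← map_mul, ← gen_ev, trace_smul]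
    have : trace (cA (evMat F d (Thw F l) * genMat F d z)) = (C (trace (evMat F d (Thw F l) * genMat F d z)) : MvPolynomial (Ltr d) (Rpoly F d)) := by
      exact (tr_map (IsScalarTower.toAlgHom F (Rpoly F d) (MvPolynomial (Ltr d) (Rpoly F d))) _).symm
    rw [this, smul_eq_mul, mul_comm, coeff_C_mul, coeff_monomial]
    simp
  | zero => simp
  | add a b _ _ ha hb => rw [map_add, add_mul, trace_add, map_add, coeff_add, ha, hb]; split_ifs <;> simp
  | smul r a _ ha => rw [map_smul, smul_mul_assoc, trace_smul, map_smul, coeff_smul, ha]; split_ifs <;> simp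
lemma hom_red (h2 : N2 F) (f : Multiset (Ltr d) →₀ FA F d) (hf : ∀ α, f α ∈ Hs F z α)
    (hD : trace (evMat F d (f.sum fun _ x => x) * genMat F d z) ∈ Dec F d) (α) : trace (evMat F d (f α) * genMat F d z) ∈ Dec F d := by
  classical
  have h := gl_dec (Yh_good z) (toFinsupp α) (fun p _ h0 e _ => Yh_cc z p h0 e) _ hD
  rw [Finsupp.sum, map_sum, Finset.sum_mul, trace_sum, map_sum, coeff_sum, sum_congr rfl fun β _ => Hs_coeff z h2 α β _ (hf β),
    Finset.sum_ite_eq'] at h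
  by_cases hα : α ∈ f.support
  · rwa [if_pos hα] at h
  · rw [Finsupp.notMem_support_iff.1 hα]; simp
end hom
section main
variable {F : Type} [Field F] {d : ℕ} (z : Fin d)
lemma cnt (x : Ltr d) (l : List (Ltr d)) : Multiset.count x (l : Multiset (Ltr d)) = List.count x l := by
  induction l with
  | nil => rfl
  | cons y l ih => rw [← cons_coe, Multiset.count_cons, ih, List.count_cons]; simp only [beq_iff_eq, @eq_comm _ y x]
lemma Hs_mul (s : Ltr d) (hs : s.1 ≠ z) (α) (v : FA F d) (hv : v ∈ Hs F z α) : nl F s * v ∈ Hs F z (s ::ₘ α) := by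
  induction hv using span_induction with
  | mem x hx =>
    obtain ⟨l, rfl, hl, rfl⟩ := hx
    exact Submodule.subset_span ⟨s :: l, rfl, List.forall_mem_cons.2 ⟨hs, hl⟩, (Thw_cons _ _).symm⟩
  | zero => rw [mul_zero]; exact Submodule.zero_mem _
  | add a b _ _ ha hb => rw [mul_add]; exact Submodule.add_mem _ ha hb
  | smul r a _ ha => rw [mul_smul_comm]; exact smul_mem _ _ ha
lemma dd_nl0 (k : Fin d) (s : Ltr d) (hs : s ≠ (k, false)) : dd k (nl F s) = 0 := by
  obtain ⟨q, b⟩ := s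
  rw [dd_nl]
  cases b
  · rw [if_neg (fun h => hs (by simp at h; rw [h])), zero_smul]
  · simp [eps]
lemma dd0 (k : Fin d) (l : List (Ltr d)) (h : (k, false) ∉ l) : dd k (Thw F l) = 0 := by
  induction l with
  | nil => rw [Thw_nil, dd_one]
  | cons s l ih =>
    rw [List.mem_cons, not_or] at h
    rw [Thw_cons, dd_mul, ih h.2, dd_nl0 k s (Ne.symm h.1)]; simp
lemma dd_w (k : Fin d) (l : List (Ltr d)) (hl : ∀ p ∈ l, p.1 ≠ z) : dd k (Thw F l) ∈ Hs F z ((l : Multiset (Ltr d)).erase (k, false)) := by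
  induction l with
  | nil => rw [Thw_nil, dd_one]; exact Submodule.zero_mem _
  | cons s l ih =>
    have ih := ih fun p hp => hl p (by simp [hp])
    have hs := hl s (by simp)
    rw [Thw_cons, dd_mul, ← cons_coe]
    by_cases h : s = (k, false)
    · subst h
      rw [Multiset.erase_cons_head]
      refine Submodule.add_mem _ ?_ ?_
      · by_cases hm : (k, false) ∈ l
        · have := Hs_mul z _ hs _ _ ih
          rwa [Multiset.cons_erase (by simpa using hm)] at this
        · rw [dd0 k l hm, mul_zero]; exact Submodule.zero_mem _
      · rw [dd_nl, smul_mul_assoc, one_mul]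
        exact smul_mem _ _ (Submodule.subset_span ⟨l, rfl, fun p hp => hl p (by simp [hp]), rfl⟩)
    · rw [dd_nl0 k s h, zero_mul, add_zero, Multiset.erase_cons_tail _ h]
      exact Hs_mul z s hs _ _ ih
lemma dd_Hs (k : Fin d) (α) (v : FA F d) (hv : v ∈ Hs F z α) : dd k v ∈ Hs F z (α.erase (k, false)) ∧ ((k, false) ∉ α → dd k v = 0) := by
  induction hv using span_induction with
  | mem x hx =>
    obtain ⟨l, rfl, hl, rfl⟩ := hx
    exact ⟨dd_w z k l hl, fun h => dd0 k l (by simpa using h)⟩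
  | zero => rw [map_zero]; exact ⟨Submodule.zero_mem _, fun _ => rfl⟩
  | add a b _ _ ha hb => rw [map_add]; exact ⟨Submodule.add_mem _ ha.1 hb.1, fun h => by rw [ha.2 h, hb.2 h, add_zero]⟩
  | smul r a _ ha => rw [map_smul]; exact ⟨smul_mem _ _ ha.1, fun h => by rw [ha.2 h, smul_zero]⟩
lemma Hs_I (α) (P : Submodule F (QA F d)) (h : ∀ l : List (Ltr d), (l : Multiset (Ltr d)) = α → pQ (Thw F l) ∈ P) (v : FA F d) (hv : v ∈ Hs F z α) : pQ v ∈ P := by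
  have : Hs F z α ≤ P.comap pQ := Submodule.span_le.2 (by rintro x ⟨l, hl, -, rfl⟩; exact h l hl)
  exact this hv
lemma Hs_four (h2 : N2 F) (α) (x) (hx : 4 ≤ Multiset.count x α) (v : FA F d) (hv : v ∈ Hs F z α) : v ∈ idealA F d := by
  rw [← pQ_eq]
  have := Hs_I z α ⊥ (fun l hl => by rw [Submodule.mem_bot, pQ_eq]; exact I_four h2 x l (by rw [← cnt, hl]; exact hx)) v hv
  simpa using this
lemma cardfib {n : ℕ} (f : Fin n → Ltr d) (s) : Fintype.card {a // f a = s} = Multiset.count s (univ.val.map f) := by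
  rw [Multiset.count_map, Fintype.card_subtype]
  simp only [eq_comm]; rfl
lemma case_pol [Infinite F] (h2 : N2 F) (α : Multiset (Ltr d)) (hα : ((∏ s, (α.count s).factorial : ℕ) : F) ≠ 0) (hz : ∀ p ∈ α, p.1 ≠ z)
    (u : FA F d) (hu : u ∈ Hs F z α) (hD : trace (evMat F d u * genMat F d z) ∈ Dec F d) : u ∈ idealA F d := by
  have key : ∀ l : List (Ltr d), (l : Multiset (Ltr d)) = α → ∃ g : Fin (Multiset.card α) → Ltr d, l = ofFn g ∧ univ.val.map g = α := by
    rintro l rfl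
    refine ⟨l.get, by simp, ?_⟩
    exact (Fin.univ_val_map l.get).trans (congrArg _ (List.ofFn_get l))
  obtain ⟨l0, -, h0⟩ := key α.toList (by simp)
  refine pol_main l0 z h2 (fun i => hz _ ?_) ?_ u ?_ hD
  · rw [← h0]; simp
  · simp only [cardfib, h0]; exact hα
  · refine Submodule.span_mono ?_ hu
    rintro x ⟨l, hl, -, rfl⟩
    obtain ⟨g, rfl, hg⟩ := key l hl
    have e : ∀ s, Fintype.card {a // g a = s} = Fintype.card {a // l0 a = s} := fun s => by rw [cardfib, cardfib, hg, h0]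
    refine ⟨Equiv.ofFiberEquiv fun s => Fintype.equivOfCardEq (e s), ?_⟩
    congr 2
    funext i
    exact (Equiv.ofFiberEquiv_map _ i).symm
lemma hom_main [Infinite F] (h2 : N2 F) (N : ℕ) : ∀ (α : Multiset (Ltr d)), Multiset.card α = N → ∀ u ∈ Hs F z α,
    trace (evMat F d u * genMat F d z) ∈ Dec F d → u ∈ idealA F d := by
  induction N using Nat.strong_induction_on with
  | _ N IH =>
  intro α hN u hu hD
  by_cases hz : ∀ p ∈ α, p.1 ≠ z
  swap
  · rw [← pQ_eq]
    have : Hs F z α ≤ ⊥ := Submodule.span_le.2 (by rintro x ⟨l, rfl, hl, rfl⟩; exact absurd (by simpa using hl) hz)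
    rw [(Submodule.mem_bot F).1 (this hu), map_zero]
  by_cases h4 : ∃ x, 4 ≤ Multiset.count x α
  · obtain ⟨x, hx⟩ := h4; exact Hs_four z h2 α x hx u hu
  push Not at h4
  by_cases hf : ((∏ s, (α.count s).factorial : ℕ) : F) = 0
  swap
  · exact case_pol z h2 α hf hz u hu hD
  rw [Nat.cast_prod, Finset.prod_eq_zero_iff] at hf
  obtain ⟨s, -, hs⟩ := hf
  have hs3 : α.count s = 3 ∧ (3 : F) = 0 := by
    have := h4 s
    generalize α.count s = c at *
    interval_cases c
    · simp at hs
    · simp at hs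
    · exact absurd (by simpa [Nat.factorial] using hs) h2
    · refine ⟨rfl, ?_⟩
      have h6 : (2 : F) * 3 = 0 := by rw [← hs]; norm_num [Nat.factorial]
      exact (mul_eq_zero.1 h6).resolve_left h2
  obtain ⟨hs3, h3⟩ := hs3
  have hdd : ∀ k, dd k u ∈ idealA F d := by
    intro k
    by_cases hk : (k, false) ∈ α
    · have hc := Multiset.card_erase_lt_of_mem hk
      exact IH _ (hN ▸ hc) _ rfl _ (dd_Hs z k α u hu).1 (D_dd k h3 z (hz _ hk) u hD)
    · rw [(dd_Hs z k α u hu).2 hk]; exact (idealA F d).zero_mem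
  by_cases hsym : ∃ k, α.count (k, false) = 3
  · obtain ⟨k, hk⟩ := hsym
    have hm : (k, false) ∈ α := Multiset.count_pos.1 (by omega)
    have h1 := dd_I h2 h3 k _ (Hs_four z h2 _ (k, false) (by rw [Multiset.count_cons_self, hk]) _ (Hs_mul z (k, false) (hz _ hm) α u hu))
    rw [dd_mul, dd_nl] at h1
    have h5 := (idealA F d).sub_mem h1 ((idealA F d).mul_mem_left (nl F (k, false)) _ (hdd k))
    rw [add_sub_cancel_left, ← pQ_eq, smul_mul_assoc, one_mul, map_smul, smul_eq_zero] at h5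
    rw [← pQ_eq]
    refine h5.resolve_left ?_
    simpa [eps, one_add_one_eq_two] using h2
  · push Not at hsym
    obtain ⟨k, b⟩ := s
    cases b
    · exact absurd hs3 (hsym k)
    obtain ⟨β, hβ⟩ : ∃ β, α = (k, true) ::ₘ (k, true) ::ₘ (k, true) ::ₘ β := by
      have := Multiset.le_count_iff_replicate_le.1 hs3.ge
      obtain ⟨β, rfl⟩ := Multiset.le_iff_exists_add.1 this
      exact ⟨β, by simp [Multiset.replicate_succ]⟩
    have hu' : pQ u ∈ SV F k β := Hs_I z α _ (fun l hl => nf2 k h2 h3 l (by rw [← cnt, hl, hs3]) β (hl.trans hβ)) u hu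
    have hcnt : ∀ s : Ltr d, s.2 = false → Multiset.count s β ≤ 2 := by
      rintro ⟨q, b⟩ hb
      simp only at hb; subst hb
      have h6 := h4 (q, false)
      have h7 := hsym q
      have : β.count (q, false) ≤ α.count (q, false) := Multiset.count_le_of_le _ (by rw [hβ]; exact ((Multiset.le_cons_self _ _).trans (Multiset.le_cons_self _ _)).trans (Multiset.le_cons_self _ _))
      omega
    rcases skewmain k h2 h3 β hcnt u hu' hdd with h | ⟨i, c, rfl, hc⟩
    · exact h
    · exact base_case k i z h2 (hz (k, true) (by simp [hβ])) (hz (i, false) (by simp [hβ])) c u hc hD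
lemma word_span (h2 : N2 F) (l : List (Ltr d)) (hl : ∀ p ∈ l, p.1 ≠ z) : wordOf F d l ∈ ⨆ α, Hs F z α := by
  have hh : (2⁻¹ : F) + 2⁻¹ = 1 := by field_simp; norm_num
  have hi : ∀ p : Ltr d, ∃ c : F, ι F p = (2⁻¹ : F) • nl F (p.1, false) + c • nl F (p.1, true) := by
    rintro ⟨q, b⟩
    cases b
    · refine ⟨2⁻¹, ?_⟩
      rw [nl, nl, ← smul_add]; simp only [eps, if_true, false_eq_true, if_false, one_smul]
      rw [neg_smul, one_smul, add_add_add_comm, add_neg_cancel, add_zero, smul_add, ← add_smul, hh, one_smul]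
    · refine ⟨-2⁻¹, ?_⟩
      rw [nl, nl, neg_smul, ← sub_eq_add_neg, ← smul_sub]; simp only [eps, if_true, false_eq_true, if_false, one_smul]
      rw [neg_smul, one_smul, add_sub_add_left_eq_sub, sub_neg_eq_add, smul_add, ← add_smul, hh, one_smul]
  have hm : ∀ s : Ltr d, s.1 ≠ z → ∀ v ∈ ⨆ α, Hs F z α, nl F s * v ∈ ⨆ α, Hs F z α := by
    intro s hs v hv
    have : (⨆ α, Hs F z α) ≤ (⨆ α, Hs F z α).comap (LinearMap.mulLeft F (nl F s)) :=
      iSup_le fun α x hx => (le_iSup (Hs F z) _) (Hs_mul z s hs α x hx)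
    exact this hv
  induction l with
  | nil => exact (le_iSup (Hs F z) 0) (Submodule.subset_span ⟨[], rfl, by simp, rfl⟩)
  | cons p l ih =>
    obtain ⟨c, hc⟩ := hi p
    have ih := ih fun p hp => hl p (by simp [hp])
    have hp := hl p (by simp)
    have : wordOf F d (p :: l) = ι F p * wordOf F d l := by simp [wordOf]
    rw [this, hc, add_mul, smul_mul_assoc, smul_mul_assoc]
    exact Submodule.add_mem _ (smul_mem _ _ (hm (p.1, false) hp _ ih)) (smul_mem _ _ (hm (p.1, true) hp _ ih))
lemma hard [Infinite F] (h2 : N2 F) (u : FA F d) (hu : u ∈ ⨆ α, Hs F z α) (hD : trace (evMat F d u * genMat F d z) ∈ Dec F d) : u ∈ idealA F d := by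
  obtain ⟨f, hf, rfl⟩ := (Submodule.mem_iSup_iff_exists_finsupp _ _).1 hu
  rw [← pQ_eq, Finsupp.sum, map_sum]
  exact Finset.sum_eq_zero fun α _ => (pQ_eq _).2 (hom_main z h2 _ α rfl _ (hf α) (hom_red z h2 f hf hD α))
end main
end
end Stmt17

theorem stmt17 (F : Type) [Field F] [Infinite F] (h2 : ringChar F ≠ 2) (d : ℕ) (hd : 1 ≤ d)
    (u : FA F d)
    (hu : u ∈ Submodule.span F {y : FA F d | ∃ l : List (Ltr d), l ≠ [] ∧
        (∀ p ∈ l, p.1 ≠ (⟨0, hd⟩ : Fin d)) ∧ y = wordOf F d l}) :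
    Matrix.trace (evMat F d u * genMat F d ⟨0, hd⟩) ∈ decompSet F d ↔ u ∈ idealA F d := by
  have h : (2 : F) ≠ 0 := Ring.two_ne_zero h2
  rw [Stmt17.dec_iff]
  refine ⟨Stmt17.hard _ h u ?_, fun hI => ?_⟩
  · refine Submodule.span_le.2 ?_ hu
    rintro x ⟨l, -, hl, rfl⟩
    exact Stmt17.word_span _ h l hl
  · rw [Stmt17.gen_ev]
    exact Stmt17.easy h u hI _ (Stmt17.mf_ι _)
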